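/- For every integer n ≥ 4, the diagonal Ramsey number of the 4-uniform loose cycle satisfies R(C^4_n, C^4_n) ≤ 3n + ⌊n/2⌋; that is, every red-blue coloring of the 4-element subsets of a set of 3n + ⌊n/2⌋ vertices contains a monochromatic copy of C^4_n. -/

import Mathlib

/-- A copy of the `k`-uniform loose path with `n` edges, all of color `b`
(`true` = red, `false` = blue), in the coloring `col` of the `k`-subsets of `V`.
The path is given by an injective listing `f 0, f 1, …, f (n*(k-1))` of its
vertices, with `i`-th edge `{f (i*(k-1)), …, f (i*(k-1)+k-1)}`. -/
def HasLoosePath {V : Type*} [DecidableEq V] (k n : ℕ) (col : Finset V → Bool)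
    (b : Bool) : Prop :=
  ∃ f : ℕ → V, Set.InjOn f (Set.Iio (n * (k - 1) + 1)) ∧
    ∀ i < n, col ((Finset.range k).image fun j => f (i * (k - 1) + j)) = b

/-- A copy of the `k`-uniform loose cycle with `n` edges, all of color `b`
(`true` = red, `false` = blue), in the coloring `col` of the `k`-subsets of `V`.
The cycle is given by an injective listing `f 0, …, f (n*(k-1) - 1)` of its
vertices, with `i`-th edge `{f (i*(k-1) % (n*(k-1))), …, f ((i*(k-1)+k-1) % (n*(k-1)))}`. -/
def HasLooseCycle {V : Type*} [DecidableEq V] (k n : ℕ) (col : Finset V → Bool)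
    (b : Bool) : Prop :=
  ∃ f : ℕ → V, Set.InjOn f (Set.Iio (n * (k - 1))) ∧
    ∀ i < n, col ((Finset.range k).image fun j => f ((i * (k - 1) + j) % (n * (k - 1)))) = b

/-- `R(P^k_n, P^k_m)`: the least positive `N` such that every red-blue coloring of the
`k`-subsets of an `N`-set contains a red `P^k_n` or a blue `P^k_m`. -/
noncomputable def RamseyPP (k n m : ℕ) : ℕ :=
  sInf {N | 0 < N ∧ ∀ col : Finset (Fin N) → Bool,
    HasLoosePath k n col true ∨ HasLoosePath k m col false}

/-- `R(P^k_n, C^k_m)`. -/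
noncomputable def RamseyPC (k n m : ℕ) : ℕ :=
  sInf {N | 0 < N ∧ ∀ col : Finset (Fin N) → Bool,
    HasLoosePath k n col true ∨ HasLooseCycle k m col false}

/-- `R(C^k_n, P^k_m)`. -/
noncomputable def RamseyCP (k n m : ℕ) : ℕ :=
  sInf {N | 0 < N ∧ ∀ col : Finset (Fin N) → Bool,
    HasLooseCycle k n col true ∨ HasLoosePath k m col false}

/-- `R(C^k_n, C^k_m)`. -/
noncomputable def RamseyCC (k n m : ℕ) : ℕ :=
  sInf {N | 0 < N ∧ ∀ col : Finset (Fin N) → Bool,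
    HasLooseCycle k n col true ∨ HasLooseCycle k m col false}

namespace LC
variable {V : Type*} [DecidableEq V]

/-- walk along a list in steps of three -/
def Wk (col : Finset V → Bool) (b : Bool) : V → List V → V → Prop
  | s, [], t => s = t
  | s, x :: y :: u :: r, t => col {s, x, y, u} = b ∧ Wk col b u r t
  | _, [_], _ => False
  | _, [_, _], _ => False

/-- loose walk with `n` edges from `s` to `t`, all vertices but the first distinct and in `J` -/
def W (col : Finset V → Bool) (b : Bool) (n : ℕ) (s t : V) (J : Finset V) : Prop :=
  ∃ l : List V, l.length = 3 * n ∧ l.Nodup ∧ (∀ x ∈ l, x ∈ J) ∧ Wk col b s l t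

theorem Wk_append {col : Finset V → Bool} {b : Bool} : ∀ {s : V} {l : List V} {t u : V} {l' : List V},
    Wk col b s l t → Wk col b t l' u → Wk col b s (l ++ l') u
  | s, [], t, u, l', h, h' => by simp only [Wk] at h; subst h; simpa using h'
  | s, x :: y :: v :: r, t, u, l', h, h' => by
      simp only [Wk, List.cons_append] at h ⊢
      exact ⟨h.1, Wk_append h.2 h'⟩
  | _, [_], _, _, _, h, _ => by simp [Wk] at h
  | _, [_, _], _, _, _, h, _ => by simp [Wk] at h

theorem W.mono {col : Finset V → Bool} {b : Bool} {n : ℕ} {s t : V} {J K : Finset V}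
    (h : W col b n s t J) (hJ : J ⊆ K) : W col b n s t K := by
  obtain ⟨l, h1, h2, h3, h4⟩ := h
  exact ⟨l, h1, h2, fun x hx => hJ (h3 x hx), h4⟩

theorem W.append {col : Finset V → Bool} {b : Bool} {n m : ℕ} {s t u : V} {J K : Finset V}
    (h : W col b n s t J) (h' : W col b m t u K) (hd : Disjoint J K) :
    W col b (n + m) s u (J ∪ K) := by
  obtain ⟨l, h1, h2, h3, h4⟩ := h
  obtain ⟨l', h1', h2', h3', h4'⟩ := h'
  refine ⟨l ++ l', by simp [h1, h1']; ring, ?_, ?_, Wk_append h4 h4'⟩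
  · rw [List.nodup_append]
    refine ⟨h2, h2', ?_⟩
    intro a ha b hb hab
    subst hab
    exact (Finset.disjoint_left.mp hd (h3 a ha)) (h3' a hb)
  · intro x hx
    rcases List.mem_append.mp hx with hx | hx
    · exact Finset.mem_union_left _ (h3 x hx)
    · exact Finset.mem_union_right _ (h3' x hx)

theorem W.zero {col : Finset V → Bool} {b : Bool} (s : V) (J : Finset V) : W col b 0 s s J :=
  ⟨[], by simp, by simp, by simp, by simp [Wk]⟩

theorem Wk_rev {col : Finset V → Bool} {b : Bool} : ∀ {s : V} {l : List V} {t : V},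
    Wk col b s l t → ∃ l', Wk col b t l' s ∧ (t :: l').Perm (s :: l)
  | s, [], t, h => by simp only [Wk] at h; subst h; exact ⟨[], by simp [Wk], by simp⟩
  | s, x :: y :: v :: r, t, h => by
      simp only [Wk] at h
      obtain ⟨l', h1, h2⟩ := Wk_rev h.2
      refine ⟨l' ++ [y, x, s], Wk_append h1 ?_, ?_⟩
      · simp only [Wk, and_true]
        rw [← h.1]; congr 1; ext a; simp only [Finset.mem_insert, Finset.mem_singleton]; tauto
      · have : (t :: (l' ++ [y, x, s])).Perm ((v :: r) ++ [y, x, s]) := by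
          rw [← List.cons_append]; exact h2.append_right _
        refine this.trans ?_
        have h5 : ([y, x, s] ++ (v :: r)).Perm (s :: x :: y :: v :: r) := by
          have : ([y,x,s]).Perm [s,x,y] := by
            have := List.reverse_perm [s,x,y]
            simpa using this
          exact this.append_right _
        exact List.perm_append_comm.trans h5
  | _, [_], _, h => by simp [Wk] at h
  | _, [_, _], _, h => by simp [Wk] at h

theorem W.rev {col : Finset V → Bool} {b : Bool} {n : ℕ} {s t : V} {X : Finset V}
    (h : W col b n s t (insert t X)) (hs : s ∉ X) (hst : s ≠ t) :
    W col b n t s (insert s X) := by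
  obtain ⟨l, h1, h2, h3, h4⟩ := h
  obtain ⟨l', h5, h6⟩ := Wk_rev h4
  have hsl : s ∉ l := fun h => by
    have := h3 s h
    simp [hst, hs] at this
  have hnd : (t :: l').Nodup := h6.nodup_iff.mpr (List.nodup_cons.mpr ⟨hsl, h2⟩)
  refine ⟨l', ?_, (List.nodup_cons.mp hnd).2, ?_, h5⟩
  · have := h6.length_eq
    simp at this; omega
  · intro x hx
    have hxt : x ≠ t := fun e => (List.nodup_cons.mp hnd).1 (e ▸ hx)
    have : x ∈ s :: l := h6.subset (List.mem_cons_of_mem _ hx)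
    rcases List.mem_cons.mp this with e | e
    · simp [e]
    · have := h3 x e
      simp only [Finset.mem_insert] at this ⊢
      tauto

theorem W.one {col : Finset V → Bool} {b : Bool} {s x y t : V} {J : Finset V}
    (h : col {s, x, y, t} = b) (hx : x ∈ J) (hy : y ∈ J) (ht : t ∈ J) (hxy : x ≠ y) (hxt : x ≠ t)
    (hyt : y ≠ t) : W col b 1 s t J :=
  ⟨[x, y, t], by simp, by simp [hxy, hxt, hyt], by simp [hx, hy, ht], by simp [Wk, h]⟩

/-! ### checker -/

def ek (a b c d : ℕ) : ℕ := 2 ^ a ||| 2 ^ b ||| 2 ^ c ||| 2 ^ d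

/-- edges keys of a label path -/
def eks : ℕ → List ℕ → List ℕ
  | s, x :: y :: u :: r => ek s x y u :: eks u r
  | _, _ => []

/-- a constraint: no path of color `b` with `n` edges from `s` to `t` with interior in `M` -/
structure Con where
  b : Bool
  n : ℕ
  s : ℕ
  t : ℕ
  M : List ℕ

def okl (M : List ℕ) (t : ℕ) : List ℕ → Bool
  | [] => false
  | [x] => x == t
  | x :: r => (M.contains x && !(r.contains x)) && okl M t r

inductive Cert where
  | done : Cert
  | step : ℕ → List ℕ → Cert → Cert
  | split : ℕ → Cert → Cert → Cert

def known (env : List (ℕ × Bool)) (m : ℕ) (b : Bool) : Bool :=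
  env.any fun x => x.1 == m && x.2 == b

def chk (cs : List Con) : Cert → List (ℕ × Bool) → Bool
  | .done, _ => false
  | .step k p r, env =>
    match cs[k]? with
    | none => false
    | some c =>
      (okl c.M c.t p && p.length == 3 * c.n) &&
      match (eks c.s p).filter (fun e => !(known env e c.b)) with
      | [] => true
      | [e] => chk cs r ((e, !c.b) :: env)
      | _ => false
  | .split m l r, env => chk cs l ((m, true) :: env) && chk cs r ((m, false) :: env)

def bits (m : ℕ) : Finset ℕ := (Finset.range (m + 1)).filter (fun i => m.testBit i = true)

theorem bits_ek (a b c d : ℕ) : bits (ek a b c d) = {a, b, c, d} := by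
  ext i
  have : ∀ m, i ∈ bits m ↔ m.testBit i = true := by
    intro m
    simp only [bits, Finset.mem_filter, Finset.mem_range, and_iff_right_iff_imp]
    intro h
    have := Nat.ge_two_pow_of_testBit h
    have h2 : i < 2 ^ i := Nat.lt_two_pow_self
    omega
  rw [this]
  simp only [ek, Nat.testBit_or, Nat.testBit_two_pow, Bool.or_eq_true, decide_eq_true_eq,
    Finset.mem_insert, Finset.mem_singleton]
  constructor
  · rintro (((h | h) | h) | h) <;> simp [h]
  · rintro (h | h | h | h) <;> simp [h]

/-- colors of edge keys -/
def ec (col : Finset V → Bool) (φ : ℕ → V) (m : ℕ) : Bool := col ((bits m).image φ)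

theorem ec_ek (col : Finset V → Bool) (φ : ℕ → V) (a b c d : ℕ) :
    ec col φ (ek a b c d) = col {φ a, φ b, φ c, φ d} := by
  simp [ec, bits_ek, Finset.image_insert]

def Con.holds (col : Finset V → Bool) (φ : ℕ → V) (c : Con) : Prop :=
  ∀ p : List ℕ, okl c.M c.t p = true → p.length = 3 * c.n →
    ¬ ∀ e ∈ eks c.s p, ec col φ e = c.b

theorem chk_sound (col : Finset V → Bool) (φ : ℕ → V) (cs : List Con)
    (hc : ∀ c ∈ cs, c.holds col φ) : ∀ (ct : Cert) (env : List (ℕ × Bool)),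
    (∀ x ∈ env, ec col φ x.1 = x.2) → chk cs ct env = true → False
  | .done, env, _, h => by simp [chk] at h
  | .step k p r, env, he, h => by
      rw [chk] at h
      split at h
      · simp at h
      rename_i c hk
      simp only [Bool.and_eq_true, beq_iff_eq] at h
      obtain ⟨⟨h1, h2⟩, h3⟩ := h
      have hcc := hc c (List.mem_of_getElem? hk) p h1 h2
      have key : ∀ e, known env e c.b = true → ec col φ e = c.b := by
        intro e h
        simp only [known, List.any_eq_true, Bool.and_eq_true, beq_iff_eq] at h
        obtain ⟨x, hx, h4, h5⟩ := h
        rw [← h4, ← h5]; exact he x hx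
      split at h3
      · rename_i hf
        apply hcc
        intro e hee
        apply key
        by_contra hn
        have : e ∈ (eks c.s p).filter (fun e => !(known env e c.b)) := by
          simpa [List.mem_filter, hee] using hn
        rw [hf] at this; simp at this
      · rename_i e0 hf
        refine chk_sound col φ cs hc r _ ?_ h3
        intro x hx
        rcases List.mem_cons.mp hx with hx | hx
        · subst hx
          by_contra hne
          apply hcc
          intro e hee
          by_cases hk : known env e c.b = true
          · exact key e hk
          · have : e ∈ (eks c.s p).filter (fun e => !(known env e c.b)) := by
              simp [List.mem_filter, hee, hk]
            rw [hf] at this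
            simp only [List.mem_singleton] at this
            subst this
            simpa using hne
        · exact he x hx
      · simp at h3
  | .split m l r, env, he, h => by
      rw [chk, Bool.and_eq_true] at h
      cases hm : ec col φ m
      · refine chk_sound col φ cs hc r _ ?_ h.2
        intro x hx
        rcases List.mem_cons.mp hx with hx | hx
        · subst hx; exact hm
        · exact he x hx
      · refine chk_sound col φ cs hc l _ ?_ h.1
        intro x hx
        rcases List.mem_cons.mp hx with hx | hx
        · subst hx; exact hm
        · exact he x hx

theorem okl_spec (M : List ℕ) (t : ℕ) (ht : t ∉ M) : ∀ p, okl M t p = true →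
    p.Nodup ∧ (∀ x ∈ p, x ∈ t :: M)
  | [], h => by simp [okl] at h
  | [x], h => by simp [okl] at h; simp [h]
  | x :: y :: r, h => by
      simp only [okl, Bool.and_eq_true, List.contains_iff_mem, Bool.not_eq_true',
        ] at h
      obtain ⟨⟨h1, h2⟩, h3⟩ := h
      obtain ⟨h4, h5⟩ := okl_spec M t ht (y :: r) h3
      refine ⟨List.nodup_cons.mpr ⟨?_, h4⟩, ?_⟩
      · intro hc
        rw [← List.contains_iff_mem, h2] at hc; simp at hc
      · intro z hz
        rcases List.mem_cons.mp hz with hz | hz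
        · subst hz; exact List.mem_cons_of_mem _ h1
        · exact h5 z hz

theorem eks_Wk (col : Finset V → Bool) (φ : ℕ → V) (b : Bool) (M : List ℕ) (t : ℕ) :
    ∀ (n : ℕ) (s : ℕ) (p : List ℕ), okl M t p = true → p.length = 3 * n →
    (∀ e ∈ eks s p, ec col φ e = b) → Wk col b (φ s) (p.map φ) (φ t)
  | 0, s, p, h, hl, _ => by
      have : p = [] := by simpa using hl
      subst this; simp [okl] at h
  | n + 1, s, p, h, hl, he => by
      match p, hl with
      | x :: y :: u :: r, hl =>
        simp only [eks, List.mem_cons, forall_eq_or_imp] at he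
        simp only [List.map, Wk]
        refine ⟨by rw [← he.1, ec_ek], ?_⟩
        cases r with
        | nil =>
          simp only [okl, Bool.and_eq_true, beq_iff_eq] at h
          simp [Wk, h.2]
        | cons x' r =>
          apply eks_Wk col φ b M t n u (x' :: r) ?_ ?_ he.2
          · simp only [okl, Bool.and_eq_true] at h
            exact h.2.2.2
          · simp at hl ⊢; omega
      | [], hl => simp at hl
      | [_], hl => simp at hl; omega
      | [_, _], hl => simp at hl; omega

theorem holds_of (col : Finset V → Bool) (φ : ℕ → V) (b : Bool) (n s t : ℕ) (M : List ℕ) (J : Finset V)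
    (hinj : ((t :: M).map φ).Nodup) (hJ : ∀ x ∈ (t :: M).map φ, x ∈ J)
    (hW : ¬ W col b n (φ s) (φ t) J) : Con.holds col φ ⟨b, n, s, t, M⟩ := by
  intro p h1 h2 h3
  apply hW
  have ht : t ∉ M := fun h => by
    simp only [List.map, List.nodup_cons] at hinj
    exact hinj.1 (List.mem_map_of_mem h)
  obtain ⟨h4, h5⟩ := okl_spec M t ht p h1
  refine ⟨p.map φ, by simpa using h2, ?_, ?_, eks_Wk col φ b M t n s p h1 h2 h3⟩
  · refine List.Nodup.map_on ?_ h4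
    intro x hx y hy hxy
    exact List.inj_on_of_nodup_map hinj (h5 x hx) (h5 y hy) hxy
  · intro x hx
    obtain ⟨a, ha, rfl⟩ := List.mem_map.mp hx
    exact hJ _ (List.mem_map_of_mem (h5 a ha))

/-- numbered labelling from a list -/
def lab (d : V) (L : List V) (i : ℕ) : V := L.getD i d

end LC

namespace LC
theorem P6_chk : chk [
  ⟨true, 2, 0, 1, [2, 3, 4, 5, 6]⟩,
  ⟨true, 2, 0, 1, [2, 3, 4, 5, 7]⟩,
  ⟨false, 2, 6, 7, [0, 1, 2, 3, 4, 5]⟩] (.split 102 (.step 0 [3, 4, 6, 2, 5, 1] <| .step 2 [0, 4, 3, 1, 5, 7] <| .step 2 [0, 3, 4, 1, 5, 7] <| .step 1 [2, 4, 7, 3, 5, 1] <| .step 1 [2, 3, 7, 4, 5, 1] <| .step 2 [1, 3, 2, 0, 4, 7] <| .step 2 [4, 5, 0, 2, 3, 7] <| .step 0 [4, 5, 6, 2, 3, 1] .done) (.step 2 [1, 2, 5, 0, 4, 7] <| .step 2 [1, 5, 2, 0, 4, 7] <| .step 1 [4, 5, 7, 2, 3, 1] <| .step 1 [2, 4, 7,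 3, 5, 1] <| .step 2 [4, 5, 1, 2, 3, 7] <| .step 2 [0, 2, 3, 1, 5, 7] <| .step 0 [2, 3, 6, 4, 5, 1] .done)) [] = true := by decide +kernel

theorem F3_0_chk : chk [
  ⟨true, 3, 0, 1, [2, 3, 4, 5, 6, 7, 8, 9, 10, 11]⟩,
  ⟨false, 2, 7, 8, [1, 3, 4, 5, 6]⟩,
  ⟨false, 2, 7, 9, [0, 2, 3, 4, 5, 6]⟩,
  ⟨false, 2, 8, 9, [0, 2, 3, 4, 5, 6]⟩,
  ⟨false, 2, 10, 11, [0, 2, 3, 4, 5, 6]⟩] (.split 141 (.split 1124 (.step 0 [3, 7, 2, 5, 10, 6, 4, 8, 1] <| .step 0 [3, 7, 2, 6, 10, 5, 4, 8, 1] <| .step 1 [3, 5, 1, 4, 6, 8] <| .step 1 [3, 6, 1, 4, 5, 8] <| .step 0 [4, 11, 6, 2, 10, 5, 3, 7, 1] <| .step 0 [4, 8, 5, 2, 10, 6, 3, 7, 1] <| .step 4 [2, 5, 4, 0, 6, 11] <| .step 3 [4, 5, 0, 2, 6, 9] <| .step 0 [6, 9, 2, 4, 10, 5, 3, 7, 1]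 .done) (.step 4 [2, 6, 5, 3, 4, 11] <| .step 4 [5, 6, 2, 0, 4, 11] <| .step 4 [5, 6, 2, 3, 4, 11] <| .step 0 [2, 7, 3, 5, 11, 4, 6, 8, 1] <| .step 1 [3, 5, 1, 4, 6, 8] <| .step 0 [6, 9, 2, 4, 11, 3, 5, 7, 1] <| .step 0 [2, 11, 4, 6, 8, 3, 5, 7, 1] <| .step 3 [3, 4, 6, 0, 2, 9] .done)) (.step 2 [2, 3, 0, 4, 6, 9] <| .step 2 [0, 2, 3, 4, 5, 9] <| .step 2 [0, 3, 2, 5, 6, 9] <| .step 2 [0, 2, 3, 4, 6, 9] <| .step 2 [2, 3, 0, 4, 5, 9] <| .split 1124 (.step 0 [4, 9, 5, 2, 10, 6, 3, 8, 1] <| .step 0 [4, 9, 6, 2, 10, 5, 3, 7, 1] <| .step 0 [4, 9, 5, 2, 10, 6, 3, 7, 1] <| .step 1 [4, 5, 3, 1, 6, 8] <| .step 1 [3, 5, 1, 4, 6, 8] <| .step 1 [3, 6, 1, 4, 5, 8] <| .step 0 [2, 9, 5, 3, 7, 4, 6, 8, 1] <| .step 0 [3, 7, 6, 2, 9, 5,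 4, 8, 1] <| .step 2 [3, 6, 0, 2, 5, 9] .done) (.step 4 [5, 6, 2, 0, 4, 11] <| .step 4 [5, 6, 2, 0, 3, 11] <| .step 0 [2, 11, 4, 6, 9, 3, 5, 7, 1] <| .step 0 [2, 11, 3, 5, 9, 4, 6, 8, 1] <| .step 1 [3, 5, 1, 4, 6, 8] .done))) [] = true := by decide +kernel

theorem F3_1_chk : chk [
  ⟨true, 3, 0, 1, [2, 3, 4, 5, 6, 7, 8, 9, 10, 11]⟩,
  ⟨false, 2, 7, 8, [1, 3, 4, 5, 6]⟩,
  ⟨false, 2, 9, 10, [0, 2, 3, 4, 5, 6]⟩,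
  ⟨false, 2, 9, 11, [0, 2, 3, 4, 5, 6]⟩,
  ⟨false, 2, 10, 11, [0, 2, 3, 4, 5, 6]⟩] (.split 354 (.split 596 (.step 0 [3, 11, 2, 4, 9, 6, 5, 8, 1] <| .step 0 [3, 10, 4, 2, 9, 6, 5, 8, 1] <| .step 0 [3, 11, 4, 2, 9, 6, 5, 8, 1] <| .step 3 [4, 6, 0, 2, 3, 11] <| .step 3 [4, 5, 3, 0, 2, 11] <| .step 4 [3, 4, 0, 2, 5, 11] <| .step 4 [2, 6, 3, 0, 4, 11] <| .step 0 [4, 9, 6, 2, 10, 3, 5, 7, 1] <| .step 0 [2, 11, 5, 3, 9, 4, 6, 8, 1] <| .step 1 [3, 5, 1, 4, 6, 8] .done) (.step 2 [2, 6, 4, 3, 5, 10] <| .step 3 [4, 6, 2, 0, 3, 11] <| .step 0 [2, 11, 3, 4, 10, 5, 6, 8, 1] .done)) (.step 1 [3, 4, 1, 5, 6, 8] <| .split 596 (.step 0 [5, 10, 6, 2, 9, 4, 3, 7, 1] <| .step 0 [5, 11, 6, 2, 9, 4, 3, 7, 1] <| .step 0 [5, 11, 2, 6, 9, 4, 3,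 7, 1] <| .step 2 [2, 4, 5, 0, 6, 10] <| .step 4 [2, 3, 0, 5, 6, 11] <| .step 4 [4, 6, 0, 2, 5, 11] <| .step 0 [6, 10, 4, 2, 9, 5, 3, 8, 1] <| .step 0 [3, 10, 2, 5, 9, 4, 6, 7, 1] <| .step 1 [4, 6, 1, 3, 5, 8] .done) (.step 2 [2, 4, 6, 0, 5, 10] <| .step 3 [4, 6, 2, 3, 5, 11] <| .step 0 [6, 10, 5, 2, 11, 3, 4, 7, 1] .done))) [] = true := by decide +kernel

theorem F3_2_chk : chk [
  ⟨true, 3, 0, 1, [2, 3, 4, 5, 6, 7, 8, 9, 10, 11]⟩,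
  ⟨false, 2, 7, 8, [1, 3, 4, 5, 6]⟩,
  ⟨false, 2, 7, 9, [0, 2, 3, 4, 5, 6]⟩,
  ⟨false, 2, 7, 10, [0, 2, 3, 4, 5, 6]⟩,
  ⟨false, 2, 8, 11, [0, 2, 3, 4, 5, 6]⟩,
  ⟨false, 2, 9, 10, [0, 2, 3, 4, 5, 6]⟩] (.split 269 (.split 612 (.step 0 [3, 8, 2, 5, 9, 6, 4, 7, 1] <| .step 0 [3, 8, 2, 6, 9, 5, 4, 7, 1] <| .step 1 [4, 6, 1, 3, 5, 8] <| .step 1 [4, 5, 1, 3, 6, 8] <| .step 0 [4, 10, 6, 2, 9, 5, 3, 8, 1] <| .step 3 [3, 5, 4, 0, 6, 10] <| .step 5 [2, 5, 0, 4, 6, 10] <| .step 0 [2, 9, 5, 4, 7, 3, 6, 8, 1] .done) (.step 2 [0, 4, 2, 5, 6, 9] <| .step 5 [2, 5, 6, 3, 4, 10] <| .step 5 [2, 6, 5, 3, 4, 10] <| .step 0 [2, 7, 4, 6, 10, 3, 5, 8, 1] <| .step 0 [2, 8, 3, 5, 10, 4, 6, 7, 1] <| .step 1 [4, 6, 1,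 3, 5, 8] .done)) (.step 4 [2, 3, 0, 4, 5, 11] <| .step 4 [2, 3, 0, 4, 6, 11] <| .step 4 [0, 2, 3, 4, 5, 11] <| .step 4 [0, 3, 2, 4, 6, 11] <| .split 228 (.step 0 [4, 11, 6, 2, 7, 5, 3, 8, 1] <| .step 0 [4, 11, 5, 2, 7, 6, 3, 8, 1] <| .step 1 [4, 6, 1, 3, 5, 8] <| .step 1 [4, 5, 1, 3, 6, 8] <| .step 0 [2, 10, 5, 3, 11, 4, 6, 7, 1] <| .step 0 [3, 9, 6, 2, 11, 4, 5, 7, 1] <| .step 5 [3, 6, 0, 2, 5, 10] .done) (.step 2 [5, 6, 2, 0, 4, 9] <| .step 2 [2, 5, 6, 0, 3, 9] <| .step 0 [2, 9, 4, 5, 11, 3, 6, 8, 1] <| .step 0 [3, 9, 6, 2, 11, 4, 5, 7, 1] <| .step 1 [4, 5, 1, 3, 6, 8] .done))) [] = true := by decide +kernel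

theorem F3_3_chk : chk [
  ⟨true, 3, 0, 1, [2, 3, 4, 5, 6, 7, 8, 9, 10, 11]⟩,
  ⟨false, 2, 7, 8, [1, 3, 4, 5, 6]⟩,
  ⟨false, 2, 7, 9, [0, 2, 3, 4, 5, 6]⟩,
  ⟨false, 2, 8, 10, [0, 2, 3, 4, 5, 6]⟩,
  ⟨false, 2, 9, 11, [0, 2, 3, 4, 5, 6]⟩,
  ⟨false, 2, 10, 11, [0, 2, 3, 4, 5, 6]⟩] (.split 141 (.split 612 (.step 0 [3, 7, 2, 5, 9, 6, 4, 8, 1] <| .step 0 [3, 7, 2, 6, 9, 5, 4, 8, 1] <| .step 1 [3, 5, 1, 4, 6, 8] <| .step 1 [3, 6, 1, 4, 5, 8] <| .step 0 [4, 10, 6, 2, 9, 5, 3, 7, 1] <| .step 0 [4, 11, 6, 2, 9, 5, 3, 7, 1] <| .step 3 [3, 5, 4, 0, 6, 10] <| .step 4 [2, 5, 0, 4, 6, 11] <| .step 0 [2, 9, 5, 4, 8, 3, 6, 7, 1] .done) (.step 2 [0, 4, 2, 5, 6, 9] <| .step 4 [2, 6, 5, 3, 4, 11] <| .step 4 [2,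 5, 6, 3, 4, 11] <| .step 4 [5, 6, 2, 0, 3, 11] <| .step 0 [2, 7, 4, 6, 11, 3, 5, 8, 1] <| .step 1 [4, 6, 1, 3, 5, 8] <| .step 0 [2, 8, 3, 5, 11, 4, 6, 7, 1] <| .step 0 [3, 11, 2, 5, 10, 6, 4, 7, 1] <| .step 3 [0, 3, 2, 5, 6, 10] .done)) (.step 2 [0, 2, 3, 5, 6, 9] <| .step 2 [0, 3, 2, 4, 5, 9] <| .step 2 [2, 3, 0, 4, 6, 9] <| .step 2 [0, 3, 2, 5, 6, 9] <| .step 2 [0, 2, 3, 4, 6, 9] <| .step 2 [2, 3, 0, 4, 5, 9] <| .split 356 (.step 0 [4, 9, 6, 2, 8, 5, 3, 7, 1] <| .step 0 [4, 9, 5, 2, 8, 6, 3, 7, 1] <| .step 1 [3, 5, 1, 4, 6, 8] <| .step 1 [3, 6, 1, 4, 5, 8] <| .step 0 [3, 10, 5, 2, 9, 4, 6, 8, 1] <| .step 0 [2, 11, 6, 3, 9, 4, 5, 8, 1] <| .step 5 [3, 5, 0, 2, 6, 11] .done) (.step 3 [2, 6, 5, 0, 4, 10] <| .step 3 [5, 6,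 2, 0, 3, 10] <| .step 0 [4, 10, 5, 2, 9, 6, 3, 7, 1] <| .step 0 [2, 10, 3, 6, 9, 5, 4, 8, 1] <| .step 1 [3, 6, 1, 4, 5, 8] .done))) [] = true := by decide +kernel

theorem F3_4_chk : chk [
  ⟨true, 3, 0, 1, [2, 3, 4, 5, 6, 7, 8, 9, 10, 11]⟩,
  ⟨false, 2, 7, 8, [1, 3, 4, 5, 6]⟩,
  ⟨false, 2, 7, 9, [0, 2, 3, 4, 5, 6]⟩,
  ⟨false, 2, 7, 10, [0, 2, 3, 4, 5, 6]⟩,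
  ⟨false, 2, 8, 9, [0, 2, 3, 4, 5, 6]⟩,
  ⟨false, 2, 8, 10, [0, 2, 3, 4, 5, 6]⟩,
  ⟨false, 2, 9, 10, [0, 2, 3, 4, 5, 6]⟩] (.split 354 (.split 212 (.step 0 [3, 9, 2, 4, 7, 6, 5, 8, 1] <| .step 0 [3, 9, 4, 2, 7, 6, 5, 8, 1] <| .step 0 [3, 10, 4, 2, 7, 6, 5, 8, 1] <| .step 2 [4, 6, 0, 2, 3, 9] <| .step 4 [5, 6, 3, 0, 2, 9] <| .step 6 [0, 4, 3, 2, 6, 10] <| .step 6 [2, 5, 0, 3, 4, 10] <| .step 0 [4, 7, 6, 2, 10, 3, 5, 8, 1] <| .step 0 [2, 9, 5, 3, 8, 6, 4, 7, 1] <| .step 1 [4, 6, 1, 3, 5, 8] .done) (.step 2 [2, 6, 4, 0, 3, 9] <| .step 3 [4, 6, 2, 3, 5, 10] <| .step 0 [4, 9, 3, 2, 10, 5, 6, 8, 1] .done)) (.step 1 [3, 4, 1, 5, 6, 8] <| .split 340 (.step 0 [5, 9, 6, 2, 8, 4, 3, 7, 1] <| .step 0 [5, 10, 6, 2, 8, 4,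 3, 7, 1] <| .step 2 [2, 3, 6, 0, 5, 9] <| .step 4 [3, 4, 5, 0, 6, 9] <| .step 6 [2, 4, 0, 5, 6, 10] <| .step 6 [2, 3, 0, 5, 6, 10] <| .step 0 [4, 9, 2, 6, 7, 3, 5, 8, 1] <| .step 0 [2, 9, 3, 5, 8, 4, 6, 7, 1] <| .step 1 [4, 6, 1, 3, 5, 8] .done) (.step 4 [2, 4, 6, 0, 5, 9] <| .step 5 [4, 6, 2, 3, 5, 10] <| .step 0 [6, 9, 5, 2, 10, 3, 4, 7, 1] .done))) [] = true := by decide +kernel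

theorem F3_5_chk : chk [
  ⟨true, 3, 0, 1, [2, 3, 4, 5, 6, 7, 8, 9, 10, 11, 12]⟩,
  ⟨false, 2, 7, 8, [1, 3, 4, 5, 6]⟩,
  ⟨false, 2, 9, 10, [0, 2, 3, 4, 5, 6]⟩,
  ⟨false, 2, 11, 12, [0, 2, 3, 4, 5, 6]⟩] (.split 525 (.split 2148 (.step 0 [3, 9, 2, 6, 11, 5, 4, 8, 1] <| .step 0 [3, 9, 2, 5, 11, 6, 4, 7, 1] <| .step 1 [3, 6, 1, 4, 5, 8] <| .step 1 [3, 6, 4, 1, 5, 8] <| .step 1 [4, 6, 1, 3, 5, 8] <| .step 0 [4, 10, 5, 2, 11, 6, 3, 7, 1] <| .step 0 [2, 9, 6, 4, 7, 3, 5, 8, 1] <| .step 2 [2, 6, 0, 4, 5, 10] .done) (.step 3 [2, 6, 5, 3, 4, 12] <| .step 3 [2, 5, 6, 3, 4, 12] <| .step 3 [5, 6, 2, 0, 4, 12] <| .step 0 [2, 9, 3, 5, 12, 4, 6, 7, 1] <| .step 0 [2, 9, 3, 6, 12, 4, 5, 8, 1] <| .step 1 [1, 6, 4, 3, 5, 8]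 <| .step 1 [3, 6, 1, 4, 5, 8] <| .step 0 [2, 12, 4, 5, 8, 3, 6, 7, 1] .done)) (.step 2 [2, 3, 0, 4, 5, 10] <| .step 2 [2, 3, 0, 4, 6, 10] <| .step 2 [0, 2, 3, 5, 6, 10] <| .step 2 [0, 3, 2, 5, 6, 10] <| .split 2148 (.step 0 [4, 10, 5, 2, 11, 6, 3, 7, 1] <| .step 0 [4, 10, 6, 2, 11, 5, 3, 8, 1] <| .step 1 [3, 6, 1, 4, 5, 8] <| .step 1 [1, 6, 3, 4, 5, 8] <| .step 1 [4, 6, 1, 3, 5, 8] <| .step 0 [3, 9, 6, 2, 11, 5, 4, 8, 1] <| .step 0 [2, 10, 5, 3, 8, 4, 6, 7, 1] <| .step 2 [3, 6, 0, 2, 5, 10] .done) (.step 3 [2, 5, 6, 0, 4, 12] <| .step 3 [5, 6, 2, 0, 3, 12] <| .step 0 [4, 12, 6, 2, 10, 5, 3, 7, 1] <| .step 0 [2, 12, 3, 5, 10, 6, 4, 8, 1] <| .step 1 [3, 5, 1, 4, 6, 8] .done))) [] = true := by decide +kernel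

theorem F3_6_chk : chk [
  ⟨true, 3, 0, 1, [2, 3, 4, 5, 6, 7, 8, 9, 10, 11, 12]⟩,
  ⟨false, 2, 7, 8, [1, 3, 4, 5, 6]⟩,
  ⟨false, 2, 7, 9, [0, 2, 3, 4, 5, 6]⟩,
  ⟨false, 2, 8, 10, [0, 2, 3, 4, 5, 6]⟩,
  ⟨false, 2, 11, 12, [0, 2, 3, 4, 5, 6]⟩] (.split 141 (.split 2148 (.step 0 [3, 7, 2, 5, 11, 6, 4, 8, 1] <| .step 0 [3, 7, 2, 6, 11, 5, 4, 8, 1] <| .step 1 [3, 5, 1, 4, 6, 8] <| .step 1 [3, 6, 1, 4, 5, 8] <| .step 0 [4, 8, 2, 6, 11, 5, 3, 7, 1] <| .step 0 [4, 12, 6, 2, 11, 5, 3, 7, 1] <| .step 3 [0, 2, 4, 3, 5, 10] <| .step 4 [2, 5, 0, 4, 6, 12] <| .step 0 [2, 11, 5, 4, 10, 3, 6, 7, 1] .done) (.step 4 [2, 6, 5, 3, 4, 12] <| .step 4 [5, 6, 2, 0, 4, 12] <| .step 0 [2, 7, 3, 5, 12, 4, 6, 8, 1] <| .step 1 [3,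 5, 1, 4, 6, 8] <| .step 0 [4, 12, 2, 6, 8, 5, 3, 7, 1] <| .step 0 [2, 12, 4, 6, 10, 3, 5, 7, 1] <| .step 3 [2, 5, 6, 3, 4, 10] .done)) (.step 2 [0, 2, 3, 4, 6, 9] <| .step 2 [2, 3, 0, 4, 6, 9] <| .step 2 [2, 3, 0, 4, 5, 9] <| .step 2 [0, 3, 2, 4, 5, 9] <| .step 2 [0, 3, 2, 5, 6, 9] <| .split 356 (.step 0 [4, 9, 6, 2, 8, 5, 3, 7, 1] <| .step 0 [4, 9, 5, 2, 8, 6, 3, 7, 1] <| .step 1 [3, 5, 1, 4, 6, 8] <| .step 1 [3, 6, 1, 4, 5, 8] <| .step 0 [3, 12, 5, 2, 9, 4, 6, 8, 1] <| .step 0 [2, 11, 6, 3, 9, 4, 5, 8, 1] <| .step 4 [2, 6, 0, 3, 5, 12] .done) (.step 3 [2, 6, 5, 0, 3, 10] <| .step 3 [2, 5, 6, 0, 4, 10] <| .step 0 [3, 10, 5, 2, 9, 6, 4, 8, 1] <| .step 0 [4, 10, 6, 2, 9, 5, 3, 7, 1] <| .step 1 [3, 5, 1, 4, 6, 8] .done)))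 [] = true := by decide +kernel

theorem ii2_chk : chk [
  ⟨true, 3, 0, 1, [2, 3, 4, 5, 6, 7, 8, 9, 10, 11]⟩,
  ⟨false, 3, 7, 8, [0, 1, 3, 4, 5, 6, 9, 10, 11]⟩] (.step 1 [4, 9, 1, 5, 10, 11, 0, 3, 8] <| .step 1 [3, 4, 9, 6, 11, 1, 5, 10, 8] <| .step 0 [8, 11, 3, 7, 9, 4, 5, 6, 1] .done) [(ek 1 4 5 6, true), (ek 1 4 7 9, false), (ek 1 5 8 10, false), (ek 1 5 10 11, false), (ek 1 6 9 11, false)] = true := by decide +kernel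

theorem ii4_chk : chk [
  ⟨true, 3, 0, 1, [2, 3, 4, 5, 6, 7, 8, 9, 10, 11]⟩,
  ⟨false, 3, 7, 8, [0, 1, 2, 3, 5, 6, 9, 10, 11]⟩] (.step 1 [2, 9, 1, 5, 10, 11, 0, 3, 8] <| .step 1 [3, 6, 9, 5, 11, 1, 2, 10, 8] <| .step 0 [8, 11, 3, 7, 9, 6, 4, 5, 1] .done) [(ek 1 2 7 9, false), (ek 1 2 8 10, false), (ek 1 4 5 6, true), (ek 1 5 9 11, false), (ek 1 5 10 11, false)] = true := by decide +kernel

theorem ii5_chk : chk [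
  ⟨true, 3, 0, 1, [2, 3, 4, 5, 6, 7, 8, 9, 10, 11]⟩,
  ⟨false, 3, 7, 8, [0, 1, 2, 3, 4, 6, 9, 10, 11]⟩] (.step 1 [2, 9, 1, 4, 11, 10, 0, 3, 8] <| .step 1 [3, 4, 9, 6, 11, 1, 2, 10, 8] <| .step 0 [8, 10, 3, 7, 9, 4, 5, 6, 1] .done) [(ek 1 2 7 9, false), (ek 1 2 8 10, false), (ek 1 4 5 6, true), (ek 1 4 10 11, false), (ek 1 6 9 11, false)] = true := by decide +kernel

theorem i02_chk : chk [
  ⟨true, 3, 0, 1, [2, 3, 4, 5, 6, 7, 8, 9, 10]⟩,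
  ⟨false, 3, 7, 9, [0, 1, 2, 3, 4, 5, 6, 8, 10]⟩] (.split 420 (.step 0 [3, 9, 8, 2, 7, 5, 4, 6, 1] <| .step 0 [3, 10, 2, 7, 8, 5, 4, 6, 1] <| .step 1 [2, 10, 1, 4, 5, 3, 0, 8, 9] <| .step 1 [1, 6, 10, 2, 5, 8, 0, 3, 9] <| .step 1 [6, 8, 0, 2, 3, 10, 1, 4, 9] <| .step 0 [6, 7, 8, 2, 10, 5, 3, 4, 1] .done) (.step 1 [5, 8, 2, 0, 3, 10, 1, 6, 9] <| .step 1 [2, 8, 5, 3, 6, 1, 4, 10, 9] <| .step 1 [2, 5, 8, 3, 4, 10, 1, 6, 9] <| .step 0 [2, 10, 3, 7, 8, 5, 4, 6, 1] <| .step 0 [2, 9, 4, 8, 10, 3, 5, 6, 1] <| .step 1 [3, 5, 8, 1, 10, 4, 0, 2, 9] .done)) [(ek 1 2 7 10, false), (ek 1 4 5 6, true), (ek 1 4 8 10, false), (ek 1 4 9 10, false), (ek 1 6 7 10, false), (ek 1 6 9 10, false)] = true := by decide +kernel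

theorem i01_chk : chk [
  ⟨true, 3, 0, 1, [2, 3, 4, 5, 6, 7, 8, 9, 10]⟩,
  ⟨false, 3, 7, 8, [0, 1, 2, 3, 4, 5, 6, 9, 10]⟩] (.split 676 (.step 0 [3, 10, 9, 2, 7, 5, 4, 6, 1] <| .step 0 [8, 10, 2, 7, 9, 5, 4, 6, 1] <| .step 0 [3, 10, 7, 2, 9, 5, 4, 6, 1] <| .step 1 [2, 6, 0, 3, 10, 9, 1, 4, 8] <| .step 1 [4, 9, 1, 3, 5, 10, 0, 2, 8] <| .step 1 [0, 3, 10, 2, 4, 9, 1, 5, 8] <| .step 0 [6, 7, 2, 4, 9, 10, 3, 5, 1] .done) (.step 1 [2, 5, 9, 0, 6, 3, 1, 10, 8] <| .step 1 [2, 5, 9, 1, 6, 10, 3, 4, 8] <| .step 1 [2, 9, 5, 0, 4, 10, 1, 3, 8] <| .step 1 [5, 9, 2, 3, 6, 1, 4, 10, 8] <| .step 1 [2, 9, 5, 3, 6, 1, 4, 10, 8] <| .step 1 [2, 9, 5, 3, 4, 10, 1, 6, 8] <| .step 0 [6, 9, 3, 5, 10, 4, 2, 7, 1] <| .step 0 [2,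 9, 10, 4, 8, 3, 5, 6, 1] <| .step 0 [4, 10, 5, 8, 9, 6, 2, 3, 1] <| .step 1 [1, 4, 2, 0, 10, 9, 5, 6, 8] .done)) [(ek 1 3 8 10, false), (ek 1 4 5 6, true), (ek 1 4 7 9, false), (ek 1 4 8 9, false), (ek 1 4 8 10, false), (ek 1 5 8 9, false), (ek 1 6 8 10, false), (ek 1 6 9 10, false)] = true := by decide +kernel

theorem Ke_chk : chk [
  ⟨true, 2, 0, 1, [2, 3, 4, 5, 6, 7]⟩,
  ⟨false, 2, 4, 5, [0, 1, 2, 3, 6, 7]⟩] (.split 29 (.step 0 [2, 3, 4, 6, 7, 1] <| .step 0 [2, 4, 3, 5, 6, 1] <| .step 1 [1, 6, 7, 0, 3, 5] <| .step 1 [2, 7, 1, 3, 6, 5] <| .step 0 [3, 5, 7, 2, 4, 1] .done) (.step 1 [2, 3, 0, 6, 7, 5] <| .step 1 [0, 3, 2, 1, 7, 5] <| .step 0 [5, 6, 7, 3, 4, 1] <| .step 0 [3, 6, 5, 2, 7, 1] <| .step 1 [1, 7, 3, 0, 6, 5] .done)) [] = true := by decide +kernel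

theorem v6_chk : chk [
  ⟨true, 3, 0, 1, [2, 3, 4, 5, 6, 10, 11, 12, 13, 14]⟩,
  ⟨true, 3, 7, 4, [8, 9, 0, 2, 3, 10, 11, 12, 13, 14]⟩,
  ⟨true, 3, 0, 1, [2, 3, 4, 5, 6, 10, 15, 16, 17, 18]⟩,
  ⟨true, 3, 7, 4, [8, 9, 0, 2, 3, 10, 15, 16, 17, 18]⟩,
  ⟨false, 3, 10, 11, [2, 3, 4, 5, 6, 0, 12, 13, 14]⟩,
  ⟨false, 3, 10, 15, [8, 9, 0, 2, 3, 7, 16, 17, 18]⟩] (.split 66817 (.step 3 [9, 17, 8, 10, 16, 0, 2, 3, 4] <| .step 3 [15, 18, 16, 8, 10, 0, 2, 3, 4] <| .step 3 [9, 17, 10, 8, 16, 0, 2, 3, 4] <| .step 5 [2, 3, 9, 8, 17, 7, 16, 18, 15] <| .step 1 [0, 8, 9, 2, 10, 3, 12, 14, 4] <| .step 1 [0, 8, 9, 2, 10, 3, 11, 13, 4] <| .step 1 [0, 8, 9, 2, 10, 3, 11, 14, 4] <| .split 5156 (.step 0 [11, 13, 12, 2, 10, 5, 4, 6, 1] <|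 .step 4 [2, 5, 3, 4, 14, 12, 0, 13, 11] <| .step 2 [16, 17, 2, 3, 10, 5, 4, 6, 1] <| .step 2 [15, 18, 3, 2, 10, 5, 4, 6, 1] <| .step 5 [7, 9, 17, 2, 16, 0, 3, 18, 15] .done) (.step 4 [5, 12, 2, 0, 14, 13, 3, 4, 11] <| .step 4 [2, 5, 12, 6, 13, 3, 4, 14, 11] <| .step 0 [2, 14, 13, 3, 12, 6, 4, 5, 1] .done)) (.split 425988 (.step 3 [9, 10, 17, 15, 18, 2, 0, 3, 4] <| .step 3 [9, 16, 17, 15, 18, 2, 0, 3, 4] <| .step 3 [9, 16, 18, 15, 17, 2, 0, 3, 4] <| .step 3 [8, 16, 18, 15, 17, 2, 0, 3, 4] <| .step 5 [9, 17, 7, 8, 16, 18, 0, 2, 15] <| .step 5 [0, 8, 16, 7, 17, 9, 3, 18, 15] <| .step 5 [0, 8, 16, 7, 17, 9, 2, 18, 15] <| .step 5 [0, 8, 16, 9, 18, 7, 3, 17, 15] <| .step 2 [15, 18, 2, 3, 10, 5, 4, 6, 1] <| .step 3 [8, 17, 15, 9, 18, 3, 0, 2, 4] <| .step 3 [3, 17,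 15, 9, 18, 2, 0, 10, 4] <| .step 5 [2, 3, 9, 16, 18, 7, 8, 17, 15] <| .step 1 [0, 8, 9, 2, 10, 3, 12, 14, 4] <| .step 1 [0, 8, 9, 2, 10, 3, 12, 13, 4] <| .step 4 [2, 5, 3, 4, 14, 12, 0, 13, 11] <| .step 4 [0, 2, 4, 12, 13, 3, 5, 14, 11] <| .step 0 [12, 13, 11, 3, 14, 5, 4, 6, 1] .done) (.step 5 [0, 16, 8, 7, 9, 17, 2, 18, 15] <| .step 5 [0, 8, 16, 3, 9, 18, 2, 17, 15] <| .step 3 [8, 17, 9, 16, 18, 3, 0, 2, 4] .done))) [(ek 0 2 3 4, true), (ek 0 7 8 9, true), (ek 1 4 5 6, true)] = true := by decide +kernel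

theorem base_chk : chk [
  ⟨true, 3, 0, 0, [1, 2, 3, 4, 5, 6, 7, 8, 9]⟩,
  ⟨true, 3, 1, 1, [0, 2, 3, 4, 5, 6, 7, 8, 9]⟩,
  ⟨true, 3, 2, 2, [0, 1, 3, 4, 5, 6, 7, 8, 9]⟩,
  ⟨true, 3, 3, 3, [0, 1, 2, 4, 5, 6, 7, 8, 9]⟩,
  ⟨true, 3, 4, 4, [0, 1, 2, 3, 5, 6, 7, 8, 9]⟩,
  ⟨true, 3, 5, 5, [0, 1, 2, 3, 4, 6, 7, 8, 9]⟩,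
  ⟨true, 3, 6, 6, [0, 1, 2, 3, 4, 5, 7, 8, 9]⟩,
  ⟨true, 3, 7, 7, [0, 1, 2, 3, 4, 5, 6, 8, 9]⟩,
  ⟨true, 3, 8, 8, [0, 1, 2, 3, 4, 5, 6, 7, 9]⟩,
  ⟨true, 3, 9, 9, [0, 1, 2, 3, 4, 5, 6, 7, 8]⟩,
  ⟨false, 3, 0, 0, [1, 2, 3, 4, 5, 6, 7, 8, 9]⟩,
  ⟨false, 3, 1, 1, [0, 2, 3, 4, 5, 6, 7, 8, 9]⟩,
  ⟨false, 3, 2, 2, [0, 1, 3, 4, 5, 6, 7, 8, 9]⟩,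
  ⟨false, 3, 3, 3, [0, 1, 2, 4, 5, 6, 7, 8, 9]⟩,
  ⟨false, 3, 4, 4, [0, 1, 2, 3, 5, 6, 7, 8, 9]⟩,
  ⟨false, 3, 5, 5, [0, 1, 2, 3, 4, 6, 7, 8, 9]⟩,
  ⟨false, 3, 6, 6, [0, 1, 2, 3, 4, 5, 7, 8, 9]⟩,
  ⟨false, 3, 7, 7, [0, 1, 2, 3, 4, 5, 6, 8, 9]⟩,
  ⟨false, 3, 8, 8, [0, 1, 2, 3, 4, 5, 6, 7, 9]⟩,
  ⟨false, 3, 9, 9, [0, 1, 2, 3, 4, 5, 6, 7, 8]⟩] (.split 23 (.split 39 (.split 58 (.split 27 (.split 43 (.split 75 (.split 139 (.split 267 (.split 523 (.split 51 (.split 83 (.split 99 (.split 71 (.step 0 [3, 5, 4, 8, 9, 6, 1, 2, 0] <| .step 0 [4, 5, 3, 7, 9, 1, 2, 6, 0] <| .step 0 [3, 4, 5, 7, 8, 2, 1, 6, 0] <| .step 17 [1, 3, 9, 4, 6, 8, 2, 5, 7] .done) (.split 401 (.step 0 [4, 8, 7, 2, 9, 5, 1, 6, 0] <| .step 0 [4,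 7, 8, 2, 3, 1, 5, 6, 0] <| .step 0 [7, 8, 4, 3, 5, 1, 6, 9, 0] <| .step 11 [3, 8, 2, 5, 7, 9, 0, 6, 1] .done) (.step 10 [4, 8, 7, 5, 9, 1, 2, 6, 0] <| .step 10 [4, 7, 8, 3, 5, 6, 1, 2, 0] <| .step 1 [7, 9, 5, 3, 8, 6, 0, 4, 1] .done))) (.split 401 (.step 0 [4, 8, 7, 3, 6, 1, 2, 5, 0] <| .step 0 [7, 8, 4, 2, 5, 1, 3, 9, 0] <| .step 0 [4, 7, 8, 2, 9, 3, 1, 5, 0] <| .step 11 [6, 7, 3, 8, 9, 2, 4, 5, 1] .done) (.step 10 [4, 8, 7, 2, 9, 5, 1, 6, 0] <| .step 10 [4, 7, 8, 3, 9, 1, 5, 6, 0] <| .step 1 [3, 8, 9, 2, 7, 5, 0, 4, 1] .done))) (.split 417 (.step 0 [5, 7, 8, 4, 6, 9, 1, 3, 0] <| .step 0 [7, 8, 5, 2, 9, 1, 3, 4, 0] <| .step 0 [5, 8, 7, 3, 6, 1, 2, 4, 0] <| .step 11 [3, 7, 6, 4, 8, 9, 2, 5, 1] .done) (.step 10 [5,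 8, 7, 3, 9, 6, 1, 4, 0] <| .step 10 [5, 7, 8, 2, 9, 1, 4, 6, 0] <| .step 1 [4, 5, 3, 6, 7, 9, 2, 8, 1] .done))) (.split 449 (.step 0 [6, 8, 7, 5, 9, 1, 2, 4, 0] <| .step 0 [7, 8, 6, 3, 9, 2, 1, 5, 0] <| .step 0 [6, 7, 8, 2, 4, 1, 3, 5, 0] <| .step 11 [5, 7, 9, 3, 6, 2, 4, 8, 1] .done) (.step 10 [7, 8, 6, 2, 9, 1, 4, 5, 0] <| .step 10 [6, 8, 7, 3, 9, 5, 1, 4, 0] <| .step 1 [2, 6, 9, 5, 7, 3, 0, 8, 1] .done))) (.split 114 (.step 0 [2, 3, 1, 4, 6, 5, 7, 9, 0] <| .step 0 [2, 8, 4, 5, 6, 1, 3, 7, 0] <| .step 1 [4, 5, 6, 2, 9, 3, 0, 7, 1] <| .step 10 [5, 7, 9, 3, 6, 2, 4, 8, 0] .done) (.step 10 [7, 8, 5, 4, 6, 1, 3, 9, 0] <| .step 11 [4, 5, 6, 2, 7, 3, 0, 9, 1] <| .step 0 [5, 8, 7, 2, 6, 3, 1, 4, 0] .done))) (.split 114 (.step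 0 [2, 3, 1, 4, 6, 5, 7, 9, 0] <| .step 1 [5, 6, 4, 2, 9, 3, 0, 7, 1] <| .step 10 [5, 7, 9, 2, 4, 3, 1, 8, 0] .done) (.step 10 [2, 7, 5, 4, 6, 1, 3, 8, 0] <| .step 11 [5, 6, 4, 7, 9, 8, 0, 3, 1] <| .step 0 [1, 3, 4, 8, 9, 7, 2, 5, 0] .done))) (.split 114 (.step 0 [2, 3, 1, 4, 6, 5, 7, 9, 0] <| .step 1 [0, 2, 3, 7, 8, 4, 5, 6, 1] <| .step 1 [0, 3, 2, 8, 9, 6, 4, 5, 1] <| .step 17 [0, 5, 9, 2, 6, 8, 3, 4, 7] .done) (.step 10 [2, 8, 5, 4, 6, 1, 3, 7, 0] <| .step 11 [5, 6, 4, 2, 9, 3, 0, 7, 1] <| .step 0 [5, 8, 2, 4, 9, 3, 1, 6, 0] .done))) (.split 401 (.step 0 [4, 8, 7, 3, 6, 1, 2, 5, 0] <| .step 0 [4, 7, 8, 3, 9, 5, 1, 2, 0] <| .step 0 [7, 8, 4, 2, 9, 1, 3, 5, 0] <| .step 11 [6, 7, 3, 5, 8, 9, 2, 4, 1] .done) (.step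 10 [4, 7, 8, 2, 5, 6, 1, 3, 0] <| .step 10 [7, 8, 4, 5, 9, 1, 3, 6, 0] <| .step 1 [0, 3, 2, 6, 8, 5, 4, 9, 1] .done))) (.split 401 (.step 0 [4, 8, 7, 3, 6, 1, 2, 5, 0] <| .step 0 [2, 3, 1, 5, 9, 8, 4, 7, 0] <| .step 0 [7, 8, 4, 6, 9, 2, 1, 5, 0] <| .step 11 [5, 8, 9, 2, 4, 6, 3, 7, 1] .done) (.step 10 [4, 8, 7, 2, 6, 3, 1, 5, 0] <| .step 10 [4, 7, 8, 2, 9, 1, 3, 5, 0] <| .step 1 [4, 5, 3, 6, 7, 2, 8, 9, 1] .done))) (.split 417 (.step 0 [1, 2, 3, 6, 9, 8, 5, 7, 0] <| .step 0 [7, 8, 5, 3, 4, 1, 2, 6, 0] <| .step 0 [2, 3, 1, 4, 9, 5, 7, 8, 0] <| .step 11 [4, 5, 9, 3, 8, 6, 0, 2, 1] .done) (.step 10 [5, 8, 7, 2, 6, 3, 1, 4, 0] <| .step 10 [5, 7, 8, 2, 9, 1, 3, 4, 0] <| .step 1 [4, 5, 3, 6, 7, 2, 8, 9, 1] .done)))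 (.split 401 (.step 0 [4, 8, 7, 3, 6, 1, 2, 5, 0] <| .step 0 [2, 3, 1, 5, 9, 8, 4, 7, 0] <| .step 0 [7, 8, 4, 6, 9, 2, 1, 5, 0] <| .step 11 [5, 8, 9, 2, 4, 6, 3, 7, 1] .done) (.step 10 [7, 8, 4, 3, 5, 1, 2, 6, 0] <| .step 14 [0, 7, 8, 6, 9, 5, 1, 3, 4] <| .step 0 [3, 4, 5, 8, 9, 6, 1, 2, 0] .done))) (.split 401 (.step 0 [1, 2, 3, 5, 6, 4, 7, 8, 0] <| .step 0 [2, 3, 1, 6, 9, 8, 4, 7, 0] <| .step 11 [8, 9, 6, 3, 4, 5, 0, 2, 1] .done) (.step 10 [4, 8, 7, 3, 6, 1, 2, 5, 0] <| .step 10 [7, 8, 4, 6, 9, 5, 1, 2, 0] <| .step 1 [0, 2, 4, 5, 9, 6, 3, 7, 1] .done))) (.split 417 (.step 0 [1, 2, 3, 6, 9, 8, 5, 7, 0] <| .step 0 [1, 3, 2, 4, 6, 5, 7, 8, 0] <| .step 0 [2, 3, 1, 4, 9, 7, 5, 8, 0] <| .step 14 [1, 7, 9, 3, 8, 6, 2,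 5, 4] .done) (.step 10 [7, 8, 5, 3, 9, 4, 1, 2, 0] <| .step 10 [5, 7, 8, 6, 9, 1, 2, 4, 0] <| .step 1 [0, 2, 3, 4, 5, 9, 6, 8, 1] .done))) [(ek 0 1 2 3, true), (ek 0 3 4 5, true)] = true := by decide +kernel

end LC

namespace LC
variable {V : Type*} [DecidableEq V]

def Cn (col : Finset V → Bool) (b : Bool) (n : ℕ) (s t : V) (X : Finset V) : Prop :=
  W col b n s t (insert t X)

def NE (col : Finset V → Bool) (z : V) (S : Finset V) (f g : V) : Prop :=
  ¬ Cn col false 2 f g (insert z S)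

theorem holds_lab {col : Finset V → Bool} {d : V} {L : List V} {b : Bool} {n s t : ℕ}
    {M : List ℕ} {J : Finset V} (hL : L.Nodup) (hi : (t :: M).Nodup)
    (hi' : ∀ i ∈ t :: M, i < L.length)
    (hW : ¬ W col b n (lab d L s) (lab d L t) J) (hJ : ∀ x ∈ (t :: M).map (lab d L), x ∈ J) :
    Con.holds col (lab d L) ⟨b, n, s, t, M⟩ := by
  refine holds_of col _ b n s t M J ?_ hJ hW
  refine List.Nodup.map_on ?_ hi
  intro x hx y hy hxy
  have hx' := hi' x hx
  have hy' := hi' y hy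
  simp only [lab, List.getD_eq_getElem _ _ hx', List.getD_eq_getElem _ _ hy'] at hxy
  exact (List.Nodup.getElem_inj_iff hL).mp hxy

theorem enum5 {S : Finset V} (h : S.card = 5) {s : V} (hs : s ∈ S) :
    ∃ b q c d, S = {s, b, q, c, d} ∧ [s, b, q, c, d].Nodup := by
  have h4 : (S.erase s).card = 4 := by rw [Finset.card_erase_of_mem hs, h]
  have hl : (S.erase s).toList.length = 4 := by rw [Finset.length_toList, h4]
  have hnd := (S.erase s).nodup_toList
  have hm : ∀ x, x ∈ (S.erase s).toList ↔ x ≠ s ∧ x ∈ S := by intro x; simp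
  match h5 : (S.erase s).toList, hl with
  | [b, q, c, d], _ =>
    rw [h5] at hnd hm
    refine ⟨b, q, c, d, ?_, ?_⟩
    · ext x
      have := hm x
      by_cases hx : x = s
      · subst hx; simp [hs]
      · simp only [List.mem_cons, List.not_mem_nil, or_false] at this
        simp only [Finset.mem_insert, Finset.mem_singleton]
        tauto
    · refine List.nodup_cons.mpr ⟨?_, hnd⟩
      rw [hm]; simp

theorem P6c {col : Finset V → Bool} {z s a b c d f g : V}
    (hnd : [z, s, a, b, c, d, f, g].Nodup)
    (h : ¬ W col false 2 f g {g, z, s, a, b, c, d}) :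
    W col true 2 z s {s, a, b, c, d, f} ∨ W col true 2 z s {s, a, b, c, d, g} := by
  by_contra hcon
  rw [not_or] at hcon
  refine chk_sound col (lab z [z, s, a, b, c, d, f, g]) _ ?_ _ _ (by simp) P6_chk
  simp only [List.forall_mem_cons]
  exact ⟨holds_lab hnd (by decide) (by simp) hcon.1 (by simp [lab]),
    holds_lab hnd (by decide) (by simp) hcon.2 (by simp [lab]),
    holds_lab hnd (by decide) (by simp) h (by simp [lab]), by simp⟩

theorem F3c0 {col : Finset V → Bool} {z r a b q c d w0 w1 w2 w3 w4 : V} {J : Finset V}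
    (hnd : [z, r, a, b, q, c, d, w0, w1, w2, w3, w4].Nodup) (hred : ¬ W col true 3 z r J)
    (hJ : ∀ x ∈ [r, a, b, q, c, d, w0, w1, w2, w3, w4], x ∈ J)
    (h0 : NE col z {a, b, q, c, d} w0 w2)
    (h1 : NE col z {a, b, q, c, d} w1 w2)
    (h2 : NE col z {a, b, q, c, d} w3 w4) :
    Cn col false 2 w0 w1 {r, b, q, c, d} := by
  by_contra hcon
  refine chk_sound col (lab z [z, r, a, b, q, c, d, w0, w1, w2, w3, w4]) _ ?_ _ _ (by simp) F3_0_chk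
  simp only [List.forall_mem_cons]
  exact ⟨holds_lab hnd (by decide) (by simp) hred hJ,
    holds_lab hnd (by decide) (by simp) hcon (by simp [lab]),
    holds_lab hnd (by decide) (by simp) h0 (by simp [lab]),
    holds_lab hnd (by decide) (by simp) h1 (by simp [lab]),
    holds_lab hnd (by decide) (by simp) h2 (by simp [lab]),
    by simp⟩

theorem F3c1 {col : Finset V → Bool} {z r a b q c d w0 w1 w2 w3 w4 : V} {J : Finset V}
    (hnd : [z, r, a, b, q, c, d, w0, w1, w2, w3, w4].Nodup) (hred : ¬ W col true 3 z r J)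
    (hJ : ∀ x ∈ [r, a, b, q, c, d, w0, w1, w2, w3, w4], x ∈ J)
    (h0 : NE col z {a, b, q, c, d} w2 w3)
    (h1 : NE col z {a, b, q, c, d} w2 w4)
    (h2 : NE col z {a, b, q, c, d} w3 w4) :
    Cn col false 2 w0 w1 {r, b, q, c, d} := by
  by_contra hcon
  refine chk_sound col (lab z [z, r, a, b, q, c, d, w0, w1, w2, w3, w4]) _ ?_ _ _ (by simp) F3_1_chk
  simp only [List.forall_mem_cons]
  exact ⟨holds_lab hnd (by decide) (by simp) hred hJ,
    holds_lab hnd (by decide) (by simp) hcon (by simp [lab]),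
    holds_lab hnd (by decide) (by simp) h0 (by simp [lab]),
    holds_lab hnd (by decide) (by simp) h1 (by simp [lab]),
    holds_lab hnd (by decide) (by simp) h2 (by simp [lab]),
    by simp⟩

theorem F3c2 {col : Finset V → Bool} {z r a b q c d w0 w1 w2 w3 w4 : V} {J : Finset V}
    (hnd : [z, r, a, b, q, c, d, w0, w1, w2, w3, w4].Nodup) (hred : ¬ W col true 3 z r J)
    (hJ : ∀ x ∈ [r, a, b, q, c, d, w0, w1, w2, w3, w4], x ∈ J)
    (h0 : NE col z {a, b, q, c, d} w0 w2)
    (h1 : NE col z {a, b, q, c, d} w0 w3)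
    (h2 : NE col z {a, b, q, c, d} w1 w4)
    (h3 : NE col z {a, b, q, c, d} w2 w3) :
    Cn col false 2 w0 w1 {r, b, q, c, d} := by
  by_contra hcon
  refine chk_sound col (lab z [z, r, a, b, q, c, d, w0, w1, w2, w3, w4]) _ ?_ _ _ (by simp) F3_2_chk
  simp only [List.forall_mem_cons]
  exact ⟨holds_lab hnd (by decide) (by simp) hred hJ,
    holds_lab hnd (by decide) (by simp) hcon (by simp [lab]),
    holds_lab hnd (by decide) (by simp) h0 (by simp [lab]),
    holds_lab hnd (by decide) (by simp) h1 (by simp [lab]),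
    holds_lab hnd (by decide) (by simp) h2 (by simp [lab]),
    holds_lab hnd (by decide) (by simp) h3 (by simp [lab]),
    by simp⟩

theorem F3c3 {col : Finset V → Bool} {z r a b q c d w0 w1 w2 w3 w4 : V} {J : Finset V}
    (hnd : [z, r, a, b, q, c, d, w0, w1, w2, w3, w4].Nodup) (hred : ¬ W col true 3 z r J)
    (hJ : ∀ x ∈ [r, a, b, q, c, d, w0, w1, w2, w3, w4], x ∈ J)
    (h0 : NE col z {a, b, q, c, d} w0 w2)
    (h1 : NE col z {a, b, q, c, d} w1 w3)
    (h2 : NE col z {a, b, q, c, d} w2 w4)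
    (h3 : NE col z {a, b, q, c, d} w3 w4) :
    Cn col false 2 w0 w1 {r, b, q, c, d} := by
  by_contra hcon
  refine chk_sound col (lab z [z, r, a, b, q, c, d, w0, w1, w2, w3, w4]) _ ?_ _ _ (by simp) F3_3_chk
  simp only [List.forall_mem_cons]
  exact ⟨holds_lab hnd (by decide) (by simp) hred hJ,
    holds_lab hnd (by decide) (by simp) hcon (by simp [lab]),
    holds_lab hnd (by decide) (by simp) h0 (by simp [lab]),
    holds_lab hnd (by decide) (by simp) h1 (by simp [lab]),
    holds_lab hnd (by decide) (by simp) h2 (by simp [lab]),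
    holds_lab hnd (by decide) (by simp) h3 (by simp [lab]),
    by simp⟩

theorem F3c4 {col : Finset V → Bool} {z r a b q c d w0 w1 w2 w3 w4 : V} {J : Finset V}
    (hnd : [z, r, a, b, q, c, d, w0, w1, w2, w3, w4].Nodup) (hred : ¬ W col true 3 z r J)
    (hJ : ∀ x ∈ [r, a, b, q, c, d, w0, w1, w2, w3, w4], x ∈ J)
    (h0 : NE col z {a, b, q, c, d} w0 w2)
    (h1 : NE col z {a, b, q, c, d} w0 w3)
    (h2 : NE col z {a, b, q, c, d} w1 w2)
    (h3 : NE col z {a, b, q, c, d} w1 w3)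
    (h4 : NE col z {a, b, q, c, d} w2 w3) :
    Cn col false 2 w0 w1 {r, b, q, c, d} := by
  by_contra hcon
  refine chk_sound col (lab z [z, r, a, b, q, c, d, w0, w1, w2, w3, w4]) _ ?_ _ _ (by simp) F3_4_chk
  simp only [List.forall_mem_cons]
  exact ⟨holds_lab hnd (by decide) (by simp) hred hJ,
    holds_lab hnd (by decide) (by simp) hcon (by simp [lab]),
    holds_lab hnd (by decide) (by simp) h0 (by simp [lab]),
    holds_lab hnd (by decide) (by simp) h1 (by simp [lab]),
    holds_lab hnd (by decide) (by simp) h2 (by simp [lab]),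
    holds_lab hnd (by decide) (by simp) h3 (by simp [lab]),
    holds_lab hnd (by decide) (by simp) h4 (by simp [lab]),
    by simp⟩

theorem F3c5 {col : Finset V → Bool} {z r a b q c d w0 w1 w2 w3 w4 w5 : V} {J : Finset V}
    (hnd : [z, r, a, b, q, c, d, w0, w1, w2, w3, w4, w5].Nodup) (hred : ¬ W col true 3 z r J)
    (hJ : ∀ x ∈ [r, a, b, q, c, d, w0, w1, w2, w3, w4, w5], x ∈ J)
    (h0 : NE col z {a, b, q, c, d} w2 w3)
    (h1 : NE col z {a, b, q, c, d} w4 w5) :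
    Cn col false 2 w0 w1 {r, b, q, c, d} := by
  by_contra hcon
  refine chk_sound col (lab z [z, r, a, b, q, c, d, w0, w1, w2, w3, w4, w5]) _ ?_ _ _ (by simp) F3_5_chk
  simp only [List.forall_mem_cons]
  exact ⟨holds_lab hnd (by decide) (by simp) hred hJ,
    holds_lab hnd (by decide) (by simp) hcon (by simp [lab]),
    holds_lab hnd (by decide) (by simp) h0 (by simp [lab]),
    holds_lab hnd (by decide) (by simp) h1 (by simp [lab]),
    by simp⟩

theorem F3c6 {col : Finset V → Bool} {z r a b q c d w0 w1 w2 w3 w4 w5 : V} {J : Finset V}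
    (hnd : [z, r, a, b, q, c, d, w0, w1, w2, w3, w4, w5].Nodup) (hred : ¬ W col true 3 z r J)
    (hJ : ∀ x ∈ [r, a, b, q, c, d, w0, w1, w2, w3, w4, w5], x ∈ J)
    (h0 : NE col z {a, b, q, c, d} w0 w2)
    (h1 : NE col z {a, b, q, c, d} w1 w3)
    (h2 : NE col z {a, b, q, c, d} w4 w5) :
    Cn col false 2 w0 w1 {r, b, q, c, d} := by
  by_contra hcon
  refine chk_sound col (lab z [z, r, a, b, q, c, d, w0, w1, w2, w3, w4, w5]) _ ?_ _ _ (by simp) F3_6_chk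
  simp only [List.forall_mem_cons]
  exact ⟨holds_lab hnd (by decide) (by simp) hred hJ,
    holds_lab hnd (by decide) (by simp) hcon (by simp [lab]),
    holds_lab hnd (by decide) (by simp) h0 (by simp [lab]),
    holds_lab hnd (by decide) (by simp) h1 (by simp [lab]),
    holds_lab hnd (by decide) (by simp) h2 (by simp [lab]),
    by simp⟩

theorem Kec {col : Finset V → Bool} {z u x y w0 w1 w2 w3 : V} {J : Finset V}
    (hnd : [z, u, x, y, w0, w1, w2, w3].Nodup)
    (hred : ¬ W col true 2 z u J) (hJ : ∀ t ∈ [u, x, y, w0, w1, w2, w3], t ∈ J) :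
    W col false 2 w0 w1 {w1, z, u, x, y, w2, w3} := by
  by_contra hcon
  refine chk_sound col (lab z [z, u, x, y, w0, w1, w2, w3]) _ ?_ _ _ (by simp) Ke_chk
  simp only [List.forall_mem_cons]
  exact ⟨holds_lab hnd (by decide) (by simp) hred hJ,
    holds_lab hnd (by decide) (by simp) hcon (by simp [lab]), by simp⟩

theorem iic {col : Finset V → Bool} {p r a b q c d w0 w1 w2 w3 w4 : V} {J : Finset V}
    (hnd : [p, r, a, b, q, c, d, w0, w1, w2, w3, w4].Nodup)
    (hr2 : col {r, q, c, d} = true)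
    (hB : ∀ s ∈ [a, b, q, c, d], ∀ w ∈ [w0, w1, w2, w3, w4], ∀ w' ∈ [w0, w1, w2, w3, w4],
      w ≠ w' → col {r, s, w, w'} = false)
    (hred : ¬ W col true 3 p r J) (hJ : ∀ t ∈ [r, a, b, q, c, d, w0, w1, w2, w3, w4], t ∈ J) :
    W col false 3 w0 w1 {w1, p, r, b, q, c, d, w2, w3, w4} := by
  by_contra hcon
  refine chk_sound col (lab p [p, r, a, b, q, c, d, w0, w1, w2, w3, w4]) _ ?_ _ _ ?_ ii2_chk
  · simp only [List.forall_mem_cons]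
    exact ⟨holds_lab hnd (by decide) (by simp) hred hJ,
      holds_lab hnd (by decide) (by simp) hcon (by simp [lab]), by simp⟩
  · have hnd' := hnd
    simp only [List.nodup_cons, List.mem_cons, List.not_mem_nil, not_or, or_false] at hnd'
    simp only [List.forall_mem_cons, ec_ek, lab, List.getD_cons_zero, List.getD_cons_succ]
    simp only [hr2, true_and]
    refine ⟨?_, ?_, ?_, ?_, ?_⟩ <;> first | (intro x hx; simp at hx) | skip
    all_goals
      apply hB <;> simp
      try tauto

theorem i02c {col : Finset V → Bool} {p r a b q c d w0 w1 w2 w3 : V} {J : Finset V}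
    (hnd : [p, r, a, b, q, c, d, w0, w1, w2, w3].Nodup)
    (hr2 : col {r, q, c, d} = true)
    (hB : ∀ s ∈ [a, b, q, c, d], col {r, s, w0, w2} = false ∧ col {r, s, w0, w3} = false ∧
      col {r, s, w1, w2} = false ∧ col {r, s, w1, w3} = false ∧ col {r, s, w2, w3} = false)
    (hred : ¬ W col true 3 p r J) (hJ : ∀ t ∈ [r, a, b, q, c, d, w0, w1, w2, w3], t ∈ J) :
    W col false 3 w0 w2 {w2, p, r, a, b, q, c, d, w1, w3} := by
  by_contra hcon
  refine chk_sound col (lab p [p, r, a, b, q, c, d, w0, w1, w2, w3]) _ ?_ _ _ ?_ i02_chk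
  · simp only [List.forall_mem_cons]
    exact ⟨holds_lab hnd (by decide) (by simp) hred hJ,
      holds_lab hnd (by decide) (by simp) hcon (by simp [lab]), by simp⟩
  · simp only [List.forall_mem_cons] at hB
    simp only [List.forall_mem_cons, ec_ek, lab, List.getD_cons_zero, List.getD_cons_succ]
    simp [hr2, hB]

theorem i01c {col : Finset V → Bool} {p r a b q c d w0 w1 w2 w3 : V} {J : Finset V}
    (hnd : [p, r, a, b, q, c, d, w0, w1, w2, w3].Nodup)
    (hr2 : col {r, q, c, d} = true)
    (hB : ∀ s ∈ [a, b, q, c, d], col {r, s, w0, w2} = false ∧ col {r, s, w0, w3} = false ∧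
      col {r, s, w1, w2} = false ∧ col {r, s, w1, w3} = false ∧ col {r, s, w2, w3} = false)
    (hred : ¬ W col true 3 p r J) (hJ : ∀ t ∈ [r, a, b, q, c, d, w0, w1, w2, w3], t ∈ J) :
    W col false 3 w0 w1 {w1, p, r, a, b, q, c, d, w2, w3} := by
  by_contra hcon
  refine chk_sound col (lab p [p, r, a, b, q, c, d, w0, w1, w2, w3]) _ ?_ _ _ ?_ i01_chk
  · simp only [List.forall_mem_cons]
    exact ⟨holds_lab hnd (by decide) (by simp) hred hJ,
      holds_lab hnd (by decide) (by simp) hcon (by simp [lab]), by simp⟩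
  · simp only [List.forall_mem_cons] at hB
    simp only [List.forall_mem_cons, ec_ek, lab, List.getD_cons_zero, List.getD_cons_succ]
    simp [hr2, hB]

theorem holds_lab2 {col : Finset V → Bool} {d : V} {L : List V} {b : Bool} {n s t : ℕ}
    {M : List ℕ} {J : Finset V} (hL : ((t :: M).map (lab d L)).Nodup)
    (hW : ¬ W col b n (lab d L s) (lab d L t) J) (hJ : ∀ x ∈ (t :: M).map (lab d L), x ∈ J) :
    Con.holds col (lab d L) ⟨b, n, s, t, M⟩ := holds_of col _ b n s t M J hL hJ hW

theorem v6c {col : Finset V → Bool} {p r a b q c d Q C D c0 e t1 t2 t3 e' u1 u2 u3 : V}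
    {J J' K K' : Finset V}
    (hnd : [p, r, a, b, q, c, d, Q, C, D, c0, e, t1, t2, t3].Nodup)
    (hnd' : [p, r, a, b, q, c, d, Q, C, D, c0, e', u1, u2, u3].Nodup)
    (hr1 : col {p, a, b, q} = true) (hr2 : col {r, q, c, d} = true) (hr3 : col {p, Q, C, D} = true)
    (h1 : ¬ W col true 3 p r J) (hJ : ∀ x ∈ [r, a, b, q, c, d, c0, e, t1, t2, t3], x ∈ J)
    (h2 : ¬ W col true 3 Q q K) (hK : ∀ x ∈ [q, C, D, p, a, b, c0, e, t1, t2, t3], x ∈ K)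
    (h1' : ¬ W col true 3 p r J') (hJ' : ∀ x ∈ [r, a, b, q, c, d, c0, e', u1, u2, u3], x ∈ J')
    (h2' : ¬ W col true 3 Q q K') (hK' : ∀ x ∈ [q, C, D, p, a, b, c0, e', u1, u2, u3], x ∈ K')
    (hA : ¬ W col false 3 c0 e {e, a, b, q, c, d, p, t1, t2, t3})
    (hB : ¬ W col false 3 c0 e' {e', C, D, p, a, b, Q, u1, u2, u3}) : False := by
  refine chk_sound col (lab p [p, r, a, b, q, c, d, Q, C, D, c0, e, t1, t2, t3, e', u1, u2, u3])
    _ ?_ _ _ ?_ v6_chk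
  · simp only [List.nodup_cons, List.mem_cons, List.not_mem_nil, not_or, or_false] at hnd hnd'
    simp only [List.forall_mem_cons]
    refine ⟨holds_lab2 ?_ h1 hJ, holds_lab2 ?_ h2 hK, holds_lab2 ?_ h1' hJ', holds_lab2 ?_ h2' hK',
      holds_lab2 ?_ hA (by simp [lab]), holds_lab2 ?_ hB (by simp [lab]), by simp⟩
    all_goals
      simp only [List.map, lab, List.getD_cons_zero, List.getD_cons_succ, List.nodup_cons,
        List.mem_cons, List.not_mem_nil, not_or, or_false]
      grind
  · simp only [List.forall_mem_cons, ec_ek, lab, List.getD_cons_zero, List.getD_cons_succ]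
    simp [hr1, hr2, hr3]

theorem basec {col : Finset V → Bool} {L : List V} (hnd : L.Nodup) (hl : L.length = 10) {d : V}
    (hr1 : col {lab d L 0, lab d L 1, lab d L 2, lab d L 3} = true)
    (hr2 : col {lab d L 0, lab d L 3, lab d L 4, lab d L 5} = true)
    (h : ∀ b, ∀ s ∈ L, ¬ W col b 3 s s L.toFinset) : False := by
  have hm : ∀ i < 10, lab d L i ∈ L := by
    intro i hi
    rw [lab, List.getD_eq_getElem _ _ (by omega)]
    exact List.getElem_mem _
  refine chk_sound col (lab d L) _ ?_ _ _ ?_ base_chk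
  · simp only [List.forall_mem_cons]
    refine ⟨?_, ?_, ?_, ?_, ?_, ?_, ?_, ?_, ?_, ?_, ?_, ?_, ?_, ?_, ?_, ?_, ?_, ?_, ?_, ?_, by simp⟩
    all_goals
      refine holds_lab hnd (by decide) (by simp [hl]) (h _ _ (hm _ (by norm_num))) ?_
      intro x hx
      obtain ⟨i, hi, rfl⟩ := List.mem_map.mp hx
      rw [List.mem_toFinset]
      apply hm
      simp at hi
      omega
  · simp only [List.forall_mem_cons, ec_ek]
    simp [hr1, hr2]

end LC

namespace LC
variable {V : Type*} [DecidableEq V]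

theorem NE.symm {col : Finset V → Bool} {z : V} {S : Finset V} {f g : V} (h : NE col z S f g)
    (hfg : f ≠ g) (hg : g ∉ insert z S) : NE col z S g f := fun h' =>
  h (W.rev h' hg hfg.symm)

/-- bad: no set of size two covers all NE-pairs in `Q` -/
def Bad (col : Finset V → Bool) (z : V) (S Q : Finset V) : Prop :=
  ∀ C : Finset V, C.card ≤ 2 → ∃ f ∈ Q, ∃ g ∈ Q, f ≠ g ∧ NE col z S f g ∧ f ∉ C ∧ g ∉ C

theorem P6 {col : Finset V → Bool} {z s f g : V} {S : Finset V} (hS : S.card = 5) (hz : z ∉ S)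
    (hs : s ∈ S) (hf : f ∉ insert z S) (hg : g ∉ insert z S) (hfg : f ≠ g)
    (h : NE col z S f g) : ∃ w, (w = f ∨ w = g) ∧ W col true 2 z s (insert w S) := by
  obtain ⟨a, b, c, d, rfl, hnd⟩ := enum5 hS hs
  have hnd2 : [z, s, a, b, c, d, f, g].Nodup := by
    simp only [List.nodup_cons, List.mem_cons, List.not_mem_nil, not_or, or_false,
      Finset.mem_insert, Finset.mem_singleton] at *
    grind
  rcases P6c (col := col) hnd2 h with h | h
  · refine ⟨f, Or.inl rfl, h.mono ?_⟩
    intro x; simp only [Finset.mem_insert, Finset.mem_singleton]; grind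
  · refine ⟨g, Or.inr rfl, h.mono ?_⟩
    intro x; simp only [Finset.mem_insert, Finset.mem_singleton]; grind

theorem factB {col : Finset V → Bool} {z r s f g w w' : V} {S J : Finset V} (hS : S.card = 5)
    (hz : z ∉ S) (hs : s ∈ S) (hf : f ∉ insert z S) (hg : g ∉ insert z S) (hfg : f ≠ g)
    (h : NE col z S f g) (hred : ¬ W col true 3 z r J) (hrJ : r ∈ J) (hSJ : S ⊆ J)
    (hfJ : f ∈ J) (hgJ : g ∈ J) (hwJ : w ∈ J) (hwJ' : w' ∈ J) (hww : w ≠ w')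
    (hwf : w ≠ f) (hwg : w ≠ g) (hwf' : w' ≠ f) (hwg' : w' ≠ g) (hwS : w ∉ S) (hwS' : w' ∉ S)
    (hrf : r ≠ f) (hrg : r ≠ g) (hrw : r ≠ w) (hrw' : r ≠ w') (hrS : r ∉ S) :
    col {r, s, w, w'} = false := by
  by_contra hc
  rw [Bool.not_eq_false] at hc
  obtain ⟨x, hx, hW⟩ := P6 hS hz hs hf hg hfg h
  apply hred
  have h1 : W col true 1 s r {w, w', r} := by
    refine W.one (x := w) (y := w') ?_ (by simp) (by simp) (by simp) hww hrw.symm hrw'.symm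
    rw [← hc]; congr 1; ext y; simp; tauto
  refine (hW.append h1 ?_).mono ?_
  · rw [Finset.disjoint_left]
    intro y hy
    simp only [Finset.mem_insert, Finset.mem_singleton] at hy ⊢
    rintro (rfl | rfl | rfl) <;> rcases hx with rfl | rfl <;> tauto
  · intro y hy
    simp only [Finset.mem_union, Finset.mem_insert, Finset.mem_singleton] at hy
    rcases hy with (rfl | hy) | rfl | rfl | rfl
    · rcases hx with rfl | rfl <;> assumption
    · exact hSJ hy
    all_goals assumption

theorem graph_pat {Q : Finset V} {E G : V → V → Prop}
    (hs : ∀ x ∈ Q, ∀ y ∈ Q, x ≠ y → E x y → E y x)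
    (hbad : ∀ C : Finset V, C.card ≤ 2 → ∃ x ∈ Q, ∃ y ∈ Q, x ≠ y ∧ E x y ∧ x ∉ C ∧ y ∉ C)
    (hG : ∀ x ∈ Q, ∀ y ∈ Q, x ≠ y → G x y → G y x)
    (p0 : ∀ w0 w1 w2 w3 w4, [w0, w1, w2, w3, w4].Nodup → (∀ x ∈ [w0, w1, w2, w3, w4], x ∈ Q) →
      E w0 w2 → E w1 w2 → E w3 w4 → G w0 w1)
    (p1 : ∀ w0 w1 w2 w3 w4, [w0, w1, w2, w3, w4].Nodup → (∀ x ∈ [w0, w1, w2, w3, w4], x ∈ Q) →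
      E w2 w3 → E w2 w4 → E w3 w4 → G w0 w1)
    (p2 : ∀ w0 w1 w2 w3 w4, [w0, w1, w2, w3, w4].Nodup → (∀ x ∈ [w0, w1, w2, w3, w4], x ∈ Q) →
      E w0 w2 → E w0 w3 → E w1 w4 → E w2 w3 → G w0 w1)
    (p3 : ∀ w0 w1 w2 w3 w4, [w0, w1, w2, w3, w4].Nodup → (∀ x ∈ [w0, w1, w2, w3, w4], x ∈ Q) →
      E w0 w2 → E w1 w3 → E w2 w4 → E w3 w4 → G w0 w1)
    (p4 : ∀ w0 w1 w2 w3, [w0, w1, w2, w3].Nodup → (∀ x ∈ [w0, w1, w2, w3], x ∈ Q) →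
      E w0 w2 → E w0 w3 → E w1 w2 → E w1 w3 → E w2 w3 → G w0 w1)
    (p5 : ∀ w0 w1 w2 w3 w4 w5, [w0, w1, w2, w3, w4, w5].Nodup →
      (∀ x ∈ [w0, w1, w2, w3, w4, w5], x ∈ Q) → E w2 w3 → E w4 w5 → G w0 w1)
    (p6 : ∀ w0 w1 w2 w3 w4 w5, [w0, w1, w2, w3, w4, w5].Nodup →
      (∀ x ∈ [w0, w1, w2, w3, w4, w5], x ∈ Q) → E w0 w2 → E w1 w3 → E w4 w5 → G w0 w1)
    {u v : V} (hu : u ∈ Q) (hv : v ∈ Q) (huv : u ≠ v) : G u v := by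
  have c2 : ∀ x y : V, ({x, y} : Finset V).card ≤ 2 := fun x y => Finset.card_le_two
  have hb : ∀ x y : V, ∃ a ∈ Q, ∃ b ∈ Q, a ≠ b ∧ E a b ∧ E b a ∧ a ≠ x ∧ a ≠ y ∧ b ≠ x ∧ b ≠ y := by
    intro x y
    obtain ⟨a, ha, b, hb, h1, h2, h3, h4⟩ := hbad {x, y} (c2 x y)
    simp only [Finset.mem_insert, Finset.mem_singleton, not_or] at h3 h4
    exact ⟨a, ha, b, hb, h1, h2, hs a ha b hb h1 h2, h3.1, h3.2, h4.1, h4.2⟩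
  clear hbad
  simp only [List.nodup_cons, List.mem_cons, List.not_mem_nil, not_or, or_false, forall_eq_or_imp,
    forall_eq, not_false_eq_true, List.nodup_nil, and_true] at p0 p1 p2 p3 p4 p5 p6
  -- star reduction
  have star : ∃ a ∈ Q, ∃ b ∈ Q, a ≠ b ∧ E a b ∧ E b a ∧ a ≠ u ∧ a ≠ v ∧ b ≠ u ∧ b ≠ v ∧
      (G u v ∨ ∀ x ∈ Q, ∀ y ∈ Q, x ≠ y → E x y → x ≠ u → x ≠ v → y ≠ u → y ≠ v → x = a ∨ y = a) := by
    obtain ⟨a, ha, b, hbQ, hab, e1, e2, h1, h2, h3, h4⟩ := hb u v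
    by_cases hA : ∀ x ∈ Q, ∀ y ∈ Q, x ≠ y → E x y → x ≠ u → x ≠ v → y ≠ u → y ≠ v → x = a ∨ y = a
    · exact ⟨a, ha, b, hbQ, hab, e1, e2, h1, h2, h3, h4, Or.inr hA⟩
    by_cases hB : ∀ x ∈ Q, ∀ y ∈ Q, x ≠ y → E x y → x ≠ u → x ≠ v → y ≠ u → y ≠ v → x = b ∨ y = b
    · exact ⟨b, hbQ, a, ha, hab.symm, e2, e1, h3, h4, h1, h2, Or.inr hB⟩
    refine ⟨a, ha, b, hbQ, hab, e1, e2, h1, h2, h3, h4, Or.inl ?_⟩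
    push Not at hA hB
    obtain ⟨x, hx, y, hy, hxy, exy, x1, x2, y1, y2, x3, y3⟩ := hA
    obtain ⟨x', hx', y', hy', hxy', exy', x1', x2', y1', y2', x3', y3'⟩ := hB
    have eyx := hs x hx y hy hxy exy
    have eyx' := hs x' hx' y' hy' hxy' exy'
    by_cases d1 : x ≠ b ∧ y ≠ b
    · exact p5 u v a b x y (by grind) (by grind) e1 exy
    by_cases d2 : x' ≠ a ∧ y' ≠ a
    · exact p5 u v a b x' y' (by grind) (by grind) e1 exy'
    -- edges b-p , a-p'
    obtain ⟨p, hp, ebp, hpa, hpb, hpu, hpv⟩ : ∃ p ∈ Q, E b p ∧ p ≠ a ∧ p ≠ b ∧ p ≠ u ∧ p ≠ v := by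
      by_cases hxb : x = b
      · subst hxb; exact ⟨y, hy, exy, by grind⟩
      · have : y = b := by grind
        subst this; exact ⟨x, hx, eyx, by grind⟩
    obtain ⟨p', hp', eap, hpa', hpb', hpu', hpv'⟩ :
        ∃ p ∈ Q, E a p ∧ p ≠ a ∧ p ≠ b ∧ p ≠ u ∧ p ≠ v := by
      by_cases hxb : x' = a
      · subst hxb; exact ⟨y', hy', exy', by grind⟩
      · have : y' = a := by grind
        subst this; exact ⟨x', hx', eyx', by grind⟩
    by_cases hpp : p = p'
    · subst hpp
      exact p1 u v a b p (by grind) (by grind) e1 eap ebp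
    · exact p5 u v b p a p' (by grind) (by grind) ebp eap
  obtain ⟨a, ha, b, hbQ, hab, eab, eba, hau, hav, hbu, hbv, hst | hst⟩ := star
  · exact hst
  have nb : ∀ c : V, (c = a ∨ ∀ x ∈ Q, ∀ y ∈ Q, x ≠ y → E x y → x ≠ u → x ≠ v → y ≠ u → y ≠ v →
      x = c ∨ y = c) → (∃ x ∈ Q, E u x ∧ x ≠ c ∧ x ≠ v ∧ x ≠ u) ∧
        (∃ x ∈ Q, E v x ∧ x ≠ c ∧ x ≠ u ∧ x ≠ v) := by
    intro c hc
    have hst' : ∀ x ∈ Q, ∀ y ∈ Q, x ≠ y → E x y → x ≠ u → x ≠ v → y ≠ u → y ≠ v →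
      x = c ∨ y = c := by
      rcases hc with rfl | hc
      · exact hst
      · exact hc
    constructor
    · obtain ⟨x, hx, y, hy, hxy, exy, eyx, h1, h2, h3, h4⟩ := hb c v
      have := hst' x hx y hy hxy exy
      by_cases hxu : x = u
      · subst hxu; exact ⟨y, hy, exy, by grind⟩
      · have : y = u := by grind
        subst this; exact ⟨x, hx, eyx, by grind⟩
    · obtain ⟨x, hx, y, hy, hxy, exy, eyx, h1, h2, h3, h4⟩ := hb c u
      have := hst' x hx y hy hxy exy
      by_cases hxu : x = v
      · subst hxu; exact ⟨y, hy, exy, by grind⟩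
      · have : y = v := by grind
        subst this; exact ⟨x, hx, eyx, by grind⟩
  obtain ⟨⟨x, hx, eux, hxa, hxv, hxu⟩, ⟨y, hy, evy, hya, hyu, hyv⟩⟩ := nb a (Or.inl rfl)
  -- leaves
  have leaf : ∀ l ∈ Q, E a l → l ≠ a → l ≠ u → l ≠ v → l ≠ x → l ≠ y → G u v := by
    intro l hl eal h1 h2 h3 h4 h5
    by_cases hxy : x = y
    · subst hxy; exact p0 u v x a l (by grind) (by grind) eux evy eal
    · exact p6 u v x y a l (by grind) (by grind) eux evy eal
  by_cases hb1 : b ≠ x ∧ b ≠ y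
  · exact leaf b hbQ eab hab.symm hbu hbv hb1.1 hb1.2
  by_cases hbs : ∀ x ∈ Q, ∀ y ∈ Q, x ≠ y → E x y → x ≠ u → x ≠ v → y ≠ u → y ≠ v → x = b ∨ y = b
  swap
  · -- second leaf l
    push Not at hbs
    obtain ⟨x', hx', y', hy', hxy', exy', x1', x2', y1', y2', x3', y3'⟩ := hbs
    obtain ⟨l, hl, eal, hla, hlb, hlu, hlv⟩ : ∃ l ∈ Q, E a l ∧ l ≠ a ∧ l ≠ b ∧ l ≠ u ∧ l ≠ v := by
      rcases hst x' hx' y' hy' hxy' exy' x1' x2' y1' y2' with rfl | rfl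
      · exact ⟨y', hy', exy', by grind⟩
      · exact ⟨x', hx', hs _ hx' _ hy' hxy' exy', by grind⟩
    by_cases hl1 : l ≠ x ∧ l ≠ y
    · exact leaf l hl eal hla hlu hlv hl1.1 hl1.2
    have hxy : x ≠ y := by grind
    have exa : E x a := by
      apply hs a ha x hx (Ne.symm hxa)
      grind
    have eya : E y a := by
      apply hs a ha y hy (Ne.symm hya)
      grind
    exact p3 u v x y a (by grind) (by grind) eux evy exa eya
  obtain ⟨⟨x', hx', eux', hxb', hxv', hxu'⟩, ⟨y', hy', evy', hyb', hyu', hyv'⟩⟩ := nb b (Or.inr hbs)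
  -- only H-edge is ab
  have fin : ∀ u v, u ∈ Q → v ∈ Q → u ≠ v → a ≠ u → a ≠ v → b ≠ u → b ≠ v → E u a → E u b →
      (∃ y ∈ Q, E v y ∧ y ≠ a ∧ y ≠ u ∧ y ≠ v) → (∃ y ∈ Q, E v y ∧ y ≠ b ∧ y ≠ u ∧ y ≠ v) → G u v := by
    rintro u v hu hv huv hau hav hbu hbv eua eub ⟨y, hy, evy, h1, h2, h3⟩ ⟨y', hy', evy', h1', h2', h3'⟩
    by_cases hyb : y = b
    · by_cases hya : y' = a
      · subst hyb hya
        exact p4 u v y' y (by grind) (by grind) eua eub evy' evy eab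
      · exact p2 u v a b y' (by grind) (by grind) eua eub evy' eab
    · exact p2 u v a b y (by grind) (by grind) eua eub evy eab
  have leaf' : x' ≠ a → y' ≠ a → G u v := by
    intro h1 h2
    by_cases hxy : x' = y'
    · subst hxy; exact p0 u v x' a b (by grind) (by grind) eux' evy' eab
    · exact p6 u v x' y' a b (by grind) (by grind) eux' evy' eab
  have hvu : G v u → G u v := hG v hv u hu (Ne.symm huv)
  by_cases hxb : x = b
  · subst hxb
    by_cases hxa' : x' = a
    · subst hxa'
      exact fin u v hu hv huv hau hav hbu hbv eux' eux ⟨y, hy, evy, hya, hyu, hyv⟩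
        ⟨y', hy', evy', hyb', hyu', hyv'⟩
    by_cases hya' : y' = a
    · subst hya'
      by_cases hyb : y = x
      · subst hyb
        exact hvu (fin v u hv hu (Ne.symm huv) hav hau hbv hbu evy' evy ⟨x', hx', eux', by grind⟩
          ⟨x', hx', eux', by grind⟩)
      · by_cases hxy : x' = y
        · subst hxy; exact p0 u v x' y' x (by grind) (by grind) eux' evy eab
        · exact p6 u v x' y y' x (by grind) (by grind) eux' evy eab
    · exact leaf' hxa' hya'
  · have hyb : y = b := by grind
    subst hyb
    by_cases hya' : y' = a
    · subst hya'
      exact hvu (fin v u hv hu (Ne.symm huv) hav hau hbv hbu evy' evy ⟨x, hx, eux, by grind⟩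
        ⟨x', hx', eux', by grind⟩)
    by_cases hxa' : x' = a
    · subst hxa'
      by_cases hxy : x = y'
      · subst hxy; exact p0 u v x x' y (by grind) (by grind) eux evy' eab
      · exact p6 u v x y' x' y (by grind) (by grind) eux evy' eab
    · exact leaf' hxa' hya'

end LC

namespace LC
variable {V : Type*} [DecidableEq V]

set_option maxHeartbeats 1000000 in
theorem F3 {col : Finset V → Bool} {z r s : V} {S Q J : Finset V} (hS : S.card = 5) (hz : z ∉ S)
    (hr : r ∉ S) (hzr : z ≠ r) (hQ : ∀ x ∈ Q, x ∉ S ∧ x ≠ z ∧ x ≠ r) (hQc : 5 ≤ Q.card)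
    (hbad : Bad col z S Q) (hred : ¬ W col true 3 z r J) (hrJ : r ∈ J) (hSJ : S ⊆ J) (hQJ : Q ⊆ J)
    (hs : s ∈ S) {w w' : V} (hw : w ∈ Q) (hw' : w' ∈ Q) (hww : w ≠ w') :
    Cn col false 2 w w' (insert r (S.erase s)) := by
  obtain ⟨b, q, c, d, rfl, hnd⟩ := enum5 hS hs
  have hX : insert r (({s, b, q, c, d} : Finset V).erase s) = {r, b, q, c, d} := by
    congr 1
    ext x
    simp only [Finset.mem_erase, Finset.mem_insert, Finset.mem_singleton]
    simp only [List.nodup_cons, List.mem_cons, List.not_mem_nil, not_or, or_false] at hnd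
    grind
  rw [hX]
  have base : ∀ L : List V, L.Nodup → (∀ x ∈ L, x ∈ Q) →
      (z :: r :: s :: b :: q :: c :: d :: L).Nodup := by
    intro L h1 h2
    have h3 : ([z, r, s, b, q, c, d] ++ L).Nodup := by
      rw [List.nodup_append]
      refine ⟨?_, h1, ?_⟩
      · refine List.nodup_cons.mpr ⟨?_, List.nodup_cons.mpr ⟨?_, hnd⟩⟩
        · simp only [List.mem_cons, not_or, Finset.mem_insert, Finset.mem_singleton] at hz ⊢
          simp; grind
        · simpa using hr
      · intro x hx y hy hxy
        subst hxy
        have := hQ x (h2 x hy)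
        simp only [List.mem_cons, Finset.mem_insert, Finset.mem_singleton,
          List.not_mem_nil, or_false] at hx this
        grind
    exact h3
  have hJ : ∀ L : List V, (∀ x ∈ L, x ∈ Q) → ∀ x ∈ r :: s :: b :: q :: c :: d :: L, x ∈ J := by
    intro L h2 x hx
    have h3 : x ∈ [r, s, b, q, c, d] ++ L := hx
    rcases List.mem_append.mp h3 with h | h
    · by_cases hxr : x = r
      · rw [hxr]; exact hrJ
      · apply hSJ
        simp only [List.mem_cons, List.not_mem_nil, or_false, Finset.mem_insert,
          Finset.mem_singleton] at h ⊢
        grind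
    · exact hQJ (h2 x h)
  have hnot : ∀ x ∈ Q, x ∉ insert z ({s, b, q, c, d} : Finset V) := by
    intro x hx
    have := hQ x hx
    rw [Finset.mem_insert]; grind
  have hnot2 : ∀ x ∈ Q, x ∉ ({r, b, q, c, d} : Finset V) := by
    intro x hx
    have := hQ x hx
    simp only [Finset.mem_insert, Finset.mem_singleton] at this ⊢; grind
  refine graph_pat (Q := Q) (E := NE col z {s, b, q, c, d})
    (G := fun w w' => Cn col false 2 w w' {r, b, q, c, d}) ?_ ?_ ?_ ?_ ?_ ?_ ?_ ?_ ?_ ?_ hw hw' hww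
  · intro x hx y hy hxy h
    exact h.symm hxy (hnot y hy)
  · intro C hC
    exact hbad C hC
  · intro x hx y hy hxy h
    exact W.rev h (hnot2 x hx) hxy
  · intro w0 w1 w2 w3 w4 h1 h2 e1 e2 e3
    exact F3c0 (base _ h1 h2) hred (hJ _ h2) e1 e2 e3
  · intro w0 w1 w2 w3 w4 h1 h2 e1 e2 e3
    exact F3c1 (base _ h1 h2) hred (hJ _ h2) e1 e2 e3
  · intro w0 w1 w2 w3 w4 h1 h2 e1 e2 e3 e4
    exact F3c2 (base _ h1 h2) hred (hJ _ h2) e1 e2 e3 e4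
  · intro w0 w1 w2 w3 w4 h1 h2 e1 e2 e3 e4
    exact F3c3 (base _ h1 h2) hred (hJ _ h2) e1 e2 e3 e4
  · intro w0 w1 w2 w3 h1 h2 e1 e2 e3 e4 e5
    obtain ⟨w4, hw4, hn⟩ : ∃ w4 ∈ Q, w4 ∉ ({w0, w1, w2, w3} : Finset V) := by
      apply Finset.exists_mem_notMem_of_card_lt_card
      exact lt_of_le_of_lt Finset.card_le_four (by omega)
    have h1' : [w0, w1, w2, w3, w4].Nodup := by
      simp only [List.nodup_cons, List.mem_cons, List.not_mem_nil, not_or, or_false,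
        Finset.mem_insert, Finset.mem_singleton] at h1 hn ⊢
      grind
    have h2' : ∀ x ∈ [w0, w1, w2, w3, w4], x ∈ Q := by
      intro x hx
      have : x ∈ [w0, w1, w2, w3] ∨ x = w4 := by
        simp only [List.mem_cons, List.not_mem_nil, or_false] at hx ⊢; grind
      rcases this with h | rfl
      · exact h2 x h
      · exact hw4
    exact F3c4 (base _ h1' h2') hred (hJ _ h2') e1 e2 e3 e4 e5
  · intro w0 w1 w2 w3 w4 w5 h1 h2 e1 e2
    exact F3c5 (base _ h1 h2) hred (hJ _ h2) e1 e2
  · intro w0 w1 w2 w3 w4 w5 h1 h2 e1 e2 e3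
    exact F3c6 (base _ h1 h2) hred (hJ _ h2) e1 e2 e3

end LC

namespace LC
variable {V : Type*} [DecidableEq V]

/-- pointed red cycle -/
structure RC (col : Finset V → Bool) (g : ℕ → V) (m : ℕ) : Prop where
  inj : ∀ i j, 0 < i → i ≤ 3 * m → 0 < j → j ≤ 3 * m → g i = g j → i = j
  close : g (3 * m) = g 0
  red : ∀ i < m, col {g (3 * i), g (3 * i + 1), g (3 * i + 2), g (3 * i + 3)} = true

def Reg (g : ℕ → V) (a b : ℕ) : Finset V := (Finset.Ioc a b).image g

theorem mem_Reg {g : ℕ → V} {a b : ℕ} {x : V} : x ∈ Reg g a b ↔ ∃ i, a < i ∧ i ≤ b ∧ g i = x := by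
  simp [Reg, and_assoc]

theorem Reg_mono {g : ℕ → V} {a b a' b' : ℕ} (h : a' ≤ a) (h' : b ≤ b') : Reg g a b ⊆ Reg g a' b' := by
  intro x
  simp only [mem_Reg]
  rintro ⟨i, h1, h2, h3⟩
  exact ⟨i, by omega, by omega, h3⟩

theorem Reg_union {g : ℕ → V} {a b c : ℕ} (h : a ≤ b) (h' : b ≤ c) :
    Reg g a c = Reg g a b ∪ Reg g b c := by
  ext x
  simp only [Finset.mem_union, mem_Reg]
  constructor
  · rintro ⟨i, h1, h2, h3⟩
    by_cases hi : i ≤ b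
    · exact Or.inl ⟨i, h1, hi, h3⟩
    · exact Or.inr ⟨i, by omega, h2, h3⟩
  · rintro (⟨i, h1, h2, h3⟩ | ⟨i, h1, h2, h3⟩)
    · exact ⟨i, h1, by omega, h3⟩
    · exact ⟨i, by omega, h2, h3⟩

theorem RC.disj {col : Finset V → Bool} {g : ℕ → V} {m : ℕ} (h : RC col g m) {a b c d : ℕ}
    (hbc : b ≤ c) (hd : d ≤ 3 * m) : Disjoint (Reg g a b) (Reg g c d) := by
  rw [Finset.disjoint_left]
  intro x hx hx'
  rw [mem_Reg] at hx hx'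
  obtain ⟨i, h1, h2, h3⟩ := hx
  obtain ⟨j, h4, h5, h6⟩ := hx'
  have := h.inj i j (by omega) (by omega) (by omega) (by omega) (h3.trans h6.symm)
  omega

theorem RC.walk {col : Finset V → Bool} {g : ℕ → V} {m : ℕ} (h : RC col g m) (a : ℕ) :
    ∀ k, a + k ≤ m → W col true k (g (3 * a)) (g (3 * (a + k))) (Reg g (3 * a) (3 * (a + k)))
  | 0, _ => by simpa using W.zero _ _
  | k + 1, hk => by
      have h1 := h.walk a k (by omega)
      have h2 : W col true 1 (g (3 * (a + k))) (g (3 * (a + (k + 1))))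
          (Reg g (3 * (a + k)) (3 * (a + (k + 1)))) := by
        have e : 3 * (a + (k + 1)) = 3 * (a + k) + 3 := by ring
        rw [e]
        have hne : ∀ i j, 3 * (a + k) < i → i ≤ 3 * (a + k) + 3 → 3 * (a + k) < j →
            j ≤ 3 * (a + k) + 3 → i ≠ j → g i ≠ g j := by
          intro i j h1 h2 h3 h4 h5 h6
          exact h5 (h.inj i j (by omega) (by omega) (by omega) (by omega) h6)
        refine W.one (h.red (a + k) (by omega)) ?_ ?_ ?_ ?_ ?_ ?_
        · exact mem_Reg.mpr ⟨_, by omega, by omega, rfl⟩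
        · exact mem_Reg.mpr ⟨_, by omega, by omega, rfl⟩
        · exact mem_Reg.mpr ⟨_, by omega, by omega, rfl⟩
        all_goals apply hne <;> omega
      have h3 := h1.append h2 (h.disj le_rfl (by omega))
      rwa [← Reg_union (by omega) (by omega)] at h3

/-- interior of the block at position `i` -/
def Blk (g : ℕ → V) (i : ℕ) : Finset V := Reg g i (i + 5)

theorem Reg_blk {g : ℕ → V} {i : ℕ} : Reg g i (i + 6) = insert (g (i + 6)) (Blk g i) := by
  ext x
  simp only [Blk, mem_Reg, Finset.mem_insert]
  constructor
  · rintro ⟨j, h1, h2, h3⟩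
    by_cases hj : j = i + 6
    · subst hj; exact Or.inl h3.symm
    · exact Or.inr ⟨j, h1, by omega, h3⟩
  · rintro (rfl | ⟨j, h1, h2, h3⟩)
    · exact ⟨i + 6, by omega, by omega, rfl⟩
    · exact ⟨j, h1, by omega, h3⟩

theorem RC.blk_card {col : Finset V → Bool} {g : ℕ → V} {m : ℕ} (h : RC col g m) {i : ℕ}
    (hi : i + 5 ≤ 3 * m) : (Blk g i).card = 5 := by
  rw [Blk, Reg, Finset.card_image_of_injOn]
  · simp
  · intro x hx y hy hxy
    simp only [Finset.coe_Ioc, Set.mem_Ioc] at hx hy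
    exact h.inj x y (by omega) (by omega) (by omega) (by omega) hxy

theorem RC.end_notMem {col : Finset V → Bool} {g : ℕ → V} {m : ℕ} (h : RC col g m) {i : ℕ}
    (hi : i + 6 ≤ 3 * m) : g (i + 6) ∉ Blk g i := by
  intro hx
  rw [Blk, mem_Reg] at hx
  obtain ⟨j, h1, h2, h3⟩ := hx
  have := h.inj j (i + 6) (by omega) (by omega) (by omega) (by omega) h3
  omega

def NoCyc (col : Finset V → Bool) (b : Bool) (n : ℕ) : Prop := ∀ s J, ¬ W col b n s s J

structure St (col : Finset V → Bool) (g : ℕ → V) (Wt B X : Finset V) (j0 : ℕ) (z0 : V)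
    (k : ℕ) (z : V) (Q D : Finset V) : Prop where
  hQ : Q ⊆ B
  hD : D.card ≤ 2
  hz : z ∈ insert z0 (Reg g (6 * j0) (6 * (j0 + k)))
  red : W col true (2 * (j0 + k)) (g 0) z (Reg g 0 (6 * (j0 + k)) ∪ (Wt \ Q))
  blue : ∀ w ∈ Q, w ∉ D → ∃ c ∈ X, c ∈ insert w (B \ Q) ∧
    W col false (2 * k) c w (((insert z0 (Reg g (6 * j0) (6 * (j0 + k)))).erase z ∪
      insert w (B \ Q)).erase c)

/-- no red path through the current gap -/
theorem noRed {col : Finset V → Bool} {g : ℕ → V} {m : ℕ} (h : RC col g m) {Wt Q : Finset V}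
    (hW : Disjoint Wt (Reg g 0 (3 * m))) (hn : NoCyc col true (m + 1)) {j L : ℕ} {z : V}
    (hQ : Q ⊆ Wt) (hred : W col true (2 * j) (g 0) z (Reg g 0 (6 * j) ∪ (Wt \ Q)))
    (hL : 2 * j + L ≤ m) :
    ¬ W col true (L + 1) z (g (6 * j + 3 * L)) (Reg g (6 * j) (6 * j + 3 * L) ∪ Q) := by
  intro hc
  have h1 := h.walk (2 * j + L) (m - (2 * j + L)) (by omega)
  rw [show 2 * j + L + (m - (2 * j + L)) = m by omega, h.close,
    show 3 * (2 * j + L) = 6 * j + 3 * L by ring] at h1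
  have h2 := (hred.append hc ?_).append h1 ?_
  · rw [show 2 * j + (L + 1) + (m - (2 * j + L)) = m + 1 by omega] at h2
    exact hn _ _ h2
  · have d1 := h.disj (a := 0) (b := 6 * j) (c := 6 * j) (d := 6 * j + 3 * L) le_rfl (by omega)
    have d2 := hW.mono_right (Reg_mono (g := g) (a := 6 * j) (b := 6 * j + 3 * L)
      (a' := 0) (b' := 3 * m) (by omega) (by omega))
    have d3 := hW.mono_right (Reg_mono (g := g) (a := 0) (b := 6 * j)
      (a' := 0) (b' := 3 * m) (by omega) (by omega))
    rw [Finset.disjoint_left] at d1 d2 d3 ⊢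
    intro x hx hx'
    simp only [Finset.mem_union, Finset.mem_sdiff] at hx hx'
    have := @hQ x
    grind
  · have d1 := h.disj (a := 0) (b := 6 * j + 3 * L) (c := 6 * j + 3 * L) (d := 3 * m) le_rfl (by omega)
    have d2 := hW.mono_right (Reg_mono (g := g) (a := 6 * j + 3 * L) (b := 3 * m)
      (a' := 0) (b' := 3 * m) (by omega) (by omega))
    rw [Reg_union (b := 6 * j) (by omega) (by omega)] at d1
    rw [Finset.disjoint_left] at d1 d2 ⊢
    intro x hx hx'
    have := @hQ x
    have := @d1 x
    have := @d2 x
    simp only [Finset.mem_union, Finset.mem_sdiff] at *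
    grind

set_option maxHeartbeats 1000000 in
theorem step_core {col : Finset V → Bool} {v z0 z r s : V} {S A A0 Wt B X Q D : Finset V} {k j : ℕ}
    (hQB : Q ⊆ B) (hBW : B ⊆ Wt) (hD : D.card ≤ 2) (hz : z ∈ insert z0 A)
    (hred : W col true (2 * j) v z (A0 ∪ (Wt \ Q)))
    (hblue : ∀ w ∈ Q, w ∉ D → ∃ c ∈ X, c ∈ insert w (B \ Q) ∧
      W col false (2 * k) c w (((insert z0 A).erase z ∪ insert w (B \ Q)).erase c))
    (hnr : ¬ W col true 3 z r (insert r S ∪ Q)) (hS : S.card = 5) (hrS : r ∉ S)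
    (d0 : Disjoint A0 (insert r S)) (hA : A ⊆ A0) (dW : Disjoint Wt (A0 ∪ insert r S))
    (hwalk : W col true (2 * (j + 1)) v r (A0 ∪ insert r S)) (hs : s ∈ S)
    (hz0 : z0 ∉ A ∪ insert r S) (hz0W : z0 ∉ Wt) (hQc : 5 ≤ Q.card) :
    ∃ (z' : V) (Q' D' : Finset V), (Q' ⊆ B ∧ D'.card ≤ 2 ∧ z' ∈ insert z0 (A ∪ insert r S) ∧
      W col true (2 * (j + 1)) v z' ((A0 ∪ insert r S) ∪ (Wt \ Q')) ∧
      (∀ w ∈ Q', w ∉ D' → ∃ c ∈ X, c ∈ insert w (B \ Q') ∧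
      W col false (2 * (k + 1)) c w (((insert z0 (A ∪ insert r S)).erase z' ∪
        insert w (B \ Q')).erase c))) ∧ Q'.card + 1 = Q.card ∧ (¬ Bad col z S Q → z' = r) := by
  have hQ : Q ⊆ Wt := hQB.trans hBW
  have dW' : ∀ x ∈ Wt, x ∉ A0 ∧ x ≠ r ∧ x ∉ S := by
    intro x hx
    have := Finset.disjoint_left.mp dW hx
    simp only [Finset.mem_union, Finset.mem_insert] at this
    tauto
  have d0' : ∀ x ∈ A0, x ≠ r ∧ x ∉ S := by
    intro x hx
    have := Finset.disjoint_left.mp d0 hx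
    simp only [Finset.mem_insert] at this
    tauto
  have hz0' : z0 ∉ A ∧ z0 ≠ r ∧ z0 ∉ S := by
    simp only [Finset.mem_union, Finset.mem_insert] at hz0
    tauto
  have hzS : z ≠ r ∧ z ∉ S ∧ z ∉ Wt := by
    rcases Finset.mem_insert.mp hz with rfl | hz
    · exact ⟨hz0'.2.1, hz0'.2.2, hz0W⟩
    · have := d0' z (hA hz)
      refine ⟨this.1, this.2, fun hw => (dW' z hw).1 (hA hz)⟩
  clear dW d0 hz0
  rw [show 2 * (k + 1) = 2 * k + 2 by ring]
  by_cases hB : Bad col z S Q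
  · obtain ⟨f, hf, f', hf', hff, hne, hfD, hfD'⟩ := hB D hD
    have hnot : ∀ x ∈ Q, x ∉ insert z S := by
      intro x hx
      have := dW' x (hQ hx)
      rw [Finset.mem_insert]
      rintro (rfl | h)
      · exact hzS.2.2 (hQ hx)
      · exact this.2.2 h
    obtain ⟨u, hu, hW2⟩ := P6 hS hzS.2.1 hs (hnot f hf) (hnot f' hf') hff hne
    have huQ : u ∈ Q := by rcases hu with rfl | rfl <;> assumption
    have huD : u ∉ D := by rcases hu with rfl | rfl <;> assumption
    clear hu hf hf' hff hne hfD hfD'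
    obtain ⟨c, hcX, hcm, hcW⟩ := hblue u huQ huD
    refine ⟨s, Q.erase u, ∅, ⟨(Finset.erase_subset _ _).trans hQB, by simp, ?_, ?_, ?_⟩, ?_,
      fun h => (h hB).elim⟩
    · simp only [Finset.mem_insert, Finset.mem_union]; tauto
    · rw [show 2 * (j + 1) = 2 * j + 2 by ring]
      refine (hred.append hW2 ?_).mono ?_
      · rw [Finset.disjoint_left]
        intro x hx hx'
        simp only [Finset.mem_union, Finset.mem_sdiff, Finset.mem_insert] at hx hx'
        have h1 := dW' x
        have h2 := d0' x
        have h3 := dW' u (hQ huQ)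
        grind
      · intro x hx
        have := @hQ x
        simp only [Finset.mem_union, Finset.mem_sdiff, Finset.mem_insert, Finset.mem_erase] at hx ⊢
        grind
    · intro w hw _
      have hwQ := Finset.mem_of_mem_erase hw
      have hwu := Finset.ne_of_mem_erase hw
      have hb2 : Cn col false 2 u w (insert r (S.erase s)) := by
        refine F3 hS hzS.2.1 hrS hzS.1 ?_ hQc hB hnr ?_ ?_ ?_ hs huQ hwQ hwu.symm
        · intro x hx
          have := dW' x (hQ hx)
          refine ⟨this.2.2, ?_, this.2.1⟩
          rintro rfl
          exact hzS.2.2 (hQ hx)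
        · simp
        · intro x hx; simp [hx]
        · intro x hx; simp [hx]
      refine ⟨c, hcX, ?_, (hcW.append hb2 ?_).mono ?_⟩
      · simp only [Finset.mem_insert, Finset.mem_sdiff, Finset.mem_erase] at hcm ⊢
        have := @hQB u
        have := @hBW c
        grind
      · rw [Finset.disjoint_left]
        intro x hx hx'
        have h1 := dW' x
        have h2 := d0' x
        have h3 := @hA x
        have h4 := @hQB x
        have h4' := @hBW x
        simp only [Finset.mem_union, Finset.mem_sdiff, Finset.mem_insert, Finset.mem_erase] at hx hx'
        grind
      · intro x hx
        have h1 := dW' x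
        have h2 := d0' x
        have h3 := @hA x
        have h4 := @hQB x
        have h4' := @hBW x
        have h5 := @hQB c
        have h5' := @hBW c
        have h9 := @hQB u
        have h6 := dW' c
        simp only [Finset.mem_union, Finset.mem_sdiff, Finset.mem_insert, Finset.mem_erase] at hx hcm ⊢
        grind
    · rw [Finset.card_erase_of_mem huQ]; omega
  · have hB' := hB
    unfold Bad at hB'
    push Not at hB'
    obtain ⟨C, hC, hcov⟩ := hB'
    obtain ⟨u, huQ, hu⟩ : ∃ u ∈ Q, u ∉ D ∪ C := by
      apply Finset.exists_mem_notMem_of_card_lt_card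
      have := Finset.card_union_le D C
      omega
    rw [Finset.mem_union, not_or] at hu
    obtain ⟨c, hcX, hcm, hcW⟩ := hblue u huQ hu.1
    refine ⟨r, Q.erase u, C, ⟨(Finset.erase_subset _ _).trans hQB, hC, ?_, ?_, ?_⟩, ?_,
      fun _ => rfl⟩
    · simp only [Finset.mem_insert, Finset.mem_union]; tauto
    · exact hwalk.mono Finset.subset_union_left
    · intro w hw hwC
      have hwQ := Finset.mem_of_mem_erase hw
      have hwu := Finset.ne_of_mem_erase hw
      have hb2 : Cn col false 2 u w (insert z S) := by
        by_contra hne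
        exact hwC (hcov u huQ w hwQ hwu.symm hne hu.2)
      refine ⟨c, hcX, ?_, (hcW.append hb2 ?_).mono ?_⟩
      · simp only [Finset.mem_insert, Finset.mem_sdiff, Finset.mem_erase] at hcm ⊢
        have := @hQB u
        have := @hBW c
        grind
      · rw [Finset.disjoint_left]
        intro x hx hx'
        have h1 := dW' x
        have h2 := d0' x
        have h3 := @hA x
        have h4 := @hQB x
        have h4' := @hBW x
        simp only [Finset.mem_union, Finset.mem_sdiff, Finset.mem_insert, Finset.mem_erase] at hx hx'
        grind
      · intro x hx
        have h1 := dW' x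
        have h2 := d0' x
        have h3 := @hA x
        have h4 := @hQB x
        have h4' := @hBW x
        have h5 := @hQB c
        have h5' := @hBW c
        have h9 := @hQB u
        have h6 := dW' c
        have h7 := d0' z
        have h8 := @hA z
        simp only [Finset.mem_union, Finset.mem_sdiff, Finset.mem_insert, Finset.mem_erase] at hx hcm hz ⊢
        grind
    · rw [Finset.card_erase_of_mem huQ]; omega

theorem St.step {col : Finset V → Bool} {g : ℕ → V} {m : ℕ} (h : RC col g m) {Wt B X : Finset V}
    (hW : Disjoint Wt (Reg g 0 (3 * m))) (hn : NoCyc col true (m + 1)) {j0 k : ℕ} {z0 z : V}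
    {Q D : Finset V} (st : St col g Wt B X j0 z0 k z Q D) (hQc : 5 ≤ Q.card)
    (hm : 6 * (j0 + k) + 6 ≤ 3 * m) (hz0 : z0 ∉ Reg g (6 * j0) (6 * (j0 + k) + 6)) (hz0W : z0 ∉ Wt) (hBW : B ⊆ Wt) :
    ∃ (z' : V) (Q' D' : Finset V), St col g Wt B X j0 z0 (k + 1) z' Q' D' ∧ Q'.card + 1 = Q.card ∧
      (¬ Bad col z (Blk g (6 * (j0 + k))) Q → z' = g (6 * (j0 + k) + 6)) := by
  obtain ⟨hQ, hD, hz, hred, hblue⟩ := st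
  have hnr := noRed h hW hn (L := 2) (hQ.trans hBW) hred (by omega)
  have e6 : 6 * (j0 + (k + 1)) = 6 * (j0 + k) + 6 := by ring
  have hScard := h.blk_card (i := 6 * (j0 + k)) (by omega)
  have hrS := h.end_notMem (i := 6 * (j0 + k)) (by omega)
  have hRegU : Reg g (6 * j0) (6 * (j0 + k) + 6) = Reg g (6 * j0) (6 * (j0 + k)) ∪
      insert (g (6 * (j0 + k) + 6)) (Blk g (6 * (j0 + k))) := by
    rw [Reg_union (b := 6 * (j0 + k)) (by omega) (by omega), Reg_blk]
  have hRegU0 : Reg g 0 (6 * (j0 + k) + 6) = Reg g 0 (6 * (j0 + k)) ∪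
      insert (g (6 * (j0 + k) + 6)) (Blk g (6 * (j0 + k))) := by
    rw [Reg_union (b := 6 * (j0 + k)) (by omega) (by omega), Reg_blk]
  rw [show 3 * 2 = 6 by rfl, Reg_blk] at hnr
  have d0 : Disjoint (Reg g 0 (6 * (j0 + k)))
      (insert (g (6 * (j0 + k) + 6)) (Blk g (6 * (j0 + k)))) := by
    rw [← Reg_blk]; exact h.disj le_rfl (by omega)
  have hsub : Reg g (6 * j0) (6 * (j0 + k)) ⊆ Reg g 0 (6 * (j0 + k)) := Reg_mono (by omega) le_rfl
  have dW : Disjoint Wt (Reg g 0 (6 * (j0 + k) + 6)) := hW.mono_right (Reg_mono le_rfl (by omega))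
  have hwalk := h.walk 0 (2 * (j0 + k + 1)) (by omega)
  rw [show 3 * (0 + 2 * (j0 + k + 1)) = 6 * (j0 + k) + 6 by ring, Nat.mul_zero] at hwalk
  have hsB : g (6 * (j0 + k) + 1) ∈ Blk g (6 * (j0 + k)) :=
    mem_Reg.mpr ⟨_, by omega, by omega, rfl⟩
  rw [hRegU0] at hwalk dW
  rw [hRegU] at hz0
  obtain ⟨z', Q', D', ⟨g1, g2, g3, g4, g5⟩, g6, g7⟩ := step_core hQ hBW hD hz hred hblue hnr hScard hrS d0
    hsub dW hwalk hsB hz0 hz0W hQc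
  refine ⟨z', Q', D', ⟨g1, g2, ?_, ?_, ?_⟩, g6, g7⟩
  · rw [e6, hRegU]; exact g3
  · rw [e6, hRegU0]; exact g4
  · rw [e6, hRegU]; exact g5

end LC

namespace LC
variable {V : Type*} [DecidableEq V]

theorem Bad.mono {col : Finset V → Bool} {z : V} {S Q Q' : Finset V} (h : Bad col z S Q)
    (hQ : Q ⊆ Q') : Bad col z S Q' := by
  intro C hC
  obtain ⟨f, hf, g, hg, h1⟩ := h C hC
  exact ⟨f, hQ hf, g, hQ hg, h1⟩

theorem St.iter {col : Finset V → Bool} {g : ℕ → V} {m : ℕ} (h : RC col g m) {Wt B X : Finset V}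
    (hW : Disjoint Wt (Reg g 0 (3 * m))) (hn : NoCyc col true (m + 1)) {j0 : ℕ} {z0 : V}
    (hz0W : z0 ∉ Wt) (hBW : B ⊆ Wt) : ∀ (t k : ℕ) (z : V) (Q D : Finset V),
    St col g Wt B X j0 z0 k z Q D → 4 + t ≤ Q.card → 6 * (j0 + k + t) ≤ 3 * m →
    z0 ∉ Reg g (6 * j0) (6 * (j0 + k + t)) →
    ∃ (z' : V) (Q' D' : Finset V), St col g Wt B X j0 z0 (k + t) z' Q' D' ∧ 4 ≤ Q'.card ∧
      ((∀ i < j0 + k + t, ¬ Bad col (g (6 * i)) (Blk g (6 * i)) Wt) → z = g (6 * (j0 + k)) →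
        z' = g (6 * (j0 + k + t)))
  | 0, k, z, Q, D, st, hQ, hm, hz0 => ⟨z, Q, D, st, by omega, fun _ h => h⟩
  | t + 1, k, z, Q, D, st, hQ, hm, hz0 => by
      obtain ⟨z', Q', D', st', hc, hb⟩ := st.step h hW hn (by omega) (by omega)
        (fun hx => hz0 (Reg_mono le_rfl (by omega) hx)) hz0W hBW
      obtain ⟨z'', Q'', D'', st'', hc', hb'⟩ := St.iter h hW hn hz0W hBW t (k + 1) z' Q' D' st'
        (by omega) (by omega) (fun hx => hz0 (Reg_mono le_rfl (by omega) hx))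
      refine ⟨z'', Q'', D'', ?_, hc', ?_⟩
      · rwa [show k + (t + 1) = k + 1 + t by omega]
      · intro hnb hz
        have := hb' (fun i hi => hnb i (by omega)) ?_
        · rw [this]; congr 1; ring
        · rw [hb ?_]
          · congr 1
          · intro hbad
            rw [hz] at hbad
            exact hnb (j0 + k) (by omega) (hbad.mono (st.hQ.trans hBW))

theorem scan {col : Finset V → Bool} {g : ℕ → V} {m : ℕ} (h : RC col g m) {Wt : Finset V}
    (hW : Disjoint Wt (Reg g 0 (3 * m))) (hn : NoCyc col true (m + 1)) {t : ℕ} (ht : 1 ≤ t)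
    (htm : 6 * t < 3 * m) (hc : t + 4 ≤ Wt.card)
    (hnb : ∀ i < t, ¬ Bad col (g (6 * i)) (Blk g (6 * i)) Wt) {C : Finset V} (hC : C.card ≤ 2)
    (hcov : ∀ f ∈ Wt, ∀ f' ∈ Wt, f ≠ f' → NE col (g 0) (Blk g 0) f f' → f ∉ C → f' ∈ C)
    {c : V} (hcW : c ∈ Wt) (hcC : c ∉ C) :
    ∃ Q D : Finset V, Q ⊆ Wt.erase c ∧ D.card ≤ 2 ∧ 4 ≤ Q.card ∧ ∀ w ∈ Q, w ∉ D →
      W col false (2 * t) c w ((insert (g 0) (Reg g 0 (6 * t - 1)) ∪ insert w (Wt \ Q)).erase c) := by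
  have hg0 : g 0 ∉ Reg g 0 (6 * t) := by
    rw [← h.close, mem_Reg]
    rintro ⟨i, h1, h2, h3⟩
    have := h.inj i (3 * m) h1 (by omega) (by omega) le_rfl h3
    omega
  have hgm : g 0 ∈ Reg g 0 (3 * m) := mem_Reg.mpr ⟨3 * m, by omega, le_rfl, h.close⟩
  have hg0W : g 0 ∉ Wt := fun hx => Finset.disjoint_left.mp hW hx hgm
  have hwalk := h.walk 0 2 (by omega)
  have h6 : g 6 ∉ Blk g 0 := h.end_notMem (i := 0) (by omega)
  have st : St col g Wt Wt {c} 0 (g 0) 1 (g 6) (Wt.erase c) C := by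
    refine ⟨Finset.erase_subset _ _, hC, ?_, ?_, ?_⟩
    · exact Finset.mem_insert_of_mem (mem_Reg.mpr ⟨6, by omega, by omega, rfl⟩)
    · exact hwalk.mono Finset.subset_union_left
    · intro w hw hwC
      have hwW := Finset.mem_of_mem_erase hw
      have hwc := Finset.ne_of_mem_erase hw
      have e : Wt \ Wt.erase c = {c} := by
        ext x; simp only [Finset.mem_sdiff, Finset.mem_erase, Finset.mem_singleton]; grind
      rw [e]
      refine ⟨c, by simp, by simp, ?_⟩
      have hb : Cn col false 2 c w (insert (g 0) (Blk g 0)) := by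
        by_contra hne
        exact hwC (hcov c hcW w hwW hwc.symm hne hcC)
      refine W.mono hb ?_
      have hd := Finset.disjoint_left.mp (hW.mono_right (Reg_mono (g := g) (a := 0) (b := 6)
        (a' := 0) (b' := 3 * m) (by omega) (by omega))) hcW
      have e6 : Reg g 0 6 = _ := Reg_blk (g := g) (i := 0)
      have h06 : g 0 ≠ g 6 := by
        intro e
        apply hg0
        rw [e]
        exact mem_Reg.mpr ⟨6, by omega, by omega, rfl⟩
      simp only [Nat.zero_add, Nat.mul_zero, Nat.mul_one] at e6 ⊢
      rw [e6] at hd ⊢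
      intro x hx
      simp only [Finset.mem_union, Finset.mem_erase, Finset.mem_insert, Finset.mem_singleton] at *
      grind
  obtain ⟨z', Q', D', st', hc', hz'⟩ := St.iter h hW hn hg0W subset_rfl (t - 1) 1 _ _ _ st
    (by rw [Finset.card_erase_of_mem hcW]; omega) (by omega)
    (fun hx => hg0 (Reg_mono le_rfl (by omega) hx))
  have hz'' := hz' (fun i hi => hnb i (by omega)) rfl
  rw [show 0 + 1 + (t - 1) = t by omega] at hz''
  rw [show 1 + (t - 1) = t by omega] at st'
  subst hz''
  -- c is not in Q'
  have main : ∀ w ∈ Q', w ∉ D' → c ∈ insert w (Wt \ Q') ∧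
      W col false (2 * t) c w ((insert (g 0) (Reg g 0 (6 * t - 1)) ∪ insert w (Wt \ Q')).erase c) := by
    intro w hw hwD
    obtain ⟨c', hc1, hc2, hc3⟩ := st'.blue w hw hwD
    rw [Finset.mem_singleton] at hc1
    subst hc1
    refine ⟨hc2, hc3.mono ?_⟩
    apply Finset.erase_subset_erase
    apply Finset.union_subset_union_left
    intro x hx
    rw [Finset.mem_erase, Finset.mem_insert, mem_Reg] at hx
    rw [Finset.mem_insert, mem_Reg]
    obtain ⟨hx1, rfl | ⟨i, h1, h2, rfl⟩⟩ := hx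
    · exact Or.inl rfl
    · refine Or.inr ⟨i, by omega, ?_, rfl⟩
      by_contra hi
      apply hx1
      congr 1
      omega
  refine ⟨Q', D', ?_, st'.hD, hc', fun w hw hwD => (main w hw hwD).2⟩
  intro x hx
  rw [Finset.mem_erase]
  refine ⟨?_, st'.hQ hx⟩
  rintro rfl
  obtain ⟨w, hw, hwD⟩ : ∃ w ∈ Q', w ∉ insert x D' := by
    apply Finset.exists_mem_notMem_of_card_lt_card
    have := Finset.card_insert_le x D'
    have := st'.hD
    omega
  rw [Finset.mem_insert, not_or] at hwD
  have := (main w hw hwD.2).1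
  simp only [Finset.mem_insert, Finset.mem_sdiff] at this
  grind

end LC

namespace LC
variable {V : Type*} [DecidableEq V]

theorem startI {col : Finset V → Bool} {g : ℕ → V} {m : ℕ} (h : RC col g m) {Wt : Finset V}
    (hW : Disjoint Wt (Reg g 0 (3 * m))) (hn : NoCyc col true (m + 1)) (hm : 3 ≤ m)
    (hc : 5 ≤ Wt.card) (hbad : Bad col (g 0) (Blk g 0) Wt) :
    (∃ γ ∈ Wt, St col g Wt (Wt.erase γ) Wt 1 (g 1) 0 (g 1) (Wt.erase γ) ∅) ∧
    (∀ w ∈ Wt, ∀ w' ∈ Wt, w ≠ w' → Cn col false 2 w w' (insert (g 6) ((Blk g 0).erase (g 1)))) ∧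
    (∀ s ∈ Blk g 0, ∀ w ∈ Wt, ∀ w' ∈ Wt, w ≠ w' → col {g 6, s, w, w'} = false) ∧
    ¬ W col true 3 (g 0) (g 6) (insert (g 6) (Blk g 0) ∪ Wt) := by
  have hS := h.blk_card (i := 0) (by omega)
  have hr : g 6 ∉ Blk g 0 := h.end_notMem (i := 0) (by omega)
  have hg0 : ∀ i, 0 < i → i < 3 * m → g i ≠ g 0 := by
    intro i h1 h2 e
    rw [← h.close] at e
    have := h.inj i (3 * m) h1 (by omega) (by omega) le_rfl e
    omega
  have hz : g 0 ∉ Blk g 0 := by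
    rw [Blk, mem_Reg]
    rintro ⟨i, h1, h2, h3⟩
    exact hg0 i h1 (by omega) h3
  have hzr : g 0 ≠ g 6 := (hg0 6 (by omega) (by omega)).symm
  have hgm : g 0 ∈ Reg g 0 (3 * m) := mem_Reg.mpr ⟨3 * m, by omega, le_rfl, h.close⟩
  have hsub : insert (g 6) (Blk g 0) ⊆ Reg g 0 (3 * m) := by
    have e6 : Reg g 0 6 = _ := Reg_blk (g := g) (i := 0)
    simp only [Nat.zero_add] at e6
    rw [← e6]
    exact Reg_mono le_rfl (by omega)
  have hQ : ∀ x ∈ Wt, x ∉ Blk g 0 ∧ x ≠ g 0 ∧ x ≠ g 6 := by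
    intro x hx
    have := Finset.disjoint_left.mp hW hx
    refine ⟨fun e => this (hsub (Finset.mem_insert_of_mem e)), ?_, ?_⟩
    · rintro rfl; exact this hgm
    · rintro rfl; exact this (hsub (Finset.mem_insert_self _ _))
  have hQ' : ∀ x ∈ Wt, x ∉ insert (g 0) (Blk g 0) := by
    intro x hx
    have := hQ x hx
    simp [this]
  have hred := noRed h hW hn (j := 0) (L := 2) (Q := Wt) subset_rfl (z := g 0)
    (W.zero _ _) (by omega)
  have e6 : Reg g 0 6 = _ := Reg_blk (g := g) (i := 0)
  simp only [Nat.zero_add, Nat.mul_zero, show 3 * 2 = 6 by rfl, show 2 + 1 = 3 by rfl] at e6 hred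
  rw [e6] at hred
  have h1B : g 1 ∈ Blk g 0 := mem_Reg.mpr ⟨1, by omega, by omega, rfl⟩
  refine ⟨?_, ?_, ?_, hred⟩
  · obtain ⟨f, hf, f', hf', hff, hne, -⟩ := hbad ∅ (by simp)
    obtain ⟨γ, hγ, hW2⟩ := P6 hS hz h1B (hQ' f hf) (hQ' f' hf') hff hne
    have hγW : γ ∈ Wt := by rcases hγ with rfl | rfl <;> assumption
    refine ⟨γ, hγW, subset_rfl, by simp, by simp, ?_, ?_⟩
    · refine hW2.mono ?_
      have e : Reg g 0 (6 * (1 + 0)) = insert (g 6) (Blk g 0) := e6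
      rw [e]
      intro x hx
      simp only [Finset.mem_union, Finset.mem_insert, Finset.mem_sdiff, Finset.mem_erase] at hx ⊢
      grind
    · intro w hw _
      exact ⟨w, Finset.mem_of_mem_erase hw, by simp, W.zero _ _⟩
  · intro w hw w' hw' hww
    exact F3 hS hz hr hzr hQ hc hbad hred (by simp) (by intro x hx; simp [hx])
      (by intro x hx; simp [hx]) h1B hw hw' hww
  · intro s hs w hw w' hw' hww
    obtain ⟨f, hf, f', hf', hff, hne, hfC, hfC'⟩ := hbad {w, w'} Finset.card_le_two
    simp only [Finset.mem_insert, Finset.mem_singleton, not_or] at hfC hfC'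
    exact factB hS hz hs (hQ' f hf) (hQ' f' hf') hff hne hred (by simp) (by intro x hx; simp [hx])
      (by simp [hf]) (by simp [hf']) (by simp [hw]) (by simp [hw']) hww (Ne.symm hfC.1)
      (Ne.symm hfC'.1) (Ne.symm hfC.2) (Ne.symm hfC'.2) (hQ w hw).1 (hQ w' hw').1
      (hQ f hf).2.2.symm (hQ f' hf').2.2.symm (hQ w hw).2.2.symm (hQ w' hw').2.2.symm hr

theorem four_of {Q D : Finset V} (hQ : 4 ≤ Q.card) (hD : D.card ≤ 2) :
    ∃ w0 w1 w2 w3, [w0, w1, w2, w3].Nodup ∧ (∀ x ∈ [w0, w1, w2, w3], x ∈ Q) ∧ w0 ∉ D ∧ w1 ∉ D := by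
  have h2 : 2 ≤ (Q \ D).card := by
    have := Finset.le_card_sdiff D Q
    omega
  obtain ⟨T, hT, hTc⟩ := Finset.exists_subset_card_eq h2
  obtain ⟨w0, w1, h01, rfl⟩ := Finset.card_eq_two.mp hTc
  have hsub : ({w0, w1} : Finset V) ⊆ Q := hT.trans Finset.sdiff_subset
  have h3 : 2 ≤ (Q \ {w0, w1}).card := by
    rw [Finset.card_sdiff_of_subset hsub, hTc]; omega
  obtain ⟨T, hT', hTc'⟩ := Finset.exists_subset_card_eq h3
  obtain ⟨w2, w3, h23, rfl⟩ := Finset.card_eq_two.mp hTc'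
  refine ⟨w0, w1, w2, w3, ?_⟩
  simp only [Finset.insert_subset_iff, Finset.singleton_subset_iff, Finset.mem_sdiff,
    Finset.mem_insert, Finset.mem_singleton] at hT hT'
  simp only [List.nodup_cons, List.mem_cons, List.not_mem_nil, not_or, or_false]
  grind

theorem two_more {Q : Finset V} (hQ : 4 ≤ Q.card) {u u' : V} (hu : u ∈ Q) (hu' : u' ∈ Q)
    (huu : u ≠ u') : ∃ w2 w3, [u, u', w2, w3].Nodup ∧ w2 ∈ Q ∧ w3 ∈ Q := by
  have hsub : ({u, u'} : Finset V) ⊆ Q := by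
    intro x; simp only [Finset.mem_insert, Finset.mem_singleton]; rintro (rfl | rfl) <;> assumption
  have h3 : 2 ≤ (Q \ {u, u'}).card := by
    rw [Finset.card_sdiff_of_subset hsub, Finset.card_pair huu]; omega
  obtain ⟨T, hT', hTc'⟩ := Finset.exists_subset_card_eq h3
  obtain ⟨w2, w3, h23, rfl⟩ := Finset.card_eq_two.mp hTc'
  refine ⟨w2, w3, ?_⟩
  simp only [Finset.insert_subset_iff, Finset.singleton_subset_iff, Finset.mem_sdiff,
    Finset.mem_insert, Finset.mem_singleton] at hT'
  simp only [List.nodup_cons, List.mem_cons, List.not_mem_nil, not_or, or_false]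
  grind

set_option maxHeartbeats 2000000 in
theorem oddI_core {col : Finset V → Bool} {p r a b q c d a' b' q' c' d' γ z : V} {k : ℕ}
    {A Wt Q D J : Finset V} (hnd : [p, r, a, b, q, c, d].Nodup)
    (hnd' : [a', b', q', c', d'].Nodup) (hA : ∀ x ∈ [p, r, a, b, q, c, d, a', b', q', c', d'], x ∉ A)
    (hS' : ∀ x ∈ [p, r, a, b, q, c, d], x ∉ [a', b', q', c', d'])
    (hWt : ∀ x ∈ Wt, x ∉ A ∧ x ∉ [p, r, a, b, q, c, d, a', b', q', c', d'])
    (hγ : γ ∈ Wt) (hQ : Q ⊆ Wt.erase γ) (hD : D.card ≤ 2) (hQc : 4 ≤ Q.card) (hz : z ∈ insert a A)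
    (hblue : ∀ w ∈ Q, w ∉ D → ∃ c0 ∈ Wt, c0 ∈ insert w (Wt.erase γ \ Q) ∧
      W col false (2 * k) c0 w (((insert a A).erase z ∪ insert w (Wt.erase γ \ Q)).erase c0))
    (hnr : ¬ W col true 3 z p J) (hJ : insert p ({a', b', q', c', d'} ∪ Q) ⊆ J)
    (hr2 : col {p, q', c', d'} = true)
    (hF : ∀ w ∈ Wt, ∀ w' ∈ Wt, w ≠ w' → Cn col false 2 w w' {r, b, q, c, d})
    (hii : ∀ w0 w1 w2 w3 w4, [w0, w1, w2, w3, w4].Nodup → (∀ x ∈ [w0, w1, w2, w3, w4], x ∈ Wt) →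
      W col false 3 w0 w1 {w1, p, r, b, q, c, d, w2, w3, w4}) :
    ¬ NoCyc col false (2 * k + 5) := by
  intro hn
  have hz' : z ∉ [p, r, b, q, c, d, a', b', q', c', d'] ∧ z ∉ Wt := by
    constructor
    · intro hx
      have := hA z
      have := hS' z
      simp only [List.nodup_cons, List.mem_cons, List.not_mem_nil, not_or, or_false,
        Finset.mem_insert] at *
      grind
    · intro hx
      have := hWt z hx
      simp only [List.mem_cons, List.not_mem_nil, not_or, or_false, Finset.mem_insert] at *
      grind
  by_cases hL : ∃ u ∈ Q, u ∉ D ∧ ∃ u' ∈ Q, u ≠ u' ∧ ¬ NE col z {a', b', q', c', d'} u u'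
  · obtain ⟨u, hu, huD, u', hu', huu, hne⟩ := hL
    obtain ⟨c0, hc0, hc0', hb⟩ := hblue u hu huD
    have hb2 : Cn col false 2 u u' (insert z {a', b', q', c', d'}) := by
      by_contra hc; exact hne hc
    obtain ⟨w2, w3, hw, hw2, hw3⟩ := two_more hQc hu hu' huu
    have q1 := hQ hu
    have q2 := hQ hu'
    have q3 := hQ hw2
    have q4 := hQ hw3
    simp only [Finset.mem_erase, Finset.mem_insert, Finset.mem_sdiff] at q1 q2 q3 q4 hc0'
    have hb3 := hii u' c0 w2 w3 γ (by
      simp only [List.nodup_cons, List.mem_cons, List.not_mem_nil, not_or, or_false] at hw ⊢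
      grind) (by simp only [List.forall_mem_cons]; simp [q2, hc0, q3, q4, hγ])
    have e1 := hb.append hb2 (by
      clear hF hii hblue hJ hne
      rw [Finset.disjoint_left]
      intro x hx hx'
      have h1 := hWt x
      have h2 := hA x
      have h3 := hS' x
      have h4 := @hQ x
      simp only [List.nodup_cons, List.mem_cons, List.not_mem_nil, not_or, or_false,
        Finset.mem_union, Finset.mem_insert, Finset.mem_singleton, Finset.mem_erase,
        Finset.mem_sdiff] at *
      grind)
    have e2 := e1.append hb3 (by
      clear hF hii hblue hJ hne
      rw [Finset.disjoint_left]
      intro x hx hx'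
      have h1 := hWt x
      have h2 := hA x
      have h3 := hS' x
      have h4 := @hQ x
      simp only [List.nodup_cons, List.mem_cons, List.not_mem_nil, not_or, or_false,
        Finset.mem_union, Finset.mem_insert, Finset.mem_singleton, Finset.mem_erase,
        Finset.mem_sdiff] at *
      grind)
    exact hn _ _ e2
  · push Not at hL
    obtain ⟨w0, w1, w2, w3, hw, hwQ, hw0, hw1⟩ := four_of hQc hD
    simp only [List.forall_mem_cons] at hwQ
    obtain ⟨q0, q1, q2, q3, -⟩ := hwQ
    have hQW : ∀ x ∈ Q, x ∈ Wt := fun x hx => Finset.mem_of_mem_erase (hQ hx)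
    have hS5 : ({a', b', q', c', d'} : Finset V).card = 5 := by
      have := List.toFinset_card_of_nodup hnd'
      simpa using this
    have hQn : ∀ x ∈ Q, x ∉ ({a', b', q', c', d'} : Finset V) ∧ x ≠ z ∧ p ≠ x := by
      intro x hx
      have h1 := hWt x (hQW x hx)
      have h2 := hQW x hx
      refine ⟨?_, ?_, ?_⟩
      · simp only [List.mem_cons, List.not_mem_nil, not_or, or_false, Finset.mem_insert,
          Finset.mem_singleton] at h1 ⊢
        grind
      · rintro rfl; exact hz'.2 h2
      · rintro rfl; simp at h1
    have hzS : z ∉ ({a', b', q', c', d'} : Finset V) := by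
      have := hz'.1
      simp only [List.mem_cons, List.not_mem_nil, not_or, or_false, Finset.mem_insert,
          Finset.mem_singleton] at this ⊢
      grind
    have hpS : p ∉ ({a', b', q', c', d'} : Finset V) := by
      have := hS' p (by simp)
      simpa using this
    have hins : ∀ x ∈ Q, x ∉ insert z ({a', b', q', c', d'} : Finset V) := by
      intro x hx
      rw [Finset.mem_insert, not_or]
      exact ⟨(hQn x hx).2.1, (hQn x hx).1⟩
    have hpJ : p ∈ J := hJ (by simp)
    have hSJ : ({a', b', q', c', d'} : Finset V) ⊆ J := fun x hx =>
      hJ (Finset.mem_insert_of_mem (Finset.mem_union_left _ hx))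
    have hQJ : ∀ x ∈ Q, x ∈ J := fun x hx =>
      hJ (Finset.mem_insert_of_mem (Finset.mem_union_right _ hx))
    have fB : ∀ f f' w w', f ∈ Q → f' ∈ Q → w ∈ Q → w' ∈ Q → f ∉ D → [f, f', w, w'].Nodup →
        ∀ s ∈ [a', b', q', c', d'], col {p, s, w, w'} = false := by
      intro f f' w w' hf hf' hw hw' hfD hnd4 s hs
      simp only [List.nodup_cons, List.mem_cons, List.not_mem_nil, not_or, or_false] at hnd4
      refine factB hS5 hzS (by simpa using hs) (hins f hf) (hins f' hf') (by grind)
        (hL f hf hfD f' hf' (by grind)) hnr hpJ hSJ (hQJ f hf) (hQJ f' hf') (hQJ w hw) (hQJ w' hw')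
        ?_ ?_ ?_ ?_ ?_ (hQn w hw).1 (hQn w' hw').1 (hQn f hf).2.2 (hQn f' hf').2.2 (hQn w hw).2.2
        (hQn w' hw').2.2 hpS
      all_goals grind
    obtain ⟨c0, hc0, hc0', hb⟩ := hblue w0 q0 hw0
    have hb2 : W col false 3 w0 w1 {w1, z, p, a', b', q', c', d', w2, w3} := by
      refine i01c (J := J) ?_ hr2 ?_ hnr ?_
      · have r0 := hQn w0 q0
        have r1 := hQn w1 q1
        have r2 := hQn w2 q2
        have r3 := hQn w3 q3
        have := hz'.1
        simp only [List.nodup_cons, List.mem_cons, List.not_mem_nil, not_or, or_false,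
          Finset.mem_insert, Finset.mem_singleton] at *
        grind
      · intro s hs
        simp only [List.nodup_cons, List.mem_cons, List.not_mem_nil, not_or, or_false] at hw
        refine ⟨fB w1 w3 w0 w2 q1 q3 q0 q2 hw1 ?_ s hs, fB w1 w2 w0 w3 q1 q2 q0 q3 hw1 ?_ s hs,
          fB w0 w3 w1 w2 q0 q3 q1 q2 hw0 ?_ s hs, fB w0 w2 w1 w3 q0 q2 q1 q3 hw0 ?_ s hs,
          fB w0 w1 w2 w3 q0 q1 q2 q3 hw0 ?_ s hs⟩
        all_goals
          simp only [List.nodup_cons, List.mem_cons, List.not_mem_nil, not_or, or_false]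
          grind
      · simp only [List.forall_mem_cons]
        refine ⟨hpJ, hSJ (by simp), hSJ (by simp), hSJ (by simp), hSJ (by simp), hSJ (by simp),
          hQJ _ q0, hQJ _ q1, hQJ _ q2, hQJ _ q3, by simp⟩
    have hc01 : w1 ≠ c0 := by
      simp only [List.nodup_cons, List.mem_cons, List.not_mem_nil, not_or, or_false,
        Finset.mem_insert, Finset.mem_sdiff] at hw hc0'
      grind
    have hb3 := hF w1 (hQW _ q1) c0 hc0 hc01
    have e1 := hb.append hb2 (by
      clear fB hL hF hii hblue hJ
      rw [Finset.disjoint_left]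
      intro x hx hx'
      have h1 := hWt x
      have h2 := hA x
      have h3 := hS' x
      have h4 := @hQ x
      simp only [List.nodup_cons, List.mem_cons, List.not_mem_nil, not_or, or_false,
        Finset.mem_union, Finset.mem_insert, Finset.mem_singleton, Finset.mem_erase,
        Finset.mem_sdiff] at *
      grind)
    have e2 := e1.append hb3 (by
      clear fB hL hF hii hblue hJ
      rw [Finset.disjoint_left]
      intro x hx hx'
      have h1 := hWt x
      have h2 := hA x
      have h3 := hS' x
      have h4 := @hQ x
      simp only [List.nodup_cons, List.mem_cons, List.not_mem_nil, not_or, or_false,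
        Finset.mem_union, Finset.mem_insert, Finset.mem_singleton, Finset.mem_erase,
        Finset.mem_sdiff] at *
      grind)
    exact hn _ _ e2

end LC

namespace LC
variable {V : Type*} [DecidableEq V]

theorem Blk_eq (g : ℕ → V) (i : ℕ) :
    Blk g i = {g (i + 1), g (i + 2), g (i + 3), g (i + 4), g (i + 5)} := by
  ext x
  simp only [Blk, mem_Reg, Finset.mem_insert, Finset.mem_singleton]
  constructor
  · rintro ⟨j, h1, h2, rfl⟩
    obtain rfl | rfl | rfl | rfl | rfl : j = i + 1 ∨ j = i + 2 ∨ j = i + 3 ∨ j = i + 4 ∨ j = i + 5 := by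
      omega
    all_goals simp
  · rintro (rfl | rfl | rfl | rfl | rfl)
    all_goals exact ⟨_, by omega, by omega, rfl⟩

theorem RC.ne {col : Finset V → Bool} {g : ℕ → V} {m : ℕ} (h : RC col g m) {i j : ℕ}
    (h1 : 0 < i) (h2 : i ≤ 3 * m) (h3 : 0 < j) (h4 : j ≤ 3 * m) (h5 : i ≠ j) : g i ≠ g j :=
  fun e => h5 (h.inj i j h1 h2 h3 h4 e)

theorem RC.nReg {col : Finset V → Bool} {g : ℕ → V} {m : ℕ} (h : RC col g m) {i a b : ℕ}
    (h1 : 0 < i) (h2 : i ≤ 3 * m) (hb : b ≤ 3 * m) (h5 : i ≤ a ∨ b < i) : g i ∉ Reg g a b := by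
  rw [mem_Reg]
  rintro ⟨j, h3, h4, h6⟩
  have := h.inj j i (by omega) (by omega) h1 h2 h6
  omega

set_option maxHeartbeats 1000000 in
theorem oddI {col : Finset V → Bool} {g : ℕ → V} {h : ℕ} (hh : 2 ≤ h) (hg : RC col g (2 * h))
    {Wt : Finset V} (hW : Disjoint Wt (Reg g 0 (3 * (2 * h)))) (hc : h + 3 ≤ Wt.card)
    (hn : NoCyc col true (2 * h + 1)) (hn' : NoCyc col false (2 * h + 1)) :
    ¬ Bad col (g 0) (Blk g 0) Wt := by
  intro hbad
  obtain ⟨⟨γ, hγ, st⟩, hF, hB, hr0⟩ := startI hg hW hn (by omega) (by omega) hbad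
  obtain ⟨k, rfl⟩ : ∃ k, h = k + 2 := ⟨h - 2, by omega⟩
  have hWi : ∀ x ∈ Wt, ∀ i, 0 < i → i ≤ 6 * k + 12 → x ≠ g i := by
    rintro x hx i h1 h2 rfl
    exact Finset.disjoint_left.mp hW hx (mem_Reg.mpr ⟨i, h1, by omega, rfl⟩)
  have hne : ∀ i j, 0 < i → i ≤ 6 * k + 12 → 0 < j → j ≤ 6 * k + 12 → i ≠ j → g i ≠ g j :=
    fun i j h1 h2 h3 h4 h5 => hg.ne h1 (by omega) h3 (by omega) h5
  have hnA : ∀ i, 0 < i → i ≤ 6 * k + 12 → (i ≤ 6 ∨ 6 * k + 6 < i) → g i ∉ Reg g 6 (6 * k + 6) :=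
    fun i h1 h2 h3 => hg.nReg h1 (by omega) (by omega) h3
  have h1W : g 1 ∉ Wt := fun hx => hWi _ hx 1 (by omega) (by omega) rfl
  obtain ⟨z, Q, D, st', hQc, -⟩ := St.iter hg hW hn h1W (Finset.erase_subset _ _) k 0 _ _ _ st
    (by rw [Finset.card_erase_of_mem hγ]; omega) (by omega)
    (hg.nReg (by omega) (by omega) (by omega) (Or.inl (by omega)))
  rw [show 0 + k = k by omega] at st'
  have e1 : 6 * (1 + k) = 6 * k + 6 := by ring
  have hnr := noRed hg hW hn (L := 2) (st'.hQ.trans (Finset.erase_subset _ _)) st'.red (by omega)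
  have hcl : g 0 = g (6 * k + 12) := by rw [← hg.close]; congr 1; ring
  rw [show 3 * 2 = 6 by rfl, Reg_blk, Blk_eq, e1, show 6 * k + 6 + 6 = 6 * k + 12 by rfl] at hnr
  have hz := st'.hz
  have hbl := st'.blue
  rw [e1] at hz hbl
  simp only [show 6 * 1 = 6 by rfl] at hz hbl
  have hred := hg.red (2 * k + 3) (by omega)
  rw [show 3 * (2 * k + 3) = 6 * k + 9 by ring] at hred
  have hnd0 : [g (6 * k + 12), g 6, g 1, g 2, g 3, g 4, g 5].Nodup := by
    simp only [List.nodup_cons, List.mem_cons, List.not_mem_nil, not_or, or_false]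
    and_intros
    all_goals first | (apply hne <;> omega) | simp
  have hbl0 : (Blk g 0).erase (g 1) = {g 2, g 3, g 4, g 5} := by
    rw [Blk_eq]
    ext x
    simp only [List.nodup_cons, List.mem_cons, List.not_mem_nil, not_or, or_false] at hnd0
    simp only [Finset.mem_erase, Finset.mem_insert, Finset.mem_singleton, Nat.zero_add]
    grind
  refine oddI_core (a' := g (6 * k + 6 + 1)) (b' := g (6 * k + 6 + 2)) (q' := g (6 * k + 6 + 3))
    (c' := g (6 * k + 6 + 4)) (d' := g (6 * k + 6 + 5)) hnd0 ?_ (A := Reg g 6 (6 * k + 6)) ?_ ?_ ?_ hγ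
    st'.hQ st'.hD hQc hz hbl hnr ?_ ?_ ?_ ?_ hn'
  · simp only [List.nodup_cons, List.mem_cons, List.not_mem_nil, not_or, or_false]
    and_intros
    all_goals first | (apply hne <;> omega) | simp
  · simp only [List.forall_mem_cons]
    and_intros
    all_goals first | (apply hnA <;> omega) | simp
  · simp only [List.forall_mem_cons]
    simp only [List.mem_cons, List.not_mem_nil, not_or, or_false]
    and_intros
    all_goals first | (apply hne <;> omega) | simp
  · intro x hx
    refine ⟨fun h => ?_, ?_⟩
    · obtain ⟨i, h1, h2, h3⟩ := mem_Reg.mp h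
      exact hWi x hx i (by omega) (by omega) h3.symm
    · simp only [List.mem_cons, List.not_mem_nil, not_or, or_false]
      and_intros
      all_goals apply hWi x hx <;> omega
  · intro x hx
    simp only [Finset.mem_insert, Finset.mem_union, Finset.mem_singleton] at hx ⊢
    grind
  · rw [← hred]; congr 1; ext x
    simp only [Finset.mem_insert, Finset.mem_singleton]
    rw [show 6 * k + 9 + 3 = 6 * k + 12 by rfl, show 6 * k + 9 + 1 = 6 * k + 6 + 4 by rfl,
      show 6 * k + 9 + 2 = 6 * k + 6 + 5 by rfl, show 6 * k + 9 = 6 * k + 6 + 3 by rfl]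
    tauto
  · intro w hw w' hw' hww
    have := hF w hw w' hw' hww
    rwa [hbl0] at this
  · intro w0 w1 w2 w3 w4 hw hwW
    rw [hcl] at hr0
    refine iic (a := g 1) ?_ ?_ ?_ hr0 ?_
    · change ([g (6 * k + 12), g 6, g 1, g 2, g 3, g 4, g 5] ++ [w0, w1, w2, w3, w4]).Nodup
      rw [List.nodup_append]
      refine ⟨hnd0, hw, ?_⟩
      rintro x hx _ hy rfl
      have := hWi x (hwW x hy)
      simp only [List.mem_cons, List.not_mem_nil, or_false] at hx
      rcases hx with hx | hx | hx | hx | hx | hx | hx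
      all_goals exact this _ (by omega) (by omega) hx
    · have := hg.red 1 (by omega)
      rw [← this]; congr 1; ext x
      simp only [Finset.mem_insert, Finset.mem_singleton]
      tauto
    · intro s hs w hw' w' hw'' hww
      refine hB s ?_ w (hwW w hw') w' (hwW w' hw'') hww
      rw [Blk_eq]; simpa using hs
    · rw [Blk_eq]
      simp only [List.forall_mem_cons] at hwW ⊢
      simp [hwW]

end LC

namespace LC
variable {V : Type*} [DecidableEq V]

set_option maxHeartbeats 1000000 in
theorem evenI_core {col : Finset V → Bool} {u r a x y γ z : V} {k : ℕ}
    {A S Wt Q D J : Finset V} (hnd : [u, r, a, x, y].Nodup) (hA : ∀ t ∈ [u, r, a, x, y], t ∉ A)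
    (hS : ∀ t ∈ [u, r, a, x, y], t ∉ S) (hAS : ∀ t ∈ A, t ∉ S)
    (hWt : ∀ x' ∈ Wt, x' ∉ A ∧ x' ∉ S ∧ x' ∉ [u, r, a, x, y])
    (hQ : Q ⊆ Wt.erase γ) (hD : D.card ≤ 2) (hQc : 4 ≤ Q.card) (hz : z ∈ insert a A)
    (hblue : ∀ w ∈ Q, w ∉ D → ∃ c0 ∈ Wt, c0 ∈ insert w (Wt.erase γ \ Q) ∧
      W col false (2 * k) c0 w (((insert a A).erase z ∪ insert w (Wt.erase γ \ Q)).erase c0))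
    (hnr : ¬ W col true 2 z u J) (hJ : insert u (insert x (insert y Q)) ⊆ J)
    (hF : ∀ w ∈ Wt, ∀ w' ∈ Wt, w ≠ w' → Cn col false 2 w w' (insert r S)) :
    ¬ NoCyc col false (2 * k + 4) := by
  intro hn
  have hz' : z ∉ [u, r, x, y] ∧ z ∉ Wt ∧ z ∉ S := by
    have h1 := hA z
    have h2 := hS z
    have h3 := hWt z
    have h4 := hAS z
    simp only [List.nodup_cons, List.mem_cons, List.not_mem_nil, not_or, or_false,
      Finset.mem_insert] at *
    grind
  obtain ⟨w0, w1, w2, w3, hw, hwQ, hw0, hw1⟩ := four_of hQc hD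
  simp only [List.forall_mem_cons] at hwQ
  obtain ⟨q0, q1, q2, q3, -⟩ := hwQ
  have hQW : ∀ x ∈ Q, x ∈ Wt := fun x hx => Finset.mem_of_mem_erase (hQ hx)
  have hQJ : ∀ x ∈ Q, x ∈ J := fun x hx => hJ (by simp [hx])
  obtain ⟨c0, hc0, hc0', hb⟩ := hblue w0 q0 hw0
  have r0 := hWt w0 (hQW _ q0)
  have r1 := hWt w1 (hQW _ q1)
  have r2 := hWt w2 (hQW _ q2)
  have r3 := hWt w3 (hQW _ q3)
  have hb2 : W col false 2 w0 w1 {w1, z, u, x, y, w2, w3} := by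
    refine Kec (J := J) ?_ hnr ?_
    · have := hz'.1
      have := hz'.2.1
      have := hQW _ q0
      have := hQW _ q1
      have := hQW _ q2
      have := hQW _ q3
      clear hblue hF hWt hA hS
      simp only [List.nodup_cons, List.mem_cons, List.not_mem_nil, not_or, or_false] at *
      grind
    · simp only [List.forall_mem_cons]
      exact ⟨hJ (by simp), hJ (by simp), hJ (by simp), hQJ _ q0, hQJ _ q1, hQJ _ q2, hQJ _ q3, by simp⟩
  have hc01 : w1 ≠ c0 := by
    simp only [List.nodup_cons, List.mem_cons, List.not_mem_nil, not_or, or_false,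
      Finset.mem_insert, Finset.mem_sdiff] at hw hc0'
    grind
  have hb3 := hF w1 (hQW _ q1) c0 hc0 hc01
  have e1 := hb.append hb2 (by
    clear hF hblue hJ
    rw [Finset.disjoint_left]
    intro t hx hx'
    have h1 := hWt t
    have h2 := hA t
    have h3 := hS t
    have h4 := @hQ t
    have h5 := hAS t
    simp only [List.nodup_cons, List.mem_cons, List.not_mem_nil, not_or, or_false,
      Finset.mem_union, Finset.mem_insert, Finset.mem_singleton, Finset.mem_erase,
      Finset.mem_sdiff] at *
    grind)
  have e2 := e1.append hb3 (by
    clear hF hblue hJ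
    rw [Finset.disjoint_left]
    intro t hx hx'
    have h1 := hWt t
    have h2 := hA t
    have h3 := hS t
    have h4 := @hQ t
    have h5 := hAS t
    simp only [List.nodup_cons, List.mem_cons, List.not_mem_nil, not_or, or_false,
      Finset.mem_union, Finset.mem_insert, Finset.mem_singleton, Finset.mem_erase,
      Finset.mem_sdiff] at *
    grind)
  exact hn _ _ e2

theorem evenI {col : Finset V → Bool} {g : ℕ → V} {h : ℕ} (hh : 1 ≤ h) (hg : RC col g (2 * h + 1))
    {Wt : Finset V} (hW : Disjoint Wt (Reg g 0 (3 * (2 * h + 1)))) (hc : h + 4 ≤ Wt.card)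
    (hn : NoCyc col true (2 * h + 2)) (hn' : NoCyc col false (2 * h + 2)) :
    ¬ Bad col (g 0) (Blk g 0) Wt := by
  intro hbad
  obtain ⟨⟨γ, hγ, st⟩, hF, hB, hr0⟩ := startI hg hW hn (by omega) (by omega) hbad
  obtain ⟨k, rfl⟩ : ∃ k, h = k + 1 := ⟨h - 1, by omega⟩
  have hWi : ∀ x ∈ Wt, ∀ i, 0 < i → i ≤ 6 * k + 9 → x ≠ g i := by
    rintro x hx i h1 h2 rfl
    exact Finset.disjoint_left.mp hW hx (mem_Reg.mpr ⟨i, h1, by omega, rfl⟩)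
  have hne : ∀ i j, 0 < i → i ≤ 6 * k + 9 → 0 < j → j ≤ 6 * k + 9 → i ≠ j → g i ≠ g j :=
    fun i j h1 h2 h3 h4 h5 => hg.ne h1 (by omega) h3 (by omega) h5
  have h1W : g 1 ∉ Wt := fun hx => hWi _ hx 1 (by omega) (by omega) rfl
  obtain ⟨z, Q, D, st', hQc, -⟩ := St.iter hg hW hn h1W (Finset.erase_subset _ _) k 0 _ _ _ st
    (by rw [Finset.card_erase_of_mem hγ]; omega) (by omega)
    (hg.nReg (by omega) (by omega) (by omega) (Or.inl (by omega)))
  rw [show 0 + k = k by omega] at st'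
  have e1 : 6 * (1 + k) = 6 * k + 6 := by ring
  have hnr := noRed hg hW hn (L := 1) (st'.hQ.trans (Finset.erase_subset _ _)) st'.red (by omega)
  rw [e1, show 6 * k + 6 + 3 * 1 = 6 * k + 9 by rfl] at hnr
  have hz := st'.hz
  have hbl := st'.blue
  rw [e1] at hz hbl
  simp only [show 6 * 1 = 6 by rfl] at hz hbl
  have hSd : ∀ i, 0 < i → i ≤ 6 * k + 9 → (i ≤ 1 ∨ 5 < i) → g i ∉ (Blk g 0).erase (g 1) := by
    intro i h1 h2 h3 hx
    rw [Finset.mem_erase] at hx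
    obtain ⟨j, h4, h5, h6⟩ := mem_Reg.mp hx.2
    by_cases hj : i = 1
    · subst hj; exact hx.1 rfl
    · exact hne j i (by omega) (by omega) (by omega) (by omega) (by omega) h6
  refine evenI_core (u := g (6 * k + 9)) (r := g 6) (a := g 1) (x := g (6 * k + 7))
    (y := g (6 * k + 8)) (A := Reg g 6 (6 * k + 6)) (S := (Blk g 0).erase (g 1)) ?_ ?_ ?_ ?_ ?_
    st'.hQ st'.hD hQc hz hbl hnr ?_ hF hn'
  · simp only [List.nodup_cons, List.mem_cons, List.not_mem_nil, not_or, or_false]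
    and_intros
    all_goals first | (apply hne <;> omega) | simp
  · simp only [List.forall_mem_cons]
    and_intros
    all_goals first | (apply hg.nReg <;> omega) | simp
  · simp only [List.forall_mem_cons]
    and_intros
    all_goals first | (apply hSd <;> omega) | simp
  · intro t ht ht'
    exact Finset.disjoint_left.mp (hg.disj (a := 0) (b := 5) (c := 6) (d := 6 * k + 6) (by omega)
      (by omega)) (Finset.mem_of_mem_erase ht') ht
  · intro x hx
    refine ⟨fun h => ?_, fun h => ?_, ?_⟩
    · obtain ⟨i, h1, h2, h3⟩ := mem_Reg.mp h
      exact hWi x hx i (by omega) (by omega) h3.symm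
    · obtain ⟨i, h1, h2, h3⟩ := mem_Reg.mp (Finset.mem_of_mem_erase h)
      exact hWi x hx i (by omega) (by omega) h3.symm
    · simp only [List.mem_cons, List.not_mem_nil, not_or, or_false]
      and_intros
      all_goals apply hWi x hx <;> omega
  · intro x hx
    rw [Finset.mem_union, mem_Reg]
    simp only [Finset.mem_insert] at hx
    rcases hx with rfl | rfl | rfl | hx
    · exact Or.inl ⟨_, by omega, by omega, rfl⟩
    · exact Or.inl ⟨_, by omega, by omega, rfl⟩
    · exact Or.inl ⟨_, by omega, by omega, rfl⟩
    · exact Or.inr hx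

end LC

namespace LC
variable {V : Type*} [DecidableEq V]

theorem W.two {col : Finset V → Bool} {β : Bool} {s a b m c d t : V} {J : Finset V}
    (hnd : [a, b, m, c, d, t].Nodup) (hJ : ∀ x ∈ [a, b, m, c, d, t], x ∈ J)
    (h1 : col {s, a, b, m} = β) (h2 : col {m, c, d, t} = β) : W col β 2 s t J :=
  ⟨[a, b, m, c, d, t], rfl, hnd, hJ, h1, h2, rfl⟩

theorem set4 {a b c d : V} {T : Finset V} (h : ∀ x, x ∈ T ↔ x = a ∨ x = b ∨ x = c ∨ x = d) :
    ({a, b, c, d} : Finset V) = T := by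
  ext x; rw [h]; simp

set_option maxHeartbeats 2000000 in
theorem evenLR {col : Finset V → Bool} {v x y u c e e' : V} {T T' J : Finset V}
    (hvu : [v, x, y, u].Nodup)
    (hce : [c, e, e'].Nodup) (hd : ∀ w ∈ [c, e, e'], w ∉ [v, x, y, u])
    (hT : T.card = 3) (hT' : T'.card = 3) (hTd : ∀ t ∈ T, t ∉ [v, x, y, u, c, e])
    (hTd' : ∀ t ∈ T', t ∉ [v, x, y, u, c, e'])
    (hJ : ∀ t ∈ [x, y, u, c, e, e'], t ∈ J) (hTJ : T ⊆ J) (hTJ' : T' ⊆ J)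
    (hR : ¬ W col true 2 v u J)
    (hA : ¬ W col false 2 c e ({e, x, y, v} ∪ T))
    (hB : ¬ W col false 2 c e' ({e', x, y, u} ∪ T')) : False := by
  have pick : ∀ (T : Finset V) (w : V), T.card = 3 → ∃ t ∈ T, ∃ t' ∈ T, t ≠ t' ∧ t ≠ w ∧ t' ≠ w := by
    intro T w hT
    have : 1 < (T.erase w).card := by
      have := Finset.pred_card_le_card_erase (s := T) (a := w)
      omega
    obtain ⟨t, ht, t', ht', hne⟩ := Finset.one_lt_card.mp this
    rw [Finset.mem_erase] at ht ht'
    exact ⟨t, ht.2, t', ht'.2, hne, ht.1, ht'.1⟩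
  simp only [List.nodup_cons, List.mem_cons, List.not_mem_nil, not_or, or_false] at hvu hce hTd hTd'
  simp only [List.forall_mem_cons] at hd hJ
  simp only [List.mem_cons, List.not_mem_nil, not_or, or_false] at hd
  -- {e,v,x,y} is blue
  have b1 : col {v, x, y, e} = false := by
    by_contra hr
    rw [Bool.not_eq_false] at hr
    obtain ⟨t, ht, t', ht', htt, hte, hte'⟩ := pick T' e hT'
    have k1 := hTd' t ht
    have k2 := hTd' t' ht'
    have j1 := hTJ' ht
    have j2 := hTJ' ht'
    have c1 : col {y, t, e', u} = false := by
      by_contra hc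
      rw [Bool.not_eq_false] at hc
      refine hR (W.two (a := x) (b := e) (m := y) (c := t) (d := e') ?_ ?_ ?_ hc)
      · simp only [List.nodup_cons, List.mem_cons, List.not_mem_nil, not_or, or_false]; grind
      · simp only [List.forall_mem_cons]; grind
      · rw [← hr]; congr 1; apply set4; intro x; simp only [Finset.mem_insert, Finset.mem_singleton]; grind
    have c2 : col {x, t', c, u} = false := by
      by_contra hc
      rw [Bool.not_eq_false] at hc
      refine hR (W.two (a := y) (b := e) (m := x) (c := t') (d := c) ?_ ?_ ?_ hc)
      · simp only [List.nodup_cons, List.mem_cons, List.not_mem_nil, not_or, or_false]; grind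
      · simp only [List.forall_mem_cons]; grind
      · rw [← hr]; congr 1; apply set4; intro x; simp only [Finset.mem_insert, Finset.mem_singleton]; grind
    refine hB (W.two (a := t') (b := x) (m := u) (c := y) (d := t) ?_ ?_ ?_ ?_)
    · simp only [List.nodup_cons, List.mem_cons, List.not_mem_nil, not_or, or_false]; grind
    · simp only [List.forall_mem_cons, Finset.mem_union, Finset.mem_insert, Finset.mem_singleton]; grind
    · rw [← c2]; congr 1; apply set4; intro x; simp only [Finset.mem_insert, Finset.mem_singleton]; grind
    · rw [← c1]; congr 1; apply set4; intro x; simp only [Finset.mem_insert, Finset.mem_singleton]; grind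
  have b2 : col {u, x, y, e'} = false := by
    by_contra hr
    rw [Bool.not_eq_false] at hr
    obtain ⟨t, ht, t', ht', htt, hte, hte'⟩ := pick T e' hT
    have k1 := hTd t ht
    have k2 := hTd t' ht'
    have j1 := hTJ ht
    have j2 := hTJ ht'
    have c1 : col {v, t, e, y} = false := by
      by_contra hc
      rw [Bool.not_eq_false] at hc
      refine hR (W.two (a := t) (b := e) (m := y) (c := x) (d := e') ?_ ?_ hc ?_)
      · simp only [List.nodup_cons, List.mem_cons, List.not_mem_nil, not_or, or_false]; grind
      · simp only [List.forall_mem_cons]; grind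
      · rw [← hr]; congr 1; apply set4; intro x; simp only [Finset.mem_insert, Finset.mem_singleton]; grind
    have c2 : col {v, t', c, x} = false := by
      by_contra hc
      rw [Bool.not_eq_false] at hc
      refine hR (W.two (a := t') (b := c) (m := x) (c := y) (d := e') ?_ ?_ hc ?_)
      · simp only [List.nodup_cons, List.mem_cons, List.not_mem_nil, not_or, or_false]; grind
      · simp only [List.forall_mem_cons]; grind
      · rw [← hr]; congr 1; apply set4; intro x; simp only [Finset.mem_insert, Finset.mem_singleton]; grind
    refine hA (W.two (a := t') (b := x) (m := v) (c := y) (d := t) ?_ ?_ ?_ ?_)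
    · simp only [List.nodup_cons, List.mem_cons, List.not_mem_nil, not_or, or_false]; grind
    · simp only [List.forall_mem_cons, Finset.mem_union, Finset.mem_insert, Finset.mem_singleton]; grind
    · rw [← c2]; congr 1; apply set4; intro x; simp only [Finset.mem_insert, Finset.mem_singleton]; grind
    · rw [← c1]; congr 1; apply set4; intro x; simp only [Finset.mem_insert, Finset.mem_singleton]; grind
  have r1 : ∀ t ∈ T, ∀ t' ∈ T, t ≠ t' → col {c, t, t', v} = true := by
    intro t ht t' ht' htt
    by_contra hc
    rw [Bool.not_eq_true] at hc
    have k1 := hTd t ht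
    have k2 := hTd t' ht'
    refine hA (W.two (a := t) (b := t') (m := v) (c := x) (d := y) ?_ ?_ hc b1)
    · simp only [List.nodup_cons, List.mem_cons, List.not_mem_nil, not_or, or_false]; grind
    · simp only [List.forall_mem_cons, Finset.mem_union, Finset.mem_insert, Finset.mem_singleton]; grind
  have r2 : ∀ t ∈ T', ∀ t' ∈ T', t ≠ t' → col {c, t, t', u} = true := by
    intro t ht t' ht' htt
    by_contra hc
    rw [Bool.not_eq_true] at hc
    have k1 := hTd' t ht
    have k2 := hTd' t' ht'
    refine hB (W.two (a := t) (b := t') (m := u) (c := x) (d := y) ?_ ?_ hc b2)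
    · simp only [List.nodup_cons, List.mem_cons, List.not_mem_nil, not_or, or_false]; grind
    · simp only [List.forall_mem_cons, Finset.mem_union, Finset.mem_insert, Finset.mem_singleton]; grind
  by_cases hsub : T ⊆ T'
  · obtain ⟨t1, t2, t3, h12, h13, h23, rfl⟩ := Finset.card_eq_three.mp hT
    have m1 := hsub (show t1 ∈ _ by simp)
    have m2 := hsub (show t2 ∈ _ by simp)
    have m3 := hsub (show t3 ∈ _ by simp)
    have k1 := hTd' t1 m1
    have k2 := hTd' t2 m2
    have k3 := hTd' t3 m3
    have j1 := hTJ' m1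
    have j2 := hTJ' m2
    have j3 := hTJ' m3
    have hr := r1 t1 (by simp) t2 (by simp) h12
    have c1 : col {c, t3, x, u} = false := by
      by_contra hc
      rw [Bool.not_eq_false] at hc
      refine hR (W.two (a := t1) (b := t2) (m := c) (c := t3) (d := x) ?_ ?_ ?_ hc)
      · simp only [List.nodup_cons, List.mem_cons, List.not_mem_nil, not_or, or_false]; grind
      · simp only [List.forall_mem_cons]; grind
      · rw [← hr]; congr 1; apply set4; intro x; simp only [Finset.mem_insert, Finset.mem_singleton]; grind
    have c2 : col {t1, y, e', u} = false := by
      by_contra hc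
      rw [Bool.not_eq_false] at hc
      refine hR (W.two (a := c) (b := t2) (m := t1) (c := y) (d := e') ?_ ?_ ?_ hc)
      · simp only [List.nodup_cons, List.mem_cons, List.not_mem_nil, not_or, or_false]; grind
      · simp only [List.forall_mem_cons]; grind
      · rw [← hr]; congr 1; apply set4; intro x; simp only [Finset.mem_insert, Finset.mem_singleton]; grind
    refine hB (W.two (a := t3) (b := x) (m := u) (c := t1) (d := y) ?_ ?_ c1 ?_)
    · simp only [List.nodup_cons, List.mem_cons, List.not_mem_nil, not_or, or_false]; grind
    · simp only [List.forall_mem_cons, Finset.mem_union, Finset.mem_insert, Finset.mem_singleton]; grind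
    · rw [← c2]; congr 1; apply set4; intro x; simp only [Finset.mem_insert, Finset.mem_singleton]; grind
  · obtain ⟨t, ht, htn⟩ := Finset.not_subset.mp hsub
    obtain ⟨t2, ht2, -, -, -, ht2t, -⟩ := pick T t hT
    obtain ⟨s, hs, s', hs', hss, hs2, hs2'⟩ := pick T' t2 hT'
    have k1 := hTd t ht
    have k2 := hTd t2 ht2
    have k3 := hTd' s hs
    have k4 := hTd' s' hs'
    have j1 := hTJ ht
    have j2 := hTJ ht2
    have j3 := hTJ' hs
    have j4 := hTJ' hs'
    refine hR (W.two (a := t) (b := t2) (m := c) (c := s) (d := s') ?_ ?_ ?_ (r2 s hs s' hs' hss))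
    · simp only [List.nodup_cons, List.mem_cons, List.not_mem_nil, not_or, or_false]; grind
    · simp only [List.forall_mem_cons]; grind
    · rw [← r1 t ht t2 ht2 ht2t.symm]; congr 1; apply set4; intro x
      simp only [Finset.mem_insert, Finset.mem_singleton]; grind

end LC

namespace LC
variable {V : Type*} [DecidableEq V]

def shf (g : ℕ → V) (m a i : ℕ) : V := if i + 3 * a ≤ 3 * m then g (i + 3 * a) else g (i + 3 * a - 3 * m)

theorem shf_lo {g : ℕ → V} {m a i : ℕ} (h : i + 3 * a ≤ 3 * m) : shf g m a i = g (i + 3 * a) := if_pos h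

theorem shf_hi {g : ℕ → V} {m a i : ℕ} (h : 3 * m < i + 3 * a) :
    shf g m a i = g (i + 3 * a - 3 * m) := if_neg (by omega)

theorem RC.shift {col : Finset V → Bool} {g : ℕ → V} {m : ℕ} (h : RC col g m) {a : ℕ} (ha : a ≤ m) :
    RC col (shf g m a) m := by
  refine ⟨?_, ?_, ?_⟩
  · intro i j h1 h2 h3 h4 h5
    unfold shf at h5
    split_ifs at h5
    · have := h.inj _ _ (by omega) (by omega) (by omega) (by omega) h5; omega
    · have := h.inj _ _ (by omega) (by omega) (by omega) (by omega) h5; omega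
    · have := h.inj _ _ (by omega) (by omega) (by omega) (by omega) h5; omega
    · have := h.inj _ _ (by omega) (by omega) (by omega) (by omega) h5; omega
  · by_cases h0 : a = 0
    · subst h0
      rw [shf_lo (by omega), shf_lo (by omega)]; simpa using h.close
    · rw [shf_hi (by omega), shf_lo (by omega)]; congr 1; omega
  · intro i hi
    by_cases hia : i + a < m
    · have := h.red (i + a) hia
      rw [shf_lo (by omega), shf_lo (by omega), shf_lo (by omega), shf_lo (by omega)]
      rw [show 3 * i + 3 * a = 3 * (i + a) by ring, show 3 * i + 1 + 3 * a = 3 * (i + a) + 1 by ring,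
        show 3 * i + 2 + 3 * a = 3 * (i + a) + 2 by ring, show 3 * i + 3 + 3 * a = 3 * (i + a) + 3 by ring]
      exact this
    · have := h.red (i + a - m) (by omega)
      have e : shf g m a (3 * i) = g (3 * (i + a - m)) := by
        by_cases hh : i + a = m
        · rw [shf_lo (by omega), show 3 * i + 3 * a = 3 * m by omega, h.close]; congr 1; omega
        · rw [shf_hi (by omega)]; congr 1; omega
      rw [e, shf_hi (by omega), shf_hi (by omega), shf_hi (by omega)]
      rw [show 3 * i + 1 + 3 * a - 3 * m = 3 * (i + a - m) + 1 by omega,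
        show 3 * i + 2 + 3 * a - 3 * m = 3 * (i + a - m) + 2 by omega,
        show 3 * i + 3 + 3 * a - 3 * m = 3 * (i + a - m) + 3 by omega]
      exact this

theorem shf_Reg {g : ℕ → V} {m a : ℕ} (ha : a ≤ m) : Reg (shf g m a) 0 (3 * m) ⊆ Reg g 0 (3 * m) := by
  intro x
  rw [mem_Reg, mem_Reg]
  rintro ⟨i, h1, h2, rfl⟩
  unfold shf
  split_ifs
  · exact ⟨_, by omega, by omega, rfl⟩
  · exact ⟨_, by omega, by omega, rfl⟩

theorem shf_Blk {g : ℕ → V} {m a : ℕ} (ha : a + 2 ≤ m) : Blk (shf g m a) 0 = Blk g (3 * a) := by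
  rw [Blk_eq, Blk_eq]
  rw [shf_lo (by omega), shf_lo (by omega), shf_lo (by omega), shf_lo (by omega), shf_lo (by omega)]
  simp only [Nat.zero_add]
  simp only [Nat.add_comm _ (3 * a)]

def rvg (g : ℕ → V) (m i : ℕ) : V := g (3 * m - i)

theorem RC.revg {col : Finset V → Bool} {g : ℕ → V} {m : ℕ} (h : RC col g m) (hm : 0 < m) :
    RC col (rvg g m) m := by
  refine ⟨?_, ?_, ?_⟩
  · intro i j h1 h2 h3 h4 h5
    unfold rvg at h5
    have e : ∀ i, 0 < i → i ≤ 3 * m → ∃ i', 0 < i' ∧ i' ≤ 3 * m ∧ g (3 * m - i) = g i' ∧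
        (i' = 3 * m - i ∨ i = 3 * m ∧ i' = 3 * m) := by
      intro i h1 h2
      by_cases hi : i = 3 * m
      · refine ⟨3 * m, by omega, by omega, ?_, Or.inr ⟨hi, rfl⟩⟩
        rw [h.close]; congr 1; omega
      · exact ⟨3 * m - i, by omega, by omega, rfl, Or.inl rfl⟩
    obtain ⟨i', a1, a2, a3, a4⟩ := e i h1 h2
    obtain ⟨j', b1, b2, b3, b4⟩ := e j h3 h4
    have := h.inj i' j' a1 a2 b1 b2 (a3.symm.trans (h5.trans b3))
    omega
  · simp [rvg, h.close]
  · intro i hi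
    have := h.red (m - 1 - i) (by omega)
    unfold rvg
    rw [← this]
    congr 1
    rw [show 3 * m - 3 * i = 3 * (m - 1 - i) + 3 by omega,
      show 3 * m - (3 * i + 1) = 3 * (m - 1 - i) + 2 by omega,
      show 3 * m - (3 * i + 2) = 3 * (m - 1 - i) + 1 by omega,
      show 3 * m - (3 * i + 3) = 3 * (m - 1 - i) by omega]
    apply set4
    intro x
    simp only [Finset.mem_insert, Finset.mem_singleton]
    tauto

theorem rvg_Reg {g : ℕ → V} {m : ℕ} (hc : g (3 * m) = g 0) (hm : 0 < m) :
    Reg (rvg g m) 0 (3 * m) ⊆ Reg g 0 (3 * m) := by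
  intro x
  rw [mem_Reg, mem_Reg]
  rintro ⟨i, h1, h2, rfl⟩
  unfold rvg
  by_cases hi : i = 3 * m
  · exact ⟨3 * m, by omega, by omega, by rw [hc]; congr 1; omega⟩
  · exact ⟨_, by omega, by omega, rfl⟩

theorem notBad {col : Finset V → Bool} {z : V} {S Q : Finset V} (h : ¬ Bad col z S Q) :
    ∃ C : Finset V, C.card ≤ 2 ∧ ∀ f ∈ Q, ∀ f' ∈ Q, f ≠ f' → NE col z S f f' → f ∉ C → f' ∈ C := by
  unfold Bad at h
  push Not at h
  exact h

theorem three_of {Q : Finset V} {e : V} (h : 4 ≤ Q.card) (he : e ∈ Q) :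
    ∃ t1 t2 t3, [e, t1, t2, t3].Nodup ∧ t1 ∈ Q ∧ t2 ∈ Q ∧ t3 ∈ Q := by
  have h3 : 3 ≤ (Q.erase e).card := by rw [Finset.card_erase_of_mem he]; omega
  obtain ⟨T, hT, hTc⟩ := Finset.exists_subset_card_eq h3
  obtain ⟨t1, t2, t3, h12, h13, h23, rfl⟩ := Finset.card_eq_three.mp hTc
  refine ⟨t1, t2, t3, ?_⟩
  simp only [Finset.insert_subset_iff, Finset.singleton_subset_iff, Finset.mem_erase] at hT
  simp only [List.nodup_cons, List.mem_cons, List.not_mem_nil, not_or, or_false]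
  grind

/-- closing a scan -/
theorem closeScan {col : Finset V → Bool} {n L : ℕ} {c e : V} {R X T Wt Q : Finset V}
    (hn : NoCyc col false (n + L))
    (hs : W col false n c e ((R ∪ insert e (Wt \ Q)).erase c))
    (hQ : Q ⊆ Wt.erase c) (he : e ∈ Q) (hT : T ⊆ Q.erase e) (hcW : c ∈ Wt)
    (hX : ∀ x ∈ X, x ∉ R ∧ x ∉ Wt) (hR : ∀ x ∈ R, x ∉ Wt) :
    ¬ W col false L c e (insert e (X ∪ T)) := by
  intro hw
  have hcT : c ∉ X ∪ T := by
    rw [Finset.mem_union, not_or]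
    refine ⟨fun h => (hX c h).2 hcW, fun h => ?_⟩
    have := hQ (Finset.mem_of_mem_erase (hT h))
    simp at this
  have hce : c ≠ e := by
    rintro rfl
    have := hQ he
    simp at this
  refine hn _ _ (hs.append (hw.rev hcT hce) ?_)
  rw [Finset.disjoint_left]
  intro x hx hx'
  have h1 := @hQ x
  have h2 := @hT x
  have h3 := hX x
  have h4 := hR x
  have h5 := @hQ e
  simp only [Finset.mem_union, Finset.mem_insert, Finset.mem_erase, Finset.mem_sdiff] at *
  grind

end LC

namespace LC
variable {V : Type*} [DecidableEq V]

theorem scanNo {col : Finset V → Bool} {g : ℕ → V} {m : ℕ} (h : RC col g m) {Wt : Finset V}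
    (hW : Disjoint Wt (Reg g 0 (3 * m))) (hn : NoCyc col true (m + 1)) (hn' : NoCyc col false (m + 1))
    {t L : ℕ} (ht : 1 ≤ t) (htm : 6 * t < 3 * m) (hL : 2 * t + L = m + 1) (hc : t + 4 ≤ Wt.card)
    (hnb : ∀ a, a + 2 ≤ m → ¬ Bad col (g (3 * a)) (Blk g (3 * a)) Wt) :
    ∃ C : Finset V, C.card ≤ 2 ∧ ∀ c ∈ Wt, c ∉ C → ∃ Q D : Finset V, Q ⊆ Wt.erase c ∧ D.card ≤ 2 ∧
      4 ≤ Q.card ∧ ∀ e ∈ Q, e ∉ D → ∀ T, T ⊆ Q.erase e →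
      ¬ W col false L c e (insert e (Reg g (6 * t - 1) (3 * m - 1) ∪ T)) := by
  obtain ⟨C, hC, hcov⟩ := notBad (hnb 0 (by omega))
  refine ⟨C, hC, fun c hcW hcC => ?_⟩
  obtain ⟨Q, D, hQ, hD, hQc, hb⟩ := scan h hW hn ht htm hc (fun i hi => by
    have := hnb (2 * i) (by omega)
    rwa [show 3 * (2 * i) = 6 * i by ring] at this) hC hcov hcW hcC
  refine ⟨Q, D, hQ, hD, hQc, fun e he heD T hT => ?_⟩
  have hWn : ∀ i, 0 < i → i ≤ 3 * m → g i ∉ Wt := fun i h1 h2 hx =>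
    Finset.disjoint_left.mp hW hx (mem_Reg.mpr ⟨i, h1, h2, rfl⟩)
  refine closeScan (n := 2 * t) (by rwa [hL]) (hb e he heD) hQ he hT hcW ?_ ?_
  · intro x hx
    obtain ⟨i, h1, h2, rfl⟩ := mem_Reg.mp hx
    refine ⟨?_, hWn i (by omega) (by omega)⟩
    rw [Finset.mem_insert, not_or, ← h.close]
    exact ⟨h.ne (by omega) (by omega) (by omega) (by omega) (by omega),
      h.nReg (by omega) (by omega) (by omega) (by omega)⟩
  · intro x hx
    rw [Finset.mem_insert, ← h.close] at hx
    rcases hx with rfl | hx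
    · exact hWn _ (by omega) (by omega)
    · obtain ⟨i, h1, h2, rfl⟩ := mem_Reg.mp hx
      exact hWn i (by omega) (by omega)

theorem noRed0 {col : Finset V → Bool} {g : ℕ → V} {m : ℕ} (h : RC col g m) {Wt : Finset V}
    (hW : Disjoint Wt (Reg g 0 (3 * m))) (hn : NoCyc col true (m + 1)) {j L : ℕ}
    (hL : 2 * j + L ≤ m) :
    ¬ W col true (L + 1) (g (6 * j)) (g (6 * j + 3 * L)) (Reg g (6 * j) (6 * j + 3 * L) ∪ Wt) := by
  refine noRed h hW hn subset_rfl ?_ hL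
  have := h.walk 0 (2 * j) (by omega)
  rw [show 3 * (0 + 2 * j) = 6 * j by ring] at this
  exact this.mono Finset.subset_union_left

theorem nbOdd {col : Finset V → Bool} {g : ℕ → V} {h : ℕ} (hh : 2 ≤ h) (hg : RC col g (2 * h))
    {Wt : Finset V} (hW : Disjoint Wt (Reg g 0 (3 * (2 * h)))) (hc : h + 3 ≤ Wt.card)
    (hn : NoCyc col true (2 * h + 1)) (hn' : NoCyc col false (2 * h + 1)) (a : ℕ) (ha : a + 2 ≤ 2 * h) :
    ¬ Bad col (g (3 * a)) (Blk g (3 * a)) Wt := by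
  have := oddI hh (hg.shift (a := a) (by omega)) (hW.mono_right (shf_Reg (by omega))) hc hn hn'
  rw [shf_Blk ha, shf_lo (by omega), Nat.zero_add] at this
  exact this

theorem nbEven {col : Finset V → Bool} {g : ℕ → V} {h : ℕ} (hh : 1 ≤ h) (hg : RC col g (2 * h + 1))
    {Wt : Finset V} (hW : Disjoint Wt (Reg g 0 (3 * (2 * h + 1)))) (hc : h + 4 ≤ Wt.card)
    (hn : NoCyc col true (2 * h + 2)) (hn' : NoCyc col false (2 * h + 2)) (a : ℕ)
    (ha : a + 2 ≤ 2 * h + 1) : ¬ Bad col (g (3 * a)) (Blk g (3 * a)) Wt := by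
  have := evenI hh (hg.shift (a := a) (by omega)) (hW.mono_right (shf_Reg (by omega))) hc hn hn'
  rw [shf_Blk ha, shf_lo (by omega), Nat.zero_add] at this
  exact this

theorem pickc {Wt C C' : Finset V} (h : 5 ≤ Wt.card) (hC : C.card ≤ 2) (hC' : C'.card ≤ 2) :
    ∃ c ∈ Wt, c ∉ C ∧ c ∉ C' := by
  obtain ⟨c, h1, h2⟩ : ∃ c ∈ Wt, c ∉ C ∪ C' := by
    apply Finset.exists_mem_notMem_of_card_lt_card
    have := Finset.card_union_le C C'
    omega
  rw [Finset.mem_union, not_or] at h2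
  exact ⟨c, h1, h2⟩

theorem evenMain {col : Finset V → Bool} {g : ℕ → V} {h : ℕ} (hh : 1 ≤ h) (hg : RC col g (2 * h + 1))
    {Wt : Finset V} (hW : Disjoint Wt (Reg g 0 (3 * (2 * h + 1)))) (hc : h + 4 ≤ Wt.card)
    (hn : NoCyc col true (2 * h + 2)) (hn' : NoCyc col false (2 * h + 2)) : False := by
  have hg2 : RC col (shf (rvg g (2 * h + 1)) (2 * h + 1) 1) (2 * h + 1) :=
    (hg.revg (by omega)).shift (by omega)
  have hW2 : Disjoint Wt (Reg (shf (rvg g (2 * h + 1)) (2 * h + 1) 1) 0 (3 * (2 * h + 1))) :=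
    hW.mono_right ((shf_Reg (by omega)).trans (rvg_Reg hg.close (by omega)))
  have e0 : shf (rvg g (2 * h + 1)) (2 * h + 1) 1 (6 * h) = g (6 * h + 3) := by
    rw [shf_lo (by omega), rvg, show 6 * h + 3 = 3 * (2 * h + 1) by ring, hg.close]; congr 1; omega
  have e1 : shf (rvg g (2 * h + 1)) (2 * h + 1) 1 (6 * h + 1) = g (6 * h + 2) := by
    rw [shf_hi (by omega), rvg]; congr 1; omega
  have e2 : shf (rvg g (2 * h + 1)) (2 * h + 1) 1 (6 * h + 2) = g (6 * h + 1) := by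
    rw [shf_hi (by omega), rvg]; congr 1; omega
  obtain ⟨C, hC, hs⟩ := scanNo (t := h) (L := 2) hg hW hn hn' hh (by omega) (by omega) hc
    (nbEven hh hg hW hc hn hn')
  obtain ⟨C', hC', hs'⟩ := scanNo (t := h) (L := 2) hg2 hW2 hn hn' hh (by omega) (by omega) hc
    (nbEven hh hg2 hW2 hc hn hn')
  generalize shf (rvg g (2 * h + 1)) (2 * h + 1) 1 = g2 at *
  obtain ⟨c, hcW, hcC, hcC'⟩ := pickc (Wt := Wt) (by omega) hC hC'
  obtain ⟨Q, D, hQ, hD, hQc, hA⟩ := hs c hcW hcC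
  obtain ⟨Q', D', hQ', hD', hQc', hB⟩ := hs' c hcW hcC'
  obtain ⟨e, he, heD⟩ : ∃ e ∈ Q, e ∉ D := Finset.exists_mem_notMem_of_card_lt_card (by omega)
  obtain ⟨e', he', heD'⟩ : ∃ e' ∈ Q', e' ∉ insert e D' := by
    apply Finset.exists_mem_notMem_of_card_lt_card
    have := Finset.card_insert_le e D'
    omega
  rw [Finset.mem_insert, not_or] at heD'
  have hT3 : 3 ≤ (Q.erase e).card := by rw [Finset.card_erase_of_mem he]; omega
  have hT3' : 3 ≤ (Q'.erase e').card := by rw [Finset.card_erase_of_mem he']; omega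
  obtain ⟨T, hT, hTc⟩ := Finset.exists_subset_card_eq hT3
  obtain ⟨T', hT', hTc'⟩ := Finset.exists_subset_card_eq hT3'
  have hA' := hA e he heD T hT
  have hB' := hB e' he' heD'.2 T' hT'
  have hR := noRed0 hg hW hn (j := h) (L := 1) (by omega)
  have hWn : ∀ x ∈ Wt, ∀ i, 0 < i → i ≤ 6 * h + 3 → x ≠ g i := by
    rintro x hx i h1 h2 rfl
    exact Finset.disjoint_left.mp hW hx (mem_Reg.mpr ⟨i, h1, by omega, rfl⟩)
  have hWn4 : ∀ x ∈ Wt, x ∉ [g (6 * h), g (6 * h + 1), g (6 * h + 2), g (6 * h + 3)] := by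
    intro x hx
    simp only [List.mem_cons, List.not_mem_nil, not_or, or_false]
    and_intros
    all_goals apply hWn x hx <;> omega
  have heW := hQ he
  have heW' := hQ' he'
  rw [Finset.mem_erase] at heW heW'
  have hTW : ∀ t ∈ T, t ∈ Wt ∧ t ≠ c ∧ t ≠ e := by
    intro t ht
    have h1 := hT ht
    rw [Finset.mem_erase] at h1
    have h2 := hQ h1.2
    rw [Finset.mem_erase] at h2
    exact ⟨h2.2, h2.1, h1.1⟩
  have hTW' : ∀ t ∈ T', t ∈ Wt ∧ t ≠ c ∧ t ≠ e' := by
    intro t ht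
    have h1 := hT' ht
    rw [Finset.mem_erase] at h1
    have h2 := hQ' h1.2
    rw [Finset.mem_erase] at h2
    exact ⟨h2.2, h2.1, h1.1⟩
  refine evenLR (v := g (6 * h)) (x := g (6 * h + 1)) (y := g (6 * h + 2)) (u := g (6 * h + 3)) (c := c)
    (e := e) (e' := e') (T := T) (T' := T') ?_ ?_ ?_ hTc hTc' ?_ ?_ ?_ ?_ ?_ hR ?_ ?_
  · simp only [List.nodup_cons, List.mem_cons, List.not_mem_nil, not_or, or_false]
    and_intros
    all_goals first | (apply hg.ne <;> omega) | simp
  · simp only [List.nodup_cons, List.mem_cons, List.not_mem_nil, not_or, or_false]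
    grind
  · simp only [List.forall_mem_cons]
    exact ⟨hWn4 c hcW, hWn4 e heW.2, hWn4 e' heW'.2, by simp⟩
  · intro t ht
    have h1 := hTW t ht
    have h2 := hWn4 t h1.1
    simp only [List.mem_cons, List.not_mem_nil, not_or, or_false] at h2 ⊢
    grind
  · intro t ht
    have h1 := hTW' t ht
    have h2 := hWn4 t h1.1
    simp only [List.mem_cons, List.not_mem_nil, not_or, or_false] at h2 ⊢
    grind
  · simp only [List.forall_mem_cons, Finset.mem_union, mem_Reg]
    exact ⟨Or.inl ⟨_, by omega, by omega, rfl⟩, Or.inl ⟨_, by omega, by omega, rfl⟩,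
      Or.inl ⟨_, by omega, by omega, rfl⟩, Or.inr hcW, Or.inr heW.2, Or.inr heW'.2, by simp⟩
  · exact fun t ht => Finset.mem_union_right _ (hTW t ht).1
  · exact fun t ht => Finset.mem_union_right _ (hTW' t ht).1
  · refine fun hw => hA' (hw.mono ?_)
    intro x hx
    simp only [Finset.mem_union, Finset.mem_insert, Finset.mem_singleton] at hx ⊢
    rw [mem_Reg]
    rcases hx with (rfl | rfl | rfl | rfl) | hx
    · exact Or.inl rfl
    · exact Or.inr (Or.inl ⟨_, by omega, by omega, rfl⟩)
    · exact Or.inr (Or.inl ⟨_, by omega, by omega, rfl⟩)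
    · exact Or.inr (Or.inl ⟨_, by omega, by omega, rfl⟩)
    · exact Or.inr (Or.inr hx)
  · refine fun hw => hB' (hw.mono ?_)
    intro x hx
    simp only [Finset.mem_union, Finset.mem_insert, Finset.mem_singleton] at hx ⊢
    rw [mem_Reg]
    rcases hx with (rfl | rfl | rfl | rfl) | hx
    · exact Or.inl rfl
    · exact Or.inr (Or.inl ⟨_, by omega, by omega, e2⟩)
    · exact Or.inr (Or.inl ⟨_, by omega, by omega, e1⟩)
    · exact Or.inr (Or.inl ⟨_, by omega, by omega, e0⟩)
    · exact Or.inr (Or.inr hx)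

set_option maxHeartbeats 1000000 in
theorem oddMain {col : Finset V → Bool} {g : ℕ → V} {h : ℕ} (hh : 2 ≤ h) (hg : RC col g (2 * h))
    {Wt : Finset V} (hW : Disjoint Wt (Reg g 0 (3 * (2 * h)))) (hc : h + 3 ≤ Wt.card)
    (hn : NoCyc col true (2 * h + 1)) (hn' : NoCyc col false (2 * h + 1)) : False := by
  have hg2 : RC col (shf g (2 * h) (2 * h - 1)) (2 * h) := hg.shift (by omega)
  have hW2 : Disjoint Wt (Reg (shf g (2 * h) (2 * h - 1)) 0 (3 * (2 * h))) :=
    hW.mono_right (shf_Reg (by omega))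
  have e0 : ∀ i, 0 < i → shf g (2 * h) (2 * h - 1) (i + 3) = g i := by
    intro i hi
    rw [shf_hi (by omega)]; congr 1; omega
  obtain ⟨C, hC, hs⟩ := scanNo (t := h - 1) (L := 3) hg hW hn hn' (by omega) (by omega) (by omega)
    (by omega) (nbOdd hh hg hW hc hn hn')
  obtain ⟨C', hC', hs'⟩ := scanNo (t := h - 1) (L := 3) hg2 hW2 hn hn' (by omega) (by omega) (by omega)
    (by omega) (nbOdd hh hg2 hW2 hc hn hn')
  generalize shf g (2 * h) (2 * h - 1) = g2 at *
  obtain ⟨k, rfl⟩ : ∃ k, h = k + 2 := ⟨h - 2, by omega⟩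
  obtain ⟨c, hcW, hcC, hcC'⟩ := pickc (Wt := Wt) (by omega) hC hC'
  obtain ⟨Q, D, hQ, hD, hQc, hA⟩ := hs c hcW hcC
  obtain ⟨Q', D', hQ', hD', hQc', hB⟩ := hs' c hcW hcC'
  obtain ⟨e, he, heD⟩ : ∃ e ∈ Q, e ∉ D := Finset.exists_mem_notMem_of_card_lt_card (by omega)
  obtain ⟨e', he', heD'⟩ : ∃ e' ∈ Q', e' ∉ insert e D' := by
    apply Finset.exists_mem_notMem_of_card_lt_card
    have := Finset.card_insert_le e D'
    omega
  rw [Finset.mem_insert, not_or] at heD'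
  obtain ⟨t1, t2, t3, ht, ht1, ht2, ht3⟩ := three_of hQc he
  obtain ⟨u1, u2, u3, hu, hu1, hu2, hu3⟩ := three_of hQc' he'
  have hA' := hA e he heD {t1, t2, t3} (by
    simp only [List.nodup_cons, List.mem_cons, List.not_mem_nil, not_or, or_false] at ht
    intro x
    simp only [Finset.mem_insert, Finset.mem_singleton, Finset.mem_erase]
    grind)
  have hB' := hB e' he' heD'.2 {u1, u2, u3} (by
    simp only [List.nodup_cons, List.mem_cons, List.not_mem_nil, not_or, or_false] at hu
    intro x
    simp only [Finset.mem_insert, Finset.mem_singleton, Finset.mem_erase]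
    grind)
  have hR := noRed0 hg hW hn (j := k + 1) (L := 2) (by omega)
  have hR' := noRed0 hg2 hW2 hn (j := k + 1) (L := 2) (by omega)
  rw [show 6 * (k + 1) + 3 * 2 = 6 * k + 12 by ring, show 6 * (k + 1) = 6 * k + 6 by ring] at hR hR'
  rw [show 6 * k + 6 = (6 * k + 3) + 3 by ring, show 6 * k + 12 = (6 * k + 9) + 3 by ring,
    e0 _ (by omega), e0 _ (by omega)] at hR'
  have hWn : ∀ x ∈ Wt, ∀ i, 0 < i → i ≤ 6 * k + 12 → x ≠ g i := by
    rintro x hx i h1 h2 rfl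
    exact Finset.disjoint_left.mp hW hx (mem_Reg.mpr ⟨i, h1, by omega, rfl⟩)
  have hQW : ∀ x ∈ Q, x ∈ Wt ∧ x ≠ c := fun x hx => by
    have := hQ hx; rw [Finset.mem_erase] at this; exact ⟨this.2, this.1⟩
  have hQW' : ∀ x ∈ Q', x ∈ Wt ∧ x ≠ c := fun x hx => by
    have := hQ' hx; rw [Finset.mem_erase] at this; exact ⟨this.2, this.1⟩
  have ndg : ∀ e t1 t2 t3, [e, t1, t2, t3].Nodup → (∀ x ∈ [e, t1, t2, t3], x ∈ Wt ∧ x ≠ c) →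
      [g (6 * k + 6), g (6 * k + 12), g (6 * k + 7), g (6 * k + 8), g (6 * k + 9), g (6 * k + 10),
        g (6 * k + 11), g (6 * k + 3), g (6 * k + 4), g (6 * k + 5), c, e, t1, t2, t3].Nodup := by
    intro e t1 t2 t3 h1 h2
    change ([g (6 * k + 6), g (6 * k + 12), g (6 * k + 7), g (6 * k + 8), g (6 * k + 9), g (6 * k + 10),
        g (6 * k + 11), g (6 * k + 3), g (6 * k + 4), g (6 * k + 5)] ++ (c :: [e, t1, t2, t3])).Nodup
    rw [List.nodup_append]
    refine ⟨?_, ?_, ?_⟩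
    · simp only [List.nodup_cons, List.mem_cons, List.not_mem_nil, not_or, or_false]
      and_intros
      all_goals first | (apply hg.ne <;> omega) | simp
    · rw [List.nodup_cons]
      exact ⟨fun hx => (h2 c hx).2 rfl, h1⟩
    · rintro x hx _ hy rfl
      have hxW : x ∈ Wt := by
        rcases List.mem_cons.mp hy with rfl | hy
        · exact hcW
        · exact (h2 x hy).1
      have := hWn x hxW
      simp only [List.mem_cons, List.not_mem_nil, or_false] at hx
      rcases hx with hx | hx | hx | hx | hx | hx | hx | hx | hx | hx
      all_goals exact this _ (by omega) (by omega) hx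
  have mJ : ∀ e t1 t2 t3, (∀ x ∈ [e, t1, t2, t3], x ∈ Wt ∧ x ≠ c) →
      ∀ x ∈ [g (6 * k + 12), g (6 * k + 7), g (6 * k + 8), g (6 * k + 9), g (6 * k + 10),
        g (6 * k + 11), c, e, t1, t2, t3], x ∈ Reg g (6 * k + 6) (6 * k + 12) ∪ Wt := by
    intro e t1 t2 t3 h2
    simp only [List.forall_mem_cons] at h2 ⊢
    simp only [Finset.mem_union, mem_Reg]
    refine ⟨Or.inl ⟨_, ?_, ?_, rfl⟩, Or.inl ⟨_, ?_, ?_, rfl⟩, Or.inl ⟨_, ?_, ?_, rfl⟩,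
      Or.inl ⟨_, ?_, ?_, rfl⟩, Or.inl ⟨_, ?_, ?_, rfl⟩, Or.inl ⟨_, ?_, ?_, rfl⟩, Or.inr hcW,
      Or.inr h2.1.1, Or.inr h2.2.1.1, Or.inr h2.2.2.1.1, Or.inr h2.2.2.2.1.1, by simp⟩
    all_goals omega
  have mK : ∀ e t1 t2 t3, (∀ x ∈ [e, t1, t2, t3], x ∈ Wt ∧ x ≠ c) →
      ∀ x ∈ [g (6 * k + 9), g (6 * k + 4), g (6 * k + 5), g (6 * k + 6), g (6 * k + 7),
        g (6 * k + 8), c, e, t1, t2, t3], x ∈ Reg g2 (6 * k + 3 + 3) (6 * k + 9 + 3) ∪ Wt := by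
    intro e t1 t2 t3 h2
    simp only [List.forall_mem_cons] at h2 ⊢
    simp only [Finset.mem_union, mem_Reg]
    refine ⟨Or.inl ⟨_, ?_, ?_, e0 _ ?_⟩, Or.inl ⟨_, ?_, ?_, e0 _ ?_⟩, Or.inl ⟨_, ?_, ?_, e0 _ ?_⟩,
      Or.inl ⟨_, ?_, ?_, e0 _ ?_⟩, Or.inl ⟨_, ?_, ?_, e0 _ ?_⟩, Or.inl ⟨_, ?_, ?_, e0 _ ?_⟩, Or.inr hcW,
      Or.inr h2.1.1, Or.inr h2.2.1.1, Or.inr h2.2.2.1.1, Or.inr h2.2.2.2.1.1, by simp⟩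
    all_goals omega
  have mt : ∀ x ∈ [e, t1, t2, t3], x ∈ Wt ∧ x ≠ c := by
    simp only [List.forall_mem_cons]
    exact ⟨hQW _ he, hQW _ ht1, hQW _ ht2, hQW _ ht3, by simp⟩
  have mu : ∀ x ∈ [e', u1, u2, u3], x ∈ Wt ∧ x ≠ c := by
    simp only [List.forall_mem_cons]
    exact ⟨hQW' _ he', hQW' _ hu1, hQW' _ hu2, hQW' _ hu3, by simp⟩
  have red1 := hg.red (2 * k + 1) (by omega)
  have red2 := hg.red (2 * k + 2) (by omega)
  have red3 := hg.red (2 * k + 3) (by omega)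
  rw [show 3 * (2 * k + 1) = 6 * k + 3 by ring] at red1
  rw [show 3 * (2 * k + 2) = 6 * k + 6 by ring] at red2
  rw [show 3 * (2 * k + 3) = 6 * k + 9 by ring] at red3
  simp only [Nat.add_assoc, Nat.reduceAdd] at red1 red2 red3
  refine v6c (ndg e t1 t2 t3 ht mt) (ndg e' u1 u2 u3 hu mu) red2 ?_ ?_ hR (mJ e t1 t2 t3 mt) hR'
    (mK e t1 t2 t3 mt) hR (mJ e' u1 u2 u3 mu) hR' (mK e' u1 u2 u3 mu) ?_ ?_
  · rw [← red3]; congr 1; apply set4; intro x; simp only [Finset.mem_insert, Finset.mem_singleton]; tauto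
  · rw [← red1]; congr 1; apply set4; intro x; simp only [Finset.mem_insert, Finset.mem_singleton]; tauto
  · refine fun hw => hA' (hw.mono ?_)
    intro x hx
    simp only [Finset.mem_union, Finset.mem_insert, Finset.mem_singleton] at hx ⊢
    rw [mem_Reg]
    rcases hx with rfl | rfl | rfl | rfl | rfl | rfl | rfl | hx
    · exact Or.inl rfl
    all_goals first
      | exact Or.inr (Or.inl ⟨_, by omega, by omega, rfl⟩)
      | exact Or.inr (Or.inr hx)
  · refine fun hw => hB' (hw.mono ?_)
    intro x hx
    simp only [Finset.mem_union, Finset.mem_insert, Finset.mem_singleton] at hx ⊢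
    rw [mem_Reg]
    rcases hx with rfl | rfl | rfl | rfl | rfl | rfl | rfl | hx
    · exact Or.inl rfl
    · exact Or.inr (Or.inl ⟨6 * k + 4 + 3, by omega, by omega, e0 _ (by omega)⟩)
    · exact Or.inr (Or.inl ⟨6 * k + 5 + 3, by omega, by omega, e0 _ (by omega)⟩)
    · exact Or.inr (Or.inl ⟨6 * k + 6 + 3, by omega, by omega, e0 _ (by omega)⟩)
    · exact Or.inr (Or.inl ⟨6 * k + 7 + 3, by omega, by omega, e0 _ (by omega)⟩)
    · exact Or.inr (Or.inl ⟨6 * k + 8 + 3, by omega, by omega, e0 _ (by omega)⟩)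
    · exact Or.inr (Or.inl ⟨6 * k + 3 + 3, by omega, by omega, e0 _ (by omega)⟩)
    · exact Or.inr (Or.inr hx)

end LC

namespace LC
variable {V : Type*} [DecidableEq V]

theorem Wk_get {col : Finset V → Bool} {b : Bool} (d : V) : ∀ {s : V} {l : List V} {t : V} (m : ℕ),
    l.length = 3 * m → Wk col b s l t →
    (s :: l).getD (3 * m) d = t ∧ ∀ i < m, col {(s :: l).getD (3 * i) d, (s :: l).getD (3 * i + 1) d,
      (s :: l).getD (3 * i + 2) d, (s :: l).getD (3 * i + 3) d} = b
  | s, l, t, 0, hl, h => by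
      have : l = [] := List.length_eq_zero_iff.mp (by omega)
      subst this
      simp only [Wk] at h
      exact ⟨by simpa using h, by intro i hi; omega⟩
  | s, [], t, m + 1, hl, h => by simp at hl
  | s, [_], t, m + 1, hl, h => by simp [Wk] at h
  | s, [_, _], t, m + 1, hl, h => by simp [Wk] at h
  | s, x :: y :: u :: r, t, m + 1, hl, h => by
      simp only [Wk] at h
      simp only [List.length_cons] at hl
      obtain ⟨h1, h2⟩ := Wk_get d m (by omega) h.2
      refine ⟨?_, ?_⟩
      · rw [← h1, show 3 * (m + 1) = 3 * m + 1 + 1 + 1 by ring]; simp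
      · intro i hi
        cases i with
        | zero => simpa using h.1
        | succ i =>
          rw [← h2 i (by omega), show 3 * (i + 1) = 3 * i + 1 + 1 + 1 by ring]
          simp

theorem cyc_g {col : Finset V → Bool} {b : Bool} {m : ℕ} {s : V} {J : Finset V}
    (h : W col b m s s J) : ∃ g : ℕ → V,
      (∀ i j, 0 < i → i ≤ 3 * m → 0 < j → j ≤ 3 * m → g i = g j → i = j) ∧ g (3 * m) = g 0 ∧
      ∀ i < m, col {g (3 * i), g (3 * i + 1), g (3 * i + 2), g (3 * i + 3)} = b := by
  obtain ⟨l, h1, h2, -, h4⟩ := h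
  obtain ⟨h5, h6⟩ := Wk_get s m h1 h4
  refine ⟨fun i => (s :: l).getD i s, ?_, by simpa using h5, h6⟩
  intro i j hi hi' hj hj' e
  obtain ⟨i, rfl⟩ : ∃ k, i = k + 1 := ⟨i - 1, by omega⟩
  obtain ⟨j, rfl⟩ : ∃ k, j = k + 1 := ⟨j - 1, by omega⟩
  have hi2 : i < l.length := by omega
  have hj2 : j < l.length := by omega
  simp only [List.getD_cons_succ, List.getD_eq_getElem _ _ hi2, List.getD_eq_getElem _ _ hj2] at e
  have := (h2.getElem_inj_iff).mp e
  omega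

theorem Wk_swap {col : Finset V → Bool} {b : Bool} : ∀ {s : V} {l : List V} {t : V},
    Wk (fun e => !col e) b s l t → Wk col (!b) s l t
  | s, [], t, h => by simpa [Wk] using h
  | s, x :: y :: v :: r, t, h => by
      simp only [Wk] at h ⊢
      refine ⟨?_, Wk_swap h.2⟩
      rw [← h.1]; simp
  | _, [_], _, h => by simp [Wk] at h
  | _, [_, _], _, h => by simp [Wk] at h

theorem NoCyc.swap {col : Finset V → Bool} {b : Bool} {n : ℕ} (h : NoCyc col (!b) n) :
    NoCyc (fun e => !col e) b n := by
  rintro s J ⟨l, h1, h2, h3, h4⟩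
  exact h s J ⟨l, h1, h2, h3, Wk_swap h4⟩

theorem main_of_red [Fintype V] {col : Finset V → Bool} {g : ℕ → V} {m : ℕ} (hm : 3 ≤ m)
    (hg : RC col g m) (hV : 3 * (m + 1) + (m + 1) / 2 ≤ Fintype.card V)
    (h1 : NoCyc col true (m + 1)) (h2 : NoCyc col false (m + 1)) : False := by
  have hW : Disjoint (Finset.univ \ Reg g 0 (3 * m)) (Reg g 0 (3 * m)) := Finset.sdiff_disjoint
  have hR : (Reg g 0 (3 * m)).card ≤ 3 * m := by
    unfold Reg
    refine Finset.card_image_le.trans ?_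
    simp
  have hc : Fintype.card V ≤ (Finset.univ \ Reg g 0 (3 * m)).card + 3 * m := by
    have := Finset.le_card_sdiff (Reg g 0 (3 * m)) Finset.univ
    rw [Finset.card_univ] at this
    omega
  generalize (Finset.univ \ Reg g 0 (3 * m)) = Wt at *
  rcases Nat.even_or_odd' m with ⟨h, rfl | rfl⟩
  · exact oddMain (by omega) hg hW (by omega) h1 h2
  · exact evenMain (by omega) hg hW (by omega) h1 h2

theorem base_red {col : Finset V → Bool} {L : List V} (hnd : L.Nodup) (hl : L.length = 10)
    {a b c d e f : V} (r : List V) (hp : (a :: b :: c :: d :: e :: f :: r).Perm L)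
    (e1 : col {a, b, c, d} = true) (e2 : col {a, d, e, f} = true)
    (h1 : NoCyc col true 3) (h2 : NoCyc col false 3) : False := by
  refine basec (d := a) (hp.nodup_iff.mpr hnd) (hp.length_eq.trans hl) (by simpa [lab] using e1)
    (by simpa [lab] using e2) ?_
  intro b s _
  cases b
  · exact h2 s _
  · exact h1 s _

theorem base_swap {col : Finset V → Bool} {L : List V} (hnd : L.Nodup) (hl : L.length = 10)
    {a b c d e f : V} (r : List V) (hp : (a :: b :: c :: d :: e :: f :: r).Perm L)
    (e1 : col {a, b, c, d} = col {a, d, e, f})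
    (h1 : NoCyc col true 3) (h2 : NoCyc col false 3) : False := by
  cases hb : col {a, b, c, d}
  · exact base_red (col := fun e => !col e) hnd hl r hp (by simpa using hb)
      (by simpa using e1.symm.trans hb) (NoCyc.swap (by simpa using h2)) (NoCyc.swap (by simpa using h1))
  · exact base_red hnd hl r hp hb (e1.symm.trans hb) h1 h2

theorem base3 [Fintype V] {col : Finset V → Bool} (hV : 10 ≤ Fintype.card V)
    (h1 : NoCyc col true 3) (h2 : NoCyc col false 3) : False := by
  obtain ⟨S, -, hS⟩ := Finset.exists_subset_card_eq (s := (Finset.univ : Finset V)) (n := 10)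
    (by rwa [Finset.card_univ])
  have hnd := S.nodup_toList
  have hl : S.toList.length = 10 := by simpa using hS
  generalize S.toList = L at *
  match L, hl with
  | [a, b, c, d, e, f, u, v, w, x], hl =>
    by_cases e1 : col {a, b, c, d} = col {c, d, e, f}
    · refine base_swap hnd hl (a := c) (b := a) (c := b) (d := d) (e := e) (f := f) [u, v, w, x] ?_ ?_ h1 h2
      · exact ((List.Perm.swap a c _).trans ((List.Perm.swap b c _).cons a))
      · rw [← e1]; congr 1; ext z; simp only [Finset.mem_insert, Finset.mem_singleton]; tauto
    · by_cases e2 : col {a, b, c, d} = col {e, f, a, b}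
      · refine base_swap hnd hl (a := a) (b := c) (c := d) (d := b) (e := e) (f := f) [u, v, w, x] ?_ ?_ h1 h2
        · exact ((((List.Perm.swap b d _).cons c).trans (List.Perm.swap b c _)).cons a)
        · convert e2 using 2 <;> (ext z; simp only [Finset.mem_insert, Finset.mem_singleton]; tauto)
      · have e3 : col {c, d, e, f} = col {e, f, a, b} := by
          revert e1 e2
          cases col {a, b, c, d} <;> cases col {c, d, e, f} <;> cases col {e, f, a, b} <;> simp
        refine base_swap hnd hl (a := e) (b := c) (c := d) (d := f) (e := a) (f := b) [u, v, w, x] ?_ ?_ h1 h2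
        · have : ([e, c, d, f, a, b] : List V).Perm [a, b, c, d, e, f] := by
            have q : ([e, c, d, f] : List V).Perm [c, d, e, f] :=
              (List.Perm.swap c e _).trans ((List.Perm.swap d e _).cons c)
            exact (q.append_right [a, b]).trans (List.perm_append_comm (l₁ := [c, d, e, f]) (l₂ := [a, b]))
          exact this.append_right [u, v, w, x]
        · convert e3 using 2 <;> (ext z; simp only [Finset.mem_insert, Finset.mem_singleton]; tauto)

theorem mainInd [Fintype V] {col : Finset V → Bool} {n : ℕ} (hn : 3 ≤ n) :
    3 * n + n / 2 ≤ Fintype.card V → NoCyc col true n → NoCyc col false n → False := by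
  induction n, hn using Nat.le_induction with
  | base => exact fun hV h1 h2 => base3 hV h1 h2
  | succ m hm ih =>
    intro hV h1 h2
    refine ih (by omega) ?_ ?_
    · intro s J hw
      obtain ⟨g, a, b, c⟩ := cyc_g hw
      exact main_of_red hm ⟨a, b, c⟩ hV h1 h2
    · intro s J hw
      obtain ⟨g, a, b, c⟩ := cyc_g hw
      exact main_of_red (col := fun e => !col e) hm ⟨a, b, fun i hi => by simp [c i hi]⟩ hV
        (NoCyc.swap (by simpa using h2)) (NoCyc.swap (by simpa using h1))

theorem cyc_out {col : Finset V → Bool} {b : Bool} {n : ℕ} {s : V} {J : Finset V} (hn : 1 ≤ n)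
    (h : W col b n s s J) : ∃ f : ℕ → V, Set.InjOn f (Set.Iio (n * (4 - 1))) ∧
    ∀ i < n, col ((Finset.range 4).image fun j => f ((i * (4 - 1) + j) % (n * (4 - 1)))) = b := by
  obtain ⟨g, h1, h2, h3⟩ := cyc_g h
  have key : ∀ i, i ≤ 3 * n → g (i % (n * (4 - 1))) = g i := by
    intro i hi
    rcases Nat.lt_or_ge i (3 * n) with h | h
    · rw [Nat.mod_eq_of_lt (by omega)]
    · have : i = 3 * n := by omega
      subst this
      rw [show n * (4 - 1) = 3 * n by omega, Nat.mod_self, h2]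
  refine ⟨g, ?_, ?_⟩
  · intro i hi j hj e
    simp only [Set.mem_Iio] at hi hj
    rcases Nat.eq_zero_or_pos i with rfl | hi0 <;> rcases Nat.eq_zero_or_pos j with rfl | hj0
    · rfl
    · have := h1 (3 * n) j (by omega) (by omega) hj0 (by omega) (h2.trans e)
      omega
    · have := h1 i (3 * n) hi0 (by omega) (by omega) (by omega) (e.trans h2.symm)
      omega
    · exact h1 i j hi0 (by omega) hj0 (by omega) e
  · intro i hi
    rw [← h3 i hi]
    congr 1
    have e4 : (Finset.range 4) = {0, 1, 2, 3} := by decide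
    rw [e4]
    simp only [Finset.image_insert, Finset.image_singleton]
    rw [key _ (by omega), key _ (by omega), key _ (by omega), key _ (by omega)]
    rw [show i * (4 - 1) = 3 * i by omega]
    rfl

end LC

/-- Theorem 3.3: for every n ≥ 4, R(C⁴ₙ, C⁴ₙ) ≤ 3n + ⌊n/2⌋; that is, every red-blue
coloring of the 4-subsets of a set of 3n + ⌊n/2⌋ vertices contains a monochromatic
copy of C⁴ₙ. -/
theorem ramsey_C4n_C4n_upper (n : ℕ) (hn : 4 ≤ n) :
    RamseyCC 4 n n ≤ 3 * n + n / 2 ∧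
    ∀ col : Finset (Fin (3 * n + n / 2)) → Bool,
      HasLooseCycle 4 n col true ∨ HasLooseCycle 4 n col false := by
  have key : ∀ col : Finset (Fin (3 * n + n / 2)) → Bool,
      HasLooseCycle 4 n col true ∨ HasLooseCycle 4 n col false := by
    intro col
    by_contra hcon
    have h1 : ¬ HasLooseCycle 4 n col true := fun h => hcon (Or.inl h)
    have h2 : ¬ HasLooseCycle 4 n col false := fun h => hcon (Or.inr h)
    exact LC.mainInd (col := col) (n := n) (by omega) (by simp)
      (fun s J hw => h1 (LC.cyc_out (by omega) hw)) (fun s J hw => h2 (LC.cyc_out (by omega) hw))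
  exact ⟨Nat.sInf_le ⟨by omega, key⟩, key⟩
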